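/- Linear Entropy Power Inequality with quantum conditioning: Let X and Y be random variables with values in ℝⁿ correlated with a finite-dimensional quantum system M, with E‖X‖² and E‖Y‖² finite, with the map (x,y) ↦ ρ(x,y) (the state of M conditioned on X = x, Y = y) continuous in trace norm, with all conditional entropies involved finite, and with I(X:Y|M) = 0. Then for every 0 < λ < 1, S(X+Y|M) ≥ λ S(X|M) + (1−λ) S(Y|M) − n( λ ln λ + (1−λ) ln(1−λ) )/2. -/

import Mathlib

open MeasureTheory Real Filter Topology
open scoped ComplexOrder

noncomputable section

/-- `ℝⁿ`. -/
abbrev En (n : ℕ) := EuclideanSpace ℝ (Fin n)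

/-- The density of the standard Gaussian probability measure on `ℝⁿ`. -/
def gaussDensity (n : ℕ) (z : En n) : ℝ :=
  (2 * π) ^ (-(n : ℝ) / 2) * Real.exp (-‖z‖ ^ 2 / 2)

/-- A state of a finite-dimensional quantum system: a positive semidefinite matrix
with unit trace. -/
def IsState {ι : Type*} [Fintype ι] [DecidableEq ι] (ρ : Matrix ι ι ℂ) : Prop :=
  ρ.PosSemidef ∧ ρ.trace = 1

open scoped Classical in
/-- The von Neumann entropy `S(ρ) = -Σᵢ λᵢ ln λᵢ` of a (Hermitian) matrix, the sum running
over its eigenvalues (with the convention `0 ln 0 = 0`; junk value `0` on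
non-Hermitian matrices). -/
def vnEnt {ι : Type*} [Fintype ι] [DecidableEq ι] (ρ : Matrix ι ι ℂ) : ℝ :=
  if h : ρ.IsHermitian then -∑ i, h.eigenvalues i * Real.log (h.eigenvalues i) else 0

/-- The classical (differential or discrete) entropy `S = -∫ p ln p` of a density `p`. -/
def clEnt {α : Type*} [MeasureSpace α] (p : α → ℝ) : ℝ := -∫ a, p a * Real.log (p a)

/-- The average state `∫ p(a) ρ(a) da` of a classical-quantum state. -/
def avgState {α : Type*} [MeasureSpace α] {d : ℕ} (p : α → ℝ)
    (ρ : α → Matrix (Fin d) (Fin d) ℂ) : Matrix (Fin d) (Fin d) ℂ :=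
  Matrix.of fun i j => ∫ a, (p a : ℂ) * ρ a i j

/-- The conditional entropy `S(A|M) = S(M|A) + S(A) - S(M)` of the classical system `A`
of a classical-quantum state `(p, ρ)` given the quantum system `M`. -/
def condEnt {α : Type*} [MeasureSpace α] {d : ℕ} (p : α → ℝ)
    (ρ : α → Matrix (Fin d) (Fin d) ℂ) : ℝ :=
  (∫ a, p a * vnEnt (ρ a)) + clEnt p - vnEnt (avgState p ρ)

/-- The integrability conditions expressing that the conditional entropy `S(A|M)` of the
classical-quantum state `(p, ρ)` is finite. -/
def EntFinite {α : Type*} [MeasureSpace α] {d : ℕ} (p : α → ℝ)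
    (ρ : α → Matrix (Fin d) (Fin d) ℂ) : Prop :=
  Integrable (fun a => p a * Real.log (p a)) ∧ Integrable (fun a => p a * vnEnt (ρ a))

/-- The marginal density of the first variable of a joint density on `ℝⁿ × ℝⁿ`. -/
def margFst {n : ℕ} (p : En n × En n → ℝ) : En n → ℝ := fun x => ∫ y, p (x, y)

/-- The state of `M` conditioned on the first classical variable:
`ρ_X(x) = (∫ p(x,y) ρ(x,y) dy) / p_X(x)`. -/
def margFstState {n d : ℕ} (p : En n × En n → ℝ)
    (ρ : En n × En n → Matrix (Fin d) (Fin d) ℂ) : En n → Matrix (Fin d) (Fin d) ℂ :=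
  fun x => ((margFst p x : ℂ))⁻¹ • Matrix.of fun i j => ∫ y, (p (x, y) : ℂ) * ρ (x, y) i j

/-- The marginal density of the second variable of a joint density on `ℝⁿ × ℝⁿ`. -/
def margSnd {n : ℕ} (p : En n × En n → ℝ) : En n → ℝ := fun y => ∫ x, p (x, y)

/-- The state of `M` conditioned on the second classical variable. -/
def margSndState {n d : ℕ} (p : En n × En n → ℝ)
    (ρ : En n × En n → Matrix (Fin d) (Fin d) ℂ) : En n → Matrix (Fin d) (Fin d) ℂ :=
  fun y => ((margSnd p y : ℂ))⁻¹ • Matrix.of fun i j => ∫ x, (p (x, y) : ℂ) * ρ (x, y) i j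

/-- The density of the sum `X + Y`: `p_S(s) = ∫ p(x, s - x) dx`. -/
def sumDensity {n : ℕ} (p : En n × En n → ℝ) : En n → ℝ := fun s => ∫ x, p (x, s - x)

/-- The state of `M` conditioned on `X + Y = s`. -/
def sumState {n d : ℕ} (p : En n × En n → ℝ)
    (ρ : En n × En n → Matrix (Fin d) (Fin d) ℂ) : En n → Matrix (Fin d) (Fin d) ℂ :=
  fun s => ((sumDensity p s : ℂ))⁻¹ •
    Matrix.of fun i j => ∫ x, (p (x, s - x) : ℂ) * ρ (x, s - x) i j

/-- The conditional mutual information `I(X:Y|M) = S(X|M) + S(Y|M) - S(X,Y|M)` of the two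
classical variables of a joint classical-quantum state on `ℝⁿ × ℝⁿ` given `M`. -/
def condMI {n d : ℕ} (p : En n × En n → ℝ)
    (ρ : En n × En n → Matrix (Fin d) (Fin d) ℂ) : ℝ :=
  condEnt (margFst p) (margFstState p ρ) + condEnt (margSnd p) (margSndState p ρ)
    - condEnt p ρ

/-- The joint density of `(A + c Z, Z)` where `A` has density `q` and `Z` is an independent
standard Gaussian. -/
def noisyDensity {n : ℕ} (c : ℝ) (q : En n → ℝ) : En n × En n → ℝ :=
  fun wz => gaussDensity n wz.2 * q (wz.1 - c • wz.2)

/-- The state of `M` conditioned on `A + c Z = w` and `Z = z`, namely `σ(w - c z)`. -/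
def noisyState {n d : ℕ} (c : ℝ) (σ : En n → Matrix (Fin d) (Fin d) ℂ) :
    En n × En n → Matrix (Fin d) (Fin d) ℂ :=
  fun wz => σ (wz.1 - c • wz.2)

/-- The mutual information `I(A + c Z : Z | M)` for a classical-quantum state `(q, σ)`. -/
def noisyMI {n d : ℕ} (c : ℝ) (q : En n → ℝ) (σ : En n → Matrix (Fin d) (Fin d) ℂ) : ℝ :=
  condMI (noisyDensity c q) (noisyState c σ)

/-- The heat-semigroup-evolved conditional entropy `t ↦ S(A + √t Z | M)`. -/
def heatEnt {n d : ℕ} (q : En n → ℝ) (σ : En n → Matrix (Fin d) (Fin d) ℂ) (t : ℝ) : ℝ :=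
  condEnt (margFst (noisyDensity (Real.sqrt t) q))
    (margFstState (noisyDensity (Real.sqrt t) q) (noisyState (Real.sqrt t) σ))

/-- The difference quotient `I(A + √t Z : Z | M) / t` whose limit as `t → 0⁺` is the
conditional Fisher information `J(A|M)`. -/
def fisherSlope {n d : ℕ} (q : En n → ℝ) (σ : En n → Matrix (Fin d) (Fin d) ℂ) (t : ℝ) : ℝ :=
  noisyMI (Real.sqrt t) q σ / t

/-- The conditional Fisher information `J(A|M) = lim_{t→0⁺} I(A + √t Z : Z | M) / t`, as an
extended real number (the limit always exists, and is computed here as a `limsup`). -/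
def condFisher {n d : ℕ} (q : En n → ℝ) (σ : En n → Matrix (Fin d) (Fin d) ℂ) : EReal :=
  Filter.limsup (fun t : ℝ => ((fisherSlope q σ t : ℝ) : EReal)) (𝓝[>] (0 : ℝ))

/-- The basic regularity hypotheses on a classical-quantum state `(p, ρ)`:
`p` is a probability density and `ρ` is a (trace-norm continuous) family of states. -/
def IsCQState {α : Type*} [MeasureSpace α] [TopologicalSpace α] {d : ℕ} (p : α → ℝ)
    (ρ : α → Matrix (Fin d) (Fin d) ℂ) : Prop :=
  Measurable p ∧ (∀ a, 0 ≤ p a) ∧ (∫ a, p a) = 1 ∧ Continuous ρ ∧ ∀ a, IsState (ρ a)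


section epi_proof

open scoped Matrix ENNReal Matrix.Norms.Elementwise

abbrev Mat (d : ℕ) := Matrix (Fin d) (Fin d) ℂ

/-- real part of the trace -/
def rtr {d : ℕ} (A : Mat d) : ℝ := A.trace.re

def ell {d : ℕ} (t : ℝ) (X ρ σ : Mat d) : ℝ :=
  2 * rtr (Xᴴ * (ρ - σ)) - rtr (Xᴴ * σ * X) - t * rtr (X * ρ * Xᴴ)

def KK {d : ℕ} (t : ℝ) (ρ σ : Mat d) : ℝ≥0∞ := ⨆ X : Mat d, ENNReal.ofReal (ell t X ρ σ)

/-- relative entropy `tr ρ (ln ρ - ln σ) - tr ρ + tr σ` -/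
def D0 {d : ℕ} (ρ σ : Mat d) : ℝ≥0∞ :=
  ∫⁻ t in Set.Ioi (0:ℝ), ENNReal.ofReal (1 / (1 + t) ^ 2) * KK t ρ σ

lemma rtr_conj {d : ℕ} (U A : Mat d) (hU : star U * U = 1) : rtr (U * A * star U) = rtr A := by
  unfold rtr
  rw [Matrix.trace_mul_comm, ← mul_assoc, hU, one_mul]

lemma rtr_diag {d : ℕ} (p : Fin d → ℝ) :
    rtr (Matrix.diagonal (fun i => (p i : ℂ))) = ∑ i, p i := by
  simp [rtr, Matrix.trace_diagonal]

lemma rtr_mul_diag {d : ℕ} (Y W : Mat d) (p q : Fin d → ℝ) :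
    rtr (Yᴴ * (Matrix.diagonal (fun i => (q i : ℂ)) * W * Matrix.diagonal (fun i => (p i : ℂ))))
      = ∑ j, ∑ i, q j * p i * (star (Y j i) * W j i).re := by
  unfold rtr
  rw [Matrix.trace_mul_comm]
  rw [Matrix.trace, Complex.re_sum]
  refine Finset.sum_congr rfl fun j _ => ?_
  rw [Matrix.diag_apply, Matrix.mul_apply, Complex.re_sum]
  refine Finset.sum_congr rfl fun i _ => ?_
  rw [Matrix.mul_diagonal, Matrix.diagonal_mul, Matrix.conjTranspose_apply]
  have : (q j : ℂ) * W j i * (p i : ℂ) * star (Y j i)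
      = ((q j * p i : ℝ) : ℂ) * (star (Y j i) * W j i) := by push_cast; ring
  rw [this, Complex.re_ofReal_mul]

lemma ell_spec {d : ℕ} (t : ℝ) (U V Y : Mat d) (p q : Fin d → ℝ)
    (hU : star U * U = 1) (hV : star V * V = 1) :
    ell t (V * Y * star U) (U * Matrix.diagonal (fun i => (p i : ℂ)) * star U)
      (V * Matrix.diagonal (fun i => (q i : ℂ)) * star V)
    = ∑ j, ∑ i, (2 * (p i - q j) * (star (Y j i) * (star V * U) j i).re
        - (q j + t * p i) * ‖Y j i‖ ^ 2) := by
  set P := Matrix.diagonal (fun i => (p i : ℂ)) with hP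
  set Q := Matrix.diagonal (fun i => (q i : ℂ)) with hQ
  have hone : (Matrix.diagonal (fun _ : Fin d => ((1:ℝ) : ℂ))) = 1 := by simp
  simp only [Matrix.star_eq_conjTranspose] at *
  have hX : (V * Y * Uᴴ)ᴴ = U * Yᴴ * Vᴴ := by
    simp [Matrix.conjTranspose_mul, mul_assoc]
  have e1 : rtr ((V * Y * Uᴴ)ᴴ * (U * P * Uᴴ - V * Q * Vᴴ))
      = ∑ j, ∑ i, (p i - q j) * (star (Y j i) * (Vᴴ * U) j i).re := by
    have a1 : rtr (U * (Yᴴ * (Vᴴ * U * P)) * Uᴴ) = rtr (Yᴴ * (1 * (Vᴴ * U) * P)) := by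
      have := rtr_conj U (Yᴴ * (Vᴴ * U * P)) hU
      rw [Matrix.star_eq_conjTranspose] at this
      rw [this, one_mul]
    have a2 : rtr (U * (Yᴴ * (Q * (Vᴴ * U))) * Uᴴ) = rtr (Yᴴ * (Q * (Vᴴ * U) * 1)) := by
      have := rtr_conj U (Yᴴ * (Q * (Vᴴ * U))) hU
      rw [Matrix.star_eq_conjTranspose] at this
      rw [this, mul_one]
    have hUU : U * Uᴴ = 1 := mul_eq_one_comm.mp hU
    have b : (V * Y * Uᴴ)ᴴ * (U * P * Uᴴ - V * Q * Vᴴ) =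
        U * (Yᴴ * (Vᴴ * U * P)) * Uᴴ - U * (Yᴴ * (Q * (Vᴴ * U))) * Uᴴ := by
      rw [hX, mul_sub]
      congr 1
      · simp only [mul_assoc]
      · calc U * Yᴴ * Vᴴ * (V * Q * Vᴴ) = U * Yᴴ * (Vᴴ * V) * Q * Vᴴ := by simp only [mul_assoc]
          _ = U * Yᴴ * Q * Vᴴ * (U * Uᴴ) := by rw [hV, hUU]; simp
          _ = _ := by simp only [mul_assoc]
    have c : rtr (U * (Yᴴ * (Vᴴ * U * P)) * Uᴴ - U * (Yᴴ * (Q * (Vᴴ * U))) * Uᴴ) =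
      rtr (U * (Yᴴ * (Vᴴ * U * P)) * Uᴴ) - rtr (U * (Yᴴ * (Q * (Vᴴ * U))) * Uᴴ) := by
      simp [rtr, Matrix.trace_sub]
    rw [b, c, a1, a2]
    conv_lhs => rw [← hone]
    rw [hP, hQ, rtr_mul_diag, rtr_mul_diag]
    simp only [← Finset.sum_sub_distrib]
    refine Finset.sum_congr rfl fun j _ => Finset.sum_congr rfl fun i _ => ?_
    ring
  have nrm : ∀ z : ℂ, (star z * z).re = ‖z‖ ^ 2 := by
    intro z
    rw [Complex.star_def, ← Complex.normSq_eq_conj_mul_self, Complex.ofReal_re,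
      Complex.normSq_eq_norm_sq]
  have e2 : rtr ((V * Y * Uᴴ)ᴴ * (V * Q * Vᴴ) * (V * Y * Uᴴ))
      = ∑ j, ∑ i, q j * ‖Y j i‖ ^ 2 := by
    have b : (V * Y * Uᴴ)ᴴ * (V * Q * Vᴴ) * (V * Y * Uᴴ) = U * (Yᴴ * (Q * Y * 1)) * Uᴴ := by
      rw [hX]
      calc U * Yᴴ * Vᴴ * (V * Q * Vᴴ) * (V * Y * Uᴴ)
          = U * Yᴴ * (Vᴴ * V) * Q * (Vᴴ * V) * Y * Uᴴ := by simp only [mul_assoc]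
        _ = _ := by rw [hV]; simp [mul_assoc]
    have := rtr_conj U (Yᴴ * (Q * Y * 1)) hU
    rw [Matrix.star_eq_conjTranspose] at this
    rw [b, this, ← hone, hQ, rtr_mul_diag]
    simp only [nrm, one_mul, mul_one]
  have e3 : rtr ((V * Y * Uᴴ) * (U * P * Uᴴ) * (V * Y * Uᴴ)ᴴ)
      = ∑ j, ∑ i, p i * ‖Y j i‖ ^ 2 := by
    have b : (V * Y * Uᴴ) * (U * P * Uᴴ) * (V * Y * Uᴴ)ᴴ = V * (Y * P * Yᴴ) * Vᴴ := by
      rw [hX]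
      calc (V * Y * Uᴴ) * (U * P * Uᴴ) * (U * Yᴴ * Vᴴ)
          = V * Y * (Uᴴ * U) * P * (Uᴴ * U) * Yᴴ * Vᴴ := by simp only [mul_assoc]
        _ = _ := by rw [hU]; simp [mul_assoc]
    have := rtr_conj V (Y * P * Yᴴ) hV
    rw [Matrix.star_eq_conjTranspose] at this
    have h2 : rtr (Y * P * Yᴴ) = rtr (Yᴴ * (1 * Y * P)) := by
      unfold rtr; rw [Matrix.trace_mul_comm, one_mul]
    rw [b, this, h2, ← hone, hP, rtr_mul_diag]
    simp only [nrm, one_mul, mul_one]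
  unfold ell
  rw [e1, e2, e3, Finset.mul_sum, Finset.mul_sum, ← Finset.sum_sub_distrib,
    ← Finset.sum_sub_distrib]
  refine Finset.sum_congr rfl fun j _ => ?_
  rw [Finset.mul_sum, Finset.mul_sum, ← Finset.sum_sub_distrib, ← Finset.sum_sub_distrib]
  refine Finset.sum_congr rfl fun i _ => ?_
  ring

lemma scalar_sup (w y : ℂ) (a b : ℝ) (hb : 0 ≤ b) (hab : b = 0 → a = 0) :
    2 * a * (star y * w).re - b * ‖y‖ ^ 2 ≤ ‖w‖ ^ 2 * (a ^ 2 / b) := by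
  rcases hb.eq_or_lt with h | h
  · rw [hab h.symm, ← h]; simp
  · have h1 : (star y * w).re ≤ ‖y‖ * ‖w‖ := by
      calc _ ≤ ‖star y * w‖ := Complex.re_le_norm _
        _ = _ := by rw [norm_mul, norm_star]
    have h2 : -(‖y‖ * ‖w‖) ≤ (star y * w).re := by
      have := Complex.abs_re_le_norm (star y * w)
      rw [norm_mul, norm_star] at this
      exact (abs_le.mp this).1
    have h3 : 2 * a * (star y * w).re ≤ 2 * |a| * (‖y‖ * ‖w‖) := by
      rcases abs_cases a with ⟨e, _⟩ | ⟨e, _⟩ <;> rw [e] <;> nlinarith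
    have : ‖w‖ ^ 2 * (a ^ 2 / b) = (‖w‖ * |a|) ^ 2 / b := by rw [mul_pow, sq_abs]; ring
    rw [this, le_div_iff₀ h]
    nlinarith [sq_nonneg (‖w‖ * |a| - b * ‖y‖)]

lemma scalar_att (w : ℂ) (a b : ℝ) :
    2 * a * (star (((a / b : ℝ) : ℂ) * w) * w).re - b * ‖((a / b : ℝ) : ℂ) * w‖ ^ 2
      = ‖w‖ ^ 2 * (a ^ 2 / b) := by
  have nrm : ∀ z : ℂ, (star z * z).re = ‖z‖ ^ 2 := by
    intro z
    rw [Complex.star_def, ← Complex.normSq_eq_conj_mul_self, Complex.ofReal_re,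
      Complex.normSq_eq_norm_sq]
  have : star (((a / b : ℝ) : ℂ) * w) * w = ((a / b : ℝ) : ℂ) * (star w * w) := by
    rw [star_mul']; simp [mul_assoc]
  rw [this, Complex.re_ofReal_mul, nrm, norm_mul, Complex.norm_real, mul_pow, Real.norm_eq_abs,
    sq_abs]
  by_cases h : b = 0
  · simp [h]
  · field_simp; ring

lemma KK_spec {d : ℕ} {t : ℝ} (ht : 0 < t) (U V : Mat d) (p q : Fin d → ℝ)
    (hU : star U * U = 1) (hV : star V * V = 1) (hp : ∀ i, 0 ≤ p i) (hq : ∀ i, 0 ≤ q i) :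
    KK t (U * Matrix.diagonal (fun i => (p i : ℂ)) * star U)
      (V * Matrix.diagonal (fun i => (q i : ℂ)) * star V)
    = ENNReal.ofReal (∑ j, ∑ i, ‖(star V * U) j i‖ ^ 2 * ((p i - q j) ^ 2 / (q j + t * p i))) := by
  have hVV : V * star V = 1 := mul_eq_one_comm.mp hV
  have hUU : U * star U = 1 := mul_eq_one_comm.mp hU
  unfold KK
  apply le_antisymm
  · refine iSup_le fun X => ENNReal.ofReal_le_ofReal ?_
    have hX : X = V * (star V * X * U) * star U := by
      calc X = (V * star V) * X * (U * star U) := by rw [hVV, hUU]; simp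
        _ = _ := by simp only [mul_assoc]
    rw [hX, ell_spec t U V _ p q hU hV]
    refine Finset.sum_le_sum fun j _ => Finset.sum_le_sum fun i _ => ?_
    refine scalar_sup _ _ _ _ (by have := hp i; have := hq j; positivity) fun h => ?_
    have h1 := hq j
    have h2 : 0 ≤ t * p i := mul_nonneg ht.le (hp i)
    have h3 : q j = 0 := by linarith
    have h4 : t * p i = 0 := by linarith
    have h5 : p i = 0 := by rcases mul_eq_zero.mp h4 with h | h; exact absurd h ht.ne'; exact h
    rw [h3, h5]; simp
  · refine le_iSup_of_le (V * (Matrix.of fun j i =>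
      (((p i - q j) / (q j + t * p i) : ℝ) : ℂ) * (star V * U) j i) * star U) ?_
    apply ENNReal.ofReal_le_ofReal
    rw [ell_spec t U V _ p q hU hV]
    refine Finset.sum_le_sum fun j _ => Finset.sum_le_sum fun i _ => ?_
    rw [Matrix.of_apply, scalar_att]

lemma scalar_int {p q : ℝ} (hp : 0 ≤ p) (hq : 0 ≤ q) (hpq : q = 0 → p = 0) :
    (∫⁻ t in Set.Ioi (0:ℝ), ENNReal.ofReal (1 / (1 + t) ^ 2 * ((p - q) ^ 2 / (q + t * p))))
      = ENNReal.ofReal (p * log p - p * log q - p + q) ∧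
    0 ≤ p * log p - p * log q - p + q := by
  rcases hq.eq_or_lt with h | h
  · rw [hpq h.symm, ← h]; simp
  have hpos : ∀ x : ℝ, 0 ≤ x → 0 < q + x * p := fun x hx => by positivity
  have hder : ∀ x ∈ Set.Ici (0:ℝ), HasDerivAt
      (fun x : ℝ => p * (log (q + x * p) - log (1 + x)) + (p - q) / (1 + x))
      (1 / (1 + x) ^ 2 * ((p - q) ^ 2 / (q + x * p))) x := by
    intro x hx
    have hx0 : (0:ℝ) ≤ x := hx
    have h1 : 0 < 1 + x := by linarith
    have h2 := hpos x hx0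
    have d1 : HasDerivAt (fun x : ℝ => q + x * p) p x := by
      simpa using ((hasDerivAt_id x).mul_const p).const_add q
    have d2 : HasDerivAt (fun x : ℝ => 1 + x) 1 x := by
      simpa using (hasDerivAt_id x).const_add 1
    have := (((d1.log h2.ne').sub (d2.log h1.ne')).const_mul p).add
      ((hasDerivAt_const x (p - q)).div d2 h1.ne')
    convert! this using 1
    field_simp
    ring
  have hlim : Tendsto (fun x : ℝ => p * (log (q + x * p) - log (1 + x)) + (p - q) / (1 + x)) atTop
      (𝓝 (p * log p)) := by
    have hz : Tendsto (fun x : ℝ => (p - q) / (1 + x)) atTop (𝓝 0) :=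
      Tendsto.div_atTop tendsto_const_nhds (tendsto_atTop_add_const_left _ _ tendsto_id)
    rcases hp.eq_or_lt with h0 | h0
    · rw [← h0] at hz ⊢
      simpa using hz
    · have h1 : Tendsto (fun x : ℝ => p + (q - p) / (1 + x)) atTop (𝓝 (p + 0)) :=
        tendsto_const_nhds.add
        (Tendsto.div_atTop tendsto_const_nhds (tendsto_atTop_add_const_left _ _ tendsto_id))
      rw [add_zero] at h1
      have h2 := ((h1.log h0.ne').const_mul p).add hz
      rw [add_zero] at h2
      refine h2.congr' ?_
      filter_upwards [eventually_ge_atTop (0:ℝ)] with x hx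
      have h3 : 0 < 1 + x := by linarith
      have h4 := hpos x hx
      rw [← Real.log_div h4.ne' h3.ne']
      congr 3
      field_simp
      ring
  have hnn : ∀ x ∈ Set.Ioi (0:ℝ), 0 ≤ 1 / (1 + x) ^ 2 * ((p - q) ^ 2 / (q + x * p)) := by
    intro x hx
    have := hpos x (le_of_lt hx)
    positivity
  have hI := integrableOn_Ioi_deriv_of_nonneg' hder hnn hlim
  have hE := integral_Ioi_of_hasDerivAt_of_nonneg' hder hnn hlim
  have hE' : ∫ x in Set.Ioi (0:ℝ), 1 / (1 + x) ^ 2 * ((p - q) ^ 2 / (q + x * p))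
      = p * log p - p * log q - p + q := by rw [hE]; simp; ring
  constructor
  · rw [← hE', ofReal_integral_eq_lintegral_ofReal hI]
    exact (ae_restrict_iff' measurableSet_Ioi).mpr (Eventually.of_forall hnn)
  · rw [← hE']
    exact setIntegral_nonneg measurableSet_Ioi hnn

lemma D0_spec {d : ℕ} (U V : Mat d) (p q : Fin d → ℝ)
    (hU : star U * U = 1) (hV : star V * V = 1) (hp : ∀ i, 0 ≤ p i) (hq : ∀ i, 0 ≤ q i)
    (hW : ∀ j i, q j = 0 → p i ≠ 0 → (star V * U) j i = 0) :
    D0 (U * Matrix.diagonal (fun i => (p i : ℂ)) * star U)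
      (V * Matrix.diagonal (fun i => (q i : ℂ)) * star V)
    = ENNReal.ofReal (∑ j, ∑ i, ‖(star V * U) j i‖ ^ 2 *
        (p i * log (p i) - p i * log (q j) - p i + q j)) ∧
    0 ≤ ∑ j, ∑ i, ‖(star V * U) j i‖ ^ 2 *
        (p i * log (p i) - p i * log (q j) - p i + q j) := by
  have key : ∀ j i, (∫⁻ t in Set.Ioi (0:ℝ), ENNReal.ofReal (1 / (1 + t) ^ 2 *
      (‖(star V * U) j i‖ ^ 2 * ((p i - q j) ^ 2 / (q j + t * p i)))))
      = ENNReal.ofReal (‖(star V * U) j i‖ ^ 2 *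
        (p i * log (p i) - p i * log (q j) - p i + q j)) ∧ 0 ≤ ‖(star V * U) j i‖ ^ 2 *
        (p i * log (p i) - p i * log (q j) - p i + q j) := by
    intro j i
    by_cases h : q j = 0 ∧ p i ≠ 0
    · rw [hW j i h.1 h.2]; simp
    · have h' : q j = 0 → p i = 0 := by tauto
      obtain ⟨h1, h2⟩ := scalar_int (hp i) (hq j) h'
      refine ⟨?_, by positivity⟩
      rw [ENNReal.ofReal_mul (by positivity), ← h1, ← lintegral_const_mul' _ _ (by simp)]
      refine lintegral_congr fun t => ?_
      rw [← ENNReal.ofReal_mul (by positivity)]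
      congr 1; ring
  have nn : ∀ t ∈ Set.Ioi (0:ℝ), ∀ j i, 0 ≤ 1 / (1 + t) ^ 2 *
      (‖(star V * U) j i‖ ^ 2 * ((p i - q j) ^ 2 / (q j + t * p i))) := by
    intro t ht j i
    have := hp i; have := hq j; have : (0:ℝ) < t := ht
    positivity
  refine ⟨?_, Finset.sum_nonneg fun j _ => Finset.sum_nonneg fun i _ => (key j i).2⟩
  unfold D0
  have e : ∀ t ∈ Set.Ioi (0:ℝ), ENNReal.ofReal (1 / (1 + t) ^ 2) *
      KK t (U * Matrix.diagonal (fun i => (p i : ℂ)) * star U)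
      (V * Matrix.diagonal (fun i => (q i : ℂ)) * star V)
      = ∑ j, ∑ i, ENNReal.ofReal (1 / (1 + t) ^ 2 *
      (‖(star V * U) j i‖ ^ 2 * ((p i - q j) ^ 2 / (q j + t * p i)))) := by
    intro t ht
    rw [KK_spec ht U V p q hU hV hp hq, ← ENNReal.ofReal_mul (by positivity), Finset.mul_sum,
      ENNReal.ofReal_sum_of_nonneg]
    · refine Finset.sum_congr rfl fun j _ => ?_
      rw [Finset.mul_sum, ENNReal.ofReal_sum_of_nonneg]
      exact fun i _ => nn t ht j i
    · intro j _
      rw [Finset.mul_sum]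
      exact Finset.sum_nonneg fun i _ => nn t ht j i
  rw [setLIntegral_congr_fun measurableSet_Ioi e, lintegral_finsetSum']
  · rw [ENNReal.ofReal_sum_of_nonneg]
    · refine Finset.sum_congr rfl fun j _ => ?_
      rw [lintegral_finsetSum', ENNReal.ofReal_sum_of_nonneg]
      · exact Finset.sum_congr rfl fun i _ => (key j i).1
      · exact fun i _ => (key j i).2
      · intro i _; fun_prop
    · exact fun j _ => Finset.sum_nonneg fun i _ => (key j i).2
  · intro j _; fun_prop

lemma unit_row {d : ℕ} (W : Mat d) (hW : W * star W = 1) (j : Fin d) :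
    ∑ i, ‖W j i‖ ^ 2 = 1 := by
  have h := congrFun (congrFun hW j) j
  rw [Matrix.mul_apply, Matrix.one_apply_eq] at h
  have h2 := congrArg Complex.re h
  rw [Complex.re_sum] at h2
  rw [Complex.one_re] at h2
  rw [← h2]
  refine Finset.sum_congr rfl fun i _ => ?_
  rw [Matrix.star_apply, Complex.star_def, Complex.mul_conj, Complex.ofReal_re,
    Complex.normSq_eq_norm_sq]

lemma unit_col {d : ℕ} (W : Mat d) (hW : star W * W = 1) (i : Fin d) :
    ∑ j, ‖W j i‖ ^ 2 = 1 := by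
  have := unit_row (star W) (by rwa [star_star]) i
  rw [← this]
  refine Finset.sum_congr rfl fun j _ => ?_
  rw [Matrix.star_apply, norm_star]

lemma W_unit {d : ℕ} {U V : Mat d} (hU : star U * U = 1) (hV : star V * V = 1) :
    star (star V * U) * (star V * U) = 1 ∧ (star V * U) * star (star V * U) = 1 := by
  have hVV : V * star V = 1 := mul_eq_one_comm.mp hV
  have h : star (star V * U) * (star V * U) = 1 := by
    rw [star_mul, star_star]
    calc star U * V * (star V * U) = star U * (V * star V) * U := by simp only [mul_assoc]
      _ = 1 := by rw [hVV, mul_one, hU]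
  exact ⟨h, mul_eq_one_comm.mp h⟩

lemma sum_spec {d : ℕ} (U V : Mat d) (p q l : Fin d → ℝ)
    (hU : star U * U = 1) (hV : star V * V = 1) :
    ∑ j, ∑ i, ‖(star V * U) j i‖ ^ 2 * (p i * log (p i) - p i * l j - p i + q j)
      = ∑ i, p i * log (p i) - (∑ j, ∑ i, ‖(star V * U) j i‖ ^ 2 * (p i * l j))
        - ∑ i, p i + ∑ j, q j := by
  obtain ⟨h1, h2⟩ := W_unit hU hV
  have e1 : ∀ f : Fin d → ℝ, ∑ j, ∑ i, ‖(star V * U) j i‖ ^ 2 * f i = ∑ i, f i := by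
    intro f
    rw [Finset.sum_comm]
    refine Finset.sum_congr rfl fun i _ => ?_
    rw [← Finset.sum_mul, unit_col _ h1, one_mul]
  have e2 : ∀ f : Fin d → ℝ, ∑ j, ∑ i, ‖(star V * U) j i‖ ^ 2 * f j = ∑ j, f j := by
    intro f
    refine Finset.sum_congr rfl fun i _ => ?_
    rw [← Finset.sum_mul, unit_row _ h2, one_mul]
  have : ∑ j, ∑ i, ‖(star V * U) j i‖ ^ 2 * (p i * log (p i) - p i * l j - p i + q j)
      = (∑ j, ∑ i, ‖(star V * U) j i‖ ^ 2 * (p i * log (p i)))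
        - (∑ j, ∑ i, ‖(star V * U) j i‖ ^ 2 * (p i * l j))
        - (∑ j, ∑ i, ‖(star V * U) j i‖ ^ 2 * p i)
        + ∑ j, ∑ i, ‖(star V * U) j i‖ ^ 2 * q j := by
    simp only [← Finset.sum_sub_distrib, ← Finset.sum_add_distrib]
    refine Finset.sum_congr rfl fun j _ => Finset.sum_congr rfl fun i _ => ?_
    ring
  rw [this, e1, e1, e2]

lemma rtr_spec {d : ℕ} (U : Mat d) (p : Fin d → ℝ) (hU : star U * U = 1) :
    rtr (U * Matrix.diagonal (fun i => (p i : ℂ)) * star U) = ∑ i, p i := by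
  rw [rtr_conj _ _ hU, rtr_diag]

lemma herm_spec {d : ℕ} {A : Mat d} (hA : A.IsHermitian) :
    A = (hA.eigenvectorUnitary : Mat d) * Matrix.diagonal (fun i => (hA.eigenvalues i : ℂ))
      * star (hA.eigenvectorUnitary : Mat d) := by
  have := hA.spectral_theorem
  rw [Unitary.conjStarAlgAut_apply] at this
  exact this

lemma eU_unit {d : ℕ} {A : Mat d} (hA : A.IsHermitian) :
    star (hA.eigenvectorUnitary : Mat d) * (hA.eigenvectorUnitary : Mat d) = 1 :=
  Unitary.coe_star_mul_self _

lemma D0_one {d : ℕ} (U : Mat d) (p : Fin d → ℝ)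
    (hU : star U * U = 1) (hp : ∀ i, 0 ≤ p i) :
    (D0 (U * Matrix.diagonal (fun i => (p i : ℂ)) * star U) 1).toReal
      = ∑ i, p i * log (p i) - ∑ i, p i + d := by
  have h1 := D0_spec U 1 p (fun _ => 1) hU (by simp) hp (by simp) (by simp)
  have e : (1 : Mat d) * Matrix.diagonal (fun i => (((1:ℝ)) : ℂ)) * star 1 = 1 := by simp
  rw [e, sum_spec U 1 p _ (fun _ => log 1) hU (by simp)] at h1
  rw [h1.1, ENNReal.toReal_ofReal h1.2]
  simp

lemma vnEnt_spec {d : ℕ} (U : Mat d) (p : Fin d → ℝ)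
    (hU : star U * U = 1) (hp : ∀ i, 0 ≤ p i) :
    vnEnt (U * Matrix.diagonal (fun i => (p i : ℂ)) * star U) = - ∑ i, p i * log (p i) := by
  set A := U * Matrix.diagonal (fun i => (p i : ℂ)) * star U with hA
  have hpsd : A.PosSemidef := by
    have : (Matrix.diagonal (fun i => (p i : ℂ))).PosSemidef := by
      rw [Matrix.posSemidef_diagonal_iff]
      intro i; exact_mod_cast hp i
    exact this.mul_mul_conjTranspose_same U
  have hh := hpsd.1
  have h1 := D0_one U p hU hp
  have h2 := D0_one _ hh.eigenvalues (eU_unit hh) hpsd.eigenvalues_nonneg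
  rw [← herm_spec hh] at h2
  rw [← hA] at h1
  have h3 := rtr_spec U p hU
  have h4 := rtr_spec _ hh.eigenvalues (eU_unit hh)
  rw [← herm_spec hh] at h4
  rw [← hA] at h3
  unfold vnEnt
  rw [dif_pos hh]
  linarith

lemma vnEnt_eig {d : ℕ} {A : Mat d} (hA : A.IsHermitian) :
    vnEnt A = - ∑ i, hA.eigenvalues i * log (hA.eigenvalues i) := by
  unfold vnEnt
  rw [dif_pos hA]

lemma rtr_eig {d : ℕ} {A : Mat d} (hA : A.IsHermitian) :
    rtr A = ∑ i, hA.eigenvalues i := by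
  conv_lhs => rw [herm_spec hA]
  exact rtr_spec _ _ (eU_unit hA)

lemma vnEnt_smul {d : ℕ} {A : Mat d} (hA : A.PosSemidef) {c : ℝ} (hc : 0 ≤ c) :
    vnEnt ((c : ℂ) • A) = c * vnEnt A - c * log c * rtr A := by
  have hh := hA.1
  have e : (c : ℂ) • A = (hh.eigenvectorUnitary : Mat d) *
      Matrix.diagonal (fun i => ((c * hh.eigenvalues i : ℝ) : ℂ))
      * star (hh.eigenvectorUnitary : Mat d) := by
    conv_lhs => rw [herm_spec hh]
    rw [← Matrix.smul_mul, ← Matrix.mul_smul]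
    congr 2
    ext i j
    by_cases h : i = j
    · subst h; simp
    · simp [h]
  rw [e, vnEnt_spec _ _ (eU_unit hh) (fun i => mul_nonneg hc (hA.eigenvalues_nonneg i)),
    vnEnt_eig hh, rtr_eig hh, Finset.mul_sum, mul_neg, Finset.mul_sum, ← neg_add', ← Finset.sum_add_distrib]
  congr 1
  refine Finset.sum_congr rfl fun i _ => ?_
  rcases hc.eq_or_lt with h | h
  · simp [← h]
  rcases (hA.eigenvalues_nonneg i).eq_or_lt with h' | h'
  · simp [← h']
  · rw [log_mul h.ne' h'.ne']; ring

open scoped Classical in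
/-- matrix logarithm (with `log 0 = 0`) -/
def logm {d : ℕ} (σ : Mat d) : Mat d :=
  if h : σ.IsHermitian then (h.eigenvectorUnitary : Mat d) *
    Matrix.diagonal (fun i => ((log (h.eigenvalues i) : ℝ) : ℂ))
      * star (h.eigenvectorUnitary : Mat d) else 0

def LL {d : ℕ} (ρ σ : Mat d) : ℝ := rtr (ρ * logm σ)

lemma LL_spec {d : ℕ} (U V : Mat d) (p l : Fin d → ℝ) :
    rtr (U * Matrix.diagonal (fun i => (p i : ℂ)) * star U *
      (V * Matrix.diagonal (fun i => (l i : ℂ)) * star V))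
      = ∑ j, ∑ i, ‖(star V * U) j i‖ ^ 2 * (p i * l j) := by
  have e : rtr (U * Matrix.diagonal (fun i => (p i : ℂ)) * star U *
      (V * Matrix.diagonal (fun i => (l i : ℂ)) * star V)) =
      rtr ((star V * U)ᴴ * (Matrix.diagonal (fun i => (l i : ℂ)) * (star V * U) *
        Matrix.diagonal (fun i => (p i : ℂ)))) := by
    unfold rtr
    have a : U * Matrix.diagonal (fun i => (p i : ℂ)) * star U *
      (V * Matrix.diagonal (fun i => (l i : ℂ)) * star V)
      = (U * Matrix.diagonal (fun i => (p i : ℂ))) * (star U *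
      V * Matrix.diagonal (fun i => (l i : ℂ)) * star V) := by simp only [mul_assoc]
    rw [a, Matrix.trace_mul_comm]
    congr 2
    simp only [Matrix.star_eq_conjTranspose, Matrix.conjTranspose_mul,
      Matrix.conjTranspose_conjTranspose, mul_assoc]
  rw [e, rtr_mul_diag]
  refine Finset.sum_congr rfl fun j _ => Finset.sum_congr rfl fun i _ => ?_
  rw [Complex.star_def, ← Complex.normSq_eq_conj_mul_self, Complex.ofReal_re,
      Complex.normSq_eq_norm_sq]
  ring

lemma W_zero {d : ℕ} {ρ σ : Mat d} (hρ : ρ.IsHermitian) (hσ : σ.IsHermitian)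
    (hk : ∀ v, σ *ᵥ v = 0 → ρ *ᵥ v = 0) (j i : Fin d) (hq : hσ.eigenvalues j = 0)
    (hp : hρ.eigenvalues i ≠ 0) :
    (star (hσ.eigenvectorUnitary : Mat d) * (hρ.eigenvectorUnitary : Mat d)) j i = 0 := by
  set U := (hρ.eigenvectorUnitary : Mat d)
  set V := (hσ.eigenvectorUnitary : Mat d)
  have h1 : σ *ᵥ (hσ.eigenvectorBasis j) = 0 := by
    rw [hσ.mulVec_eigenvectorBasis, hq]; simp
  have h2 := hk _ h1
  have h3 : ∀ k, (ρ * V) k j = 0 := by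
    intro k
    rw [Matrix.mul_apply]
    exact congrFun h2 k
  have h4 : star U * ρ * V = Matrix.diagonal (fun i => (hρ.eigenvalues i : ℂ)) * (star U * V) := by
    conv_lhs => rw [herm_spec hρ]
    calc star U * (U * Matrix.diagonal (fun i => (hρ.eigenvalues i : ℂ)) * star U) * V
        = (star U * U) * Matrix.diagonal (fun i => (hρ.eigenvalues i : ℂ)) * (star U * V) := by
          simp only [mul_assoc]
      _ = _ := by rw [eU_unit hρ, one_mul]
  have h5 : (star U * ρ * V) i j = 0 := by
    rw [mul_assoc, Matrix.mul_apply]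
    simp [h3]
  rw [h4, Matrix.diagonal_mul] at h5
  have h6 : (star U * V) i j = 0 := by
    rcases mul_eq_zero.mp h5 with h | h
    · exact absurd (by exact_mod_cast h) hp
    · exact h
  have h7 : star V * U = star (star U * V) := by rw [star_mul, star_star]
  rw [h7, Matrix.star_apply, h6, star_zero]

lemma LL_eig {d : ℕ} {ρ σ : Mat d} (hρ : ρ.IsHermitian) (hσ : σ.IsHermitian) :
    LL ρ σ = ∑ j, ∑ i, ‖(star (hσ.eigenvectorUnitary : Mat d) *
      (hρ.eigenvectorUnitary : Mat d)) j i‖ ^ 2 *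
      (hρ.eigenvalues i * log (hσ.eigenvalues j)) := by
  unfold LL logm
  rw [dif_pos hσ]
  conv_lhs => rw [herm_spec hρ]
  exact LL_spec _ _ _ _

lemma D0_formula {d : ℕ} {ρ σ : Mat d} (hρ : ρ.PosSemidef) (hσ : σ.PosSemidef)
    (hk : ∀ v, σ *ᵥ v = 0 → ρ *ᵥ v = 0) {c : ℝ} (hc : 0 < c) :
    D0 ρ ((c : ℂ) • σ) = ENNReal.ofReal
      (-vnEnt ρ - LL ρ σ - log c * rtr ρ - rtr ρ + c * rtr σ) ∧
      0 ≤ -vnEnt ρ - LL ρ σ - log c * rtr ρ - rtr ρ + c * rtr σ := by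
  set U := (hρ.1.eigenvectorUnitary : Mat d) with hU
  set V := (hσ.1.eigenvectorUnitary : Mat d) with hV
  have e : (c : ℂ) • σ = V * Matrix.diagonal (fun i => ((c * hσ.1.eigenvalues i : ℝ) : ℂ))
      * star V := by
    conv_lhs => rw [herm_spec hσ.1]
    rw [← Matrix.smul_mul, ← Matrix.mul_smul]
    congr 2
    ext i j
    by_cases h : i = j
    · subst h; simp
    · simp [h]
  have hW : ∀ j i, hσ.1.eigenvalues j = 0 → hρ.1.eigenvalues i ≠ 0 → (star V * U) j i = 0 :=
    fun j i h1 h2 => W_zero hρ.1 hσ.1 hk j i h1 h2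
  have h := D0_spec U V hρ.1.eigenvalues (fun i => c * hσ.1.eigenvalues i) (eU_unit hρ.1)
    (eU_unit hσ.1) hρ.eigenvalues_nonneg (fun i => mul_nonneg hc.le (hσ.eigenvalues_nonneg i))
    (by
      intro j i h1 h2
      refine hW j i ?_ h2
      rcases mul_eq_zero.mp h1 with h | h
      · exact absurd h hc.ne'
      · exact h)
  rw [← e, ← herm_spec hρ.1] at h
  have e2 : ∑ j, ∑ i, ‖(star V * U) j i‖ ^ 2 * (hρ.1.eigenvalues i * log (hρ.1.eigenvalues i) -
      hρ.1.eigenvalues i * log (c * hσ.1.eigenvalues j) -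
      hρ.1.eigenvalues i + c * hσ.1.eigenvalues j)
      = -vnEnt ρ - LL ρ σ - log c * rtr ρ - rtr ρ + c * rtr σ := by
    have e3 : ∀ j i, ‖(star V * U) j i‖ ^ 2 * (hρ.1.eigenvalues i * log (hρ.1.eigenvalues i) -
      hρ.1.eigenvalues i * log (c * hσ.1.eigenvalues j) -
      hρ.1.eigenvalues i + c * hσ.1.eigenvalues j) =
      ‖(star V * U) j i‖ ^ 2 * (hρ.1.eigenvalues i * log (hρ.1.eigenvalues i) -
      hρ.1.eigenvalues i * (log c + log (hσ.1.eigenvalues j)) -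
      hρ.1.eigenvalues i + c * hσ.1.eigenvalues j) := by
      intro j i
      by_cases h0 : hσ.1.eigenvalues j = 0
      · by_cases h1 : hρ.1.eigenvalues i = 0
        · rw [h1]; simp
        · rw [hW j i h0 h1]; simp
      · rw [log_mul hc.ne' h0]
    simp only [e3]
    rw [sum_spec U V _ _ _ (eU_unit hρ.1) (eU_unit hσ.1)]
    rw [vnEnt_eig hρ.1, LL_eig hρ.1 hσ.1, rtr_eig hσ.1, rtr_eig hρ.1, Finset.mul_sum,
      Finset.mul_sum, neg_neg]
    have e4 : ∑ j, ∑ i, ‖(star V * U) j i‖ ^ 2 * (hρ.1.eigenvalues i *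
        (log c + log (hσ.1.eigenvalues j)))
        = (∑ i, log c * hρ.1.eigenvalues i) + ∑ j, ∑ i, ‖(star V * U) j i‖ ^ 2 *
        (hρ.1.eigenvalues i * log (hσ.1.eigenvalues j)) := by
      have := W_unit (eU_unit hρ.1) (eU_unit hσ.1)
      have e5 : ∑ i, log c * hρ.1.eigenvalues i = ∑ j, ∑ i, ‖(star V * U) j i‖ ^ 2 *
          (log c * hρ.1.eigenvalues i) := by
        rw [Finset.sum_comm]
        refine Finset.sum_congr rfl fun i _ => ?_
        rw [← Finset.sum_mul, unit_col _ this.1, one_mul]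
      rw [e5, ← Finset.sum_add_distrib]
      refine Finset.sum_congr rfl fun j _ => ?_
      rw [← Finset.sum_add_distrib]
      refine Finset.sum_congr rfl fun i _ => ?_
      ring
    rw [e4]
    ring
  rw [e2] at h
  exact h

lemma LL_self {d : ℕ} {σ : Mat d} (hσ : σ.IsHermitian) : LL σ σ = - vnEnt σ := by
  rw [LL_eig hσ hσ, vnEnt_eig hσ, neg_neg]
  refine Finset.sum_congr rfl fun j _ => ?_
  rw [eU_unit hσ, Finset.sum_eq_single j]
  · simp
  · intro i _ hij; rw [Matrix.one_apply_ne hij.symm]; simp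
  · simp

lemma rtr_nonneg {d : ℕ} {A : Mat d} (hA : A.PosSemidef) : 0 ≤ rtr A := by
  rw [rtr_eig hA.1]; exact Finset.sum_nonneg fun i _ => hA.eigenvalues_nonneg i

lemma eig_le_rtr {d : ℕ} {A : Mat d} (hA : A.PosSemidef) (j : Fin d) :
    hA.1.eigenvalues j ≤ rtr A := by
  rw [rtr_eig hA.1]
  exact Finset.single_le_sum (f := hA.1.eigenvalues) (fun i _ => hA.eigenvalues_nonneg i)
    (Finset.mem_univ j)

lemma LL_le {d : ℕ} {ρ σ : Mat d} (hρ : ρ.PosSemidef) (hσ : σ.PosSemidef)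
    (hk : ∀ v, σ *ᵥ v = 0 → ρ *ᵥ v = 0) : LL ρ σ ≤ log (rtr σ) * rtr ρ := by
  have hu := W_unit (eU_unit hρ.1) (eU_unit hσ.1)
  rw [LL_eig hρ.1 hσ.1]
  have : log (rtr σ) * rtr ρ = ∑ j, ∑ i, ‖(star (hσ.1.eigenvectorUnitary : Mat d) *
      (hρ.1.eigenvectorUnitary : Mat d)) j i‖ ^ 2 *
      (hρ.1.eigenvalues i * log (rtr σ)) := by
    rw [Finset.sum_comm, rtr_eig hρ.1, Finset.mul_sum]
    refine Finset.sum_congr rfl fun i _ => ?_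
    rw [← Finset.sum_mul, unit_col _ hu.1, one_mul, mul_comm]
  rw [this]
  refine Finset.sum_le_sum fun j _ => Finset.sum_le_sum fun i _ => ?_
  by_cases h1 : hρ.1.eigenvalues i = 0
  · rw [h1]; simp
  by_cases h0 : hσ.1.eigenvalues j = 0
  · rw [W_zero hρ.1 hσ.1 hk j i h0 h1]; simp
  · have h2 : 0 < hσ.1.eigenvalues j := lt_of_le_of_ne (hσ.eigenvalues_nonneg j) (Ne.symm h0)
    have := hρ.eigenvalues_nonneg i
    have := Real.log_le_log h2 (eig_le_rtr hσ j)
    gcongr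

lemma vnEnt_lower {d : ℕ} {A : Mat d} (hA : A.PosSemidef) :
    0 ≤ vnEnt A + rtr A * log (rtr A) := by
  have := LL_le hA hA (fun _ h => h)
  rw [LL_self hA.1] at this
  linarith

lemma vnEnt_upper {d : ℕ} {A : Mat d} (hA : A.PosSemidef) :
    vnEnt A + rtr A * log (rtr A) ≤ d * rtr A := by
  have h0 := rtr_nonneg hA
  have : vnEnt A + rtr A * log (rtr A) = ∑ i, (- (hA.1.eigenvalues i * log (hA.1.eigenvalues i))
      + hA.1.eigenvalues i * log (rtr A)) := by
    rw [Finset.sum_add_distrib, ← Finset.sum_mul, ← rtr_eig, vnEnt_eig hA.1,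
      Finset.sum_neg_distrib]
  rw [this]
  have : (d : ℝ) * rtr A = ∑ _i : Fin d, rtr A := by simp
  rw [this]
  refine Finset.sum_le_sum fun i _ => ?_
  rcases (hA.eigenvalues_nonneg i).eq_or_lt with h | h
  · rw [← h]; simpa using h0
  · have h1 : 0 < rtr A := h.trans_le (eig_le_rtr hA i)
    have h2 := Real.log_le_sub_one_of_pos (div_pos h1 h)
    rw [Real.log_div h1.ne' h.ne'] at h2
    have h3 : hA.1.eigenvalues i * (log (rtr A) - log (hA.1.eigenvalues i))
      ≤ hA.1.eigenvalues i * (rtr A / hA.1.eigenvalues i - 1) := by gcongr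
    rw [mul_sub_one, mul_div_cancel₀ _ h.ne'] at h3
    nlinarith

lemma vnEnt_zero' {d : ℕ} : vnEnt (0 : Mat d) = 0 := by
  have h := vnEnt_spec (d := d) 1 (fun _ => 0) (by simp) (by simp)
  simpa using h

instance instMatNACG {d : ℕ} : NormedAddCommGroup (Mat d) := Matrix.normedAddCommGroup
instance instMatTop {d : ℕ} : TopologicalSpace (Mat d) :=
  instMatNACG.toMetricSpace.toPseudoMetricSpace.toUniformSpace.toTopologicalSpace
instance instMatNS {d : ℕ} : NormedSpace ℝ (Mat d) := Matrix.normedSpace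
instance instMatNSC {d : ℕ} : NormedSpace ℂ (Mat d) := Matrix.normedSpace
instance instMatContinuousMul {d : ℕ} : ContinuousMul (Mat d) :=
  (inferInstance : @ContinuousMul (Mat d) instTopologicalSpaceMatrix _)
instance instMatContinuousStar {d : ℕ} : ContinuousStar (Mat d) :=
  (inferInstance : @ContinuousStar (Mat d) instTopologicalSpaceMatrix _)

/-- `rtr (B * A * C)` as a continuous linear functional of `A`. -/
def rtrL {d : ℕ} (B C : Mat d) : Mat d →L[ℝ] ℝ :=
  LinearMap.toContinuousLinearMap
    { toFun := fun A => rtr (B * A * C)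
      map_add' := by intro x y; simp [rtr, mul_add, add_mul]
      map_smul' := by
        intro c x
        simp only [rtr, Matrix.mul_smul, Matrix.smul_mul, Matrix.trace_smul, RingHom.id_apply,
          Complex.smul_re] }

lemma rtrL_apply {d : ℕ} (B C A : Mat d) : rtrL B C A = rtr (B * A * C) := rfl

lemma rtr_eq_rtrL {d : ℕ} (A : Mat d) : rtr A = rtrL 1 1 A := by simp [rtrL_apply]

lemma continuous_rtr {d : ℕ} : Continuous (rtr : Mat d → ℝ) := by
  have : (rtr : Mat d → ℝ) = fun A => rtrL 1 1 A := funext rtr_eq_rtrL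
  rw [this]; exact (rtrL 1 1).continuous

lemma ell_eq {d : ℕ} (t : ℝ) (X ρ σ : Mat d) :
    ell t X ρ σ = ((2:ℝ) • rtrL Xᴴ 1 - t • rtrL X Xᴴ) ρ - ((2:ℝ) • rtrL Xᴴ 1 + rtrL Xᴴ X) σ := by
  have : rtr (Xᴴ * (ρ - σ)) = rtr (Xᴴ * ρ) - rtr (Xᴴ * σ) := by
    simp [rtr, mul_sub]
  simp only [ell, this, _root_.sub_apply, _root_.add_apply,
    _root_.smul_apply, rtrL_apply, smul_eq_mul, mul_one]
  ring

lemma continuous_ell {d : ℕ} {α : Type*} [TopologicalSpace α] {t : α → ℝ} {X ρ σ : α → Mat d}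
    (ht : Continuous t) (hX : Continuous X) (hρ : Continuous ρ) (hσ : Continuous σ) :
    Continuous (fun a => ell (t a) (X a) (ρ a) (σ a)) := by
  unfold ell
  have h := continuous_rtr (d := d)
  fun_prop

lemma measurable_ell {d : ℕ} {α : Type*} [MeasurableSpace α] {t : α → ℝ} {X ρ σ : α → Mat d}
    (ht : StronglyMeasurable t) (hX : StronglyMeasurable X) (hρ : StronglyMeasurable ρ)
    (hσ : StronglyMeasurable σ) :
    Measurable (fun a => ell (t a) (X a) (ρ a) (σ a)) := by
  have h1 : StronglyMeasurable (fun a => (t a, X a, ρ a, σ a)) :=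
    ht.prodMk (hX.prodMk (hρ.prodMk hσ))
  have h2 : Continuous (fun z : ℝ × Mat d × Mat d × Mat d =>
    ell z.1 z.2.1 z.2.2.1 z.2.2.2) := continuous_ell (by fun_prop) (by fun_prop) (by fun_prop)
      (by fun_prop)
  have h3 := h2.comp_stronglyMeasurable h1
  exact h3.measurable

lemma KK_dense {d : ℕ} (t : ℝ) (ρ σ : Mat d) :
    KK t ρ σ = ⨆ n : ℕ, ENNReal.ofReal (ell t (TopologicalSpace.denseSeq (Mat d) n) ρ σ) := by
  unfold KK
  apply le_antisymm
  · refine iSup_le fun X => ?_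
    refine (TopologicalSpace.denseRange_denseSeq (Mat d)).induction_on X ?_ ?_
    · refine isClosed_le ?_ continuous_const
      refine ENNReal.continuous_ofReal.comp ?_
      exact continuous_ell continuous_const continuous_id continuous_const continuous_const
    · intro n
      exact le_iSup (fun n => ENNReal.ofReal (ell t (TopologicalSpace.denseSeq (Mat d) n) ρ σ)) n
  · exact iSup_le fun n => le_iSup (fun X => ENNReal.ofReal (ell t X ρ σ)) _

lemma measurable_KK {α : Type*} [MeasurableSpace α] {d : ℕ} {R S : α → Mat d}
    (hR : StronglyMeasurable R) (hS : StronglyMeasurable S) :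
    Measurable (fun z : ℝ × α => ENNReal.ofReal (1 / (1 + z.1) ^ 2) * KK z.1 (R z.2) (S z.2)) := by
  simp only [KK_dense]
  refine Measurable.mul (by fun_prop) (Measurable.iSup fun n => ?_)
  refine ENNReal.measurable_ofReal.comp ?_
  exact measurable_ell measurable_fst.stronglyMeasurable stronglyMeasurable_const
      (hR.comp_measurable measurable_snd) (hS.comp_measurable measurable_snd)

lemma measurable_D0 {α : Type*} [MeasurableSpace α] {d : ℕ} {R S : α → Mat d}
    (hR : StronglyMeasurable R) (hS : StronglyMeasurable S) :
    Measurable (fun a => D0 (R a) (S a)) := by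
  unfold D0
  exact Measurable.lintegral_prod_left' (f := fun z : ℝ × α =>
    ENNReal.ofReal (1 / (1 + z.1) ^ 2) * KK z.1 (R z.2) (S z.2)) (measurable_KK hR hS)

lemma D0_jensen {α : Type*} [MeasurableSpace α] {ν : Measure α} [SFinite ν] {d : ℕ}
    {R S : α → Mat d} (hR : StronglyMeasurable R) (hS : StronglyMeasurable S)
    (hRi : Integrable R ν) (hSi : Integrable S ν) :
    D0 (∫ a, R a ∂ν) (∫ a, S a ∂ν) ≤ ∫⁻ a, D0 (R a) (S a) ∂ν := by
  have h1 : ∀ t, KK t (∫ a, R a ∂ν) (∫ a, S a ∂ν) ≤ ∫⁻ a, KK t (R a) (S a) ∂ν := by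
    intro t
    refine iSup_le fun X => ?_
    have : ell t X (∫ a, R a ∂ν) (∫ a, S a ∂ν) = ∫ a, ell t X (R a) (S a) ∂ν := by
      simp only [ell_eq]
      rw [integral_sub]
      · rw [ContinuousLinearMap.integral_comp_comm _ hRi,
          ContinuousLinearMap.integral_comp_comm _ hSi]
      · exact ContinuousLinearMap.integrable_comp _ hRi
      · exact ContinuousLinearMap.integrable_comp _ hSi
    rw [this]
    have h2 : ENNReal.ofReal (∫ a, ell t X (R a) (S a) ∂ν)
        ≤ ∫⁻ a, ENNReal.ofReal (ell t X (R a) (S a)) ∂ν := by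
      have hi : Integrable (fun a => ell t X (R a) (S a)) ν := by
        simp only [ell_eq]
        exact (ContinuousLinearMap.integrable_comp _ hRi).sub
          (ContinuousLinearMap.integrable_comp _ hSi)
      calc ENNReal.ofReal (∫ a, ell t X (R a) (S a) ∂ν)
          ≤ ENNReal.ofReal (∫ a, max (ell t X (R a) (S a)) 0 ∂ν) :=
            ENNReal.ofReal_le_ofReal (integral_mono hi hi.pos_part fun a => le_max_left _ _)
        _ = ∫⁻ a, ENNReal.ofReal (max (ell t X (R a) (S a)) 0) ∂ν :=
            ofReal_integral_eq_lintegral_ofReal hi.pos_part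
              (Eventually.of_forall fun a => le_max_right _ _)
        _ = _ := by
            refine lintegral_congr fun a => ?_
            rw [ENNReal.ofReal_max]; simp
    refine h2.trans (lintegral_mono fun a => ?_)
    exact le_iSup (fun X => ENNReal.ofReal (ell t X (R a) (S a))) X
  unfold D0
  rw [lintegral_lintegral_swap]
  · refine lintegral_mono fun t => ?_
    rw [lintegral_const_mul']
    · gcongr; exact h1 t
    · simp
  · exact ((measurable_KK hR hS).comp measurable_swap).aemeasurable

lemma D0_lsc {d : ℕ} {ρk : ℕ → Mat d} {ρ σ : Mat d} (h : Tendsto ρk atTop (𝓝 ρ)) :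
    D0 ρ σ ≤ liminf (fun k => D0 (ρk k) σ) atTop := by
  have h1 : ∀ t, KK t ρ σ ≤ liminf (fun k => KK t (ρk k) σ) atTop := by
    intro t
    refine iSup_le fun X => ?_
    have h2 : Tendsto (fun k => ENNReal.ofReal (ell t X (ρk k) σ)) atTop
        (𝓝 (ENNReal.ofReal (ell t X ρ σ))) := by
      refine (ENNReal.continuous_ofReal.tendsto _).comp ?_
      have hc : Continuous (fun ρ : Mat d => ell t X ρ σ) :=
        continuous_ell continuous_const continuous_const continuous_id continuous_const
      exact (hc.tendsto ρ).comp h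
    rw [← h2.liminf_eq]
    refine liminf_le_liminf (Eventually.of_forall fun k => ?_)
    exact le_iSup (fun X => ENNReal.ofReal (ell t X (ρk k) σ)) X
  unfold D0
  have hm : ∀ k, Measurable (fun t : ℝ => ENNReal.ofReal (1 / (1 + t) ^ 2) * KK t (ρk k) σ) := by
    intro k
    have h3 := measurable_KK (α := Unit) (R := fun _ => ρk k) (S := fun _ => σ)
      stronglyMeasurable_const stronglyMeasurable_const
    have h4 : Measurable fun t : ℝ => (t, ()) := measurable_id.prodMk measurable_const
    have h5 := h3.comp h4
    simpa only [Function.comp_def] using h5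
  refine le_trans ?_ (lintegral_liminf_le hm)
  refine lintegral_mono fun t => ?_
  calc _ ≤ ENNReal.ofReal (1 / (1 + t) ^ 2) * liminf (fun k => KK t (ρk k) σ) atTop := by
        gcongr; exact h1 t
    _ ≤ _ := by
      exact ENNReal.le_liminf_mul.trans' (by simp)

lemma psd_integral {α : Type*} [MeasurableSpace α] {ν : Measure α} {d : ℕ}
    {R : α → Mat d} (h : ∀ a, (R a).PosSemidef) : (∫ a, R a ∂ν).PosSemidef := by
  by_cases hi : Integrable R ν
  swap
  · rw [integral_undef hi]; exact Matrix.PosSemidef.zero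
  have key : ∀ (f : Mat d →L[ℝ] ℂ), f (∫ a, R a ∂ν) = ∫ a, f (R a) ∂ν := fun f =>
    (ContinuousLinearMap.integral_comp_comm f hi).symm
  have ent : ∀ i j, (∫ a, R a ∂ν) i j = ∫ a, R a i j ∂ν := by
    intro i j
    exact key (LinearMap.toContinuousLinearMap
      { toFun := fun A => A i j, map_add' := by simp, map_smul' := by simp })
  refine Matrix.PosSemidef.of_dotProduct_mulVec_nonneg ?_ ?_
  · ext i j
    rw [Matrix.conjTranspose_apply, ent, ent, Complex.star_def, ← integral_conj]
    refine integral_congr_ae (Eventually.of_forall fun a => ?_)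
    exact (h a).1.apply i j
  · intro v
    have := key (LinearMap.toContinuousLinearMap
      { toFun := fun A => star v ⬝ᵥ (A *ᵥ v)
        map_add' := by intro x y; simp [Matrix.add_mulVec]
        map_smul' := by intro c x; simp [Matrix.smul_mulVec] })
    have e : star v ⬝ᵥ ((∫ a, R a ∂ν) *ᵥ v) = ∫ a, star v ⬝ᵥ (R a *ᵥ v) ∂ν := this
    rw [e]
    exact integral_nonneg fun a => (h a).dotProduct_mulVec_nonneg v

lemma rtr_integral {α : Type*} [MeasurableSpace α] {ν : Measure α} {d : ℕ}
    {R : α → Mat d} (hi : Integrable R ν) : rtr (∫ a, R a ∂ν) = ∫ a, rtr (R a) ∂ν := by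
  simp only [rtr_eq_rtrL]
  exact (ContinuousLinearMap.integral_comp_comm _ hi).symm

lemma LL_integral {α : Type*} [MeasurableSpace α] {ν : Measure α} {d : ℕ}
    {R : α → Mat d} (hi : Integrable R ν) (σ : Mat d) :
    LL (∫ a, R a ∂ν) σ = ∫ a, LL (R a) σ ∂ν := by
  have : ∀ A : Mat d, LL A σ = rtrL 1 (logm σ) A := by intro A; simp [LL, rtrL_apply]
  simp only [this]
  exact (ContinuousLinearMap.integral_comp_comm _ hi).symm

lemma integrable_LL {α : Type*} [MeasurableSpace α] {ν : Measure α} {d : ℕ}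
    {R : α → Mat d} (hi : Integrable R ν) (σ : Mat d) :
    Integrable (fun a => LL (R a) σ) ν := by
  have : ∀ A : Mat d, LL A σ = rtrL 1 (logm σ) A := by intro A; simp [LL, rtrL_apply]
  simp only [this]
  exact ContinuousLinearMap.integrable_comp _ hi

lemma entry_norm_le {d : ℕ} {A : Mat d} (hA : A.PosSemidef) (i j : Fin d) : ‖A i j‖ ≤ rtr A := by
  have h1 : A = (hA.1.eigenvectorUnitary : Mat d) *
    Matrix.diagonal (fun i => (hA.1.eigenvalues i : ℂ))
      * star (hA.1.eigenvectorUnitary : Mat d) := herm_spec hA.1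
  set U := (hA.1.eigenvectorUnitary : Mat d)
  have hU := eU_unit hA.1
  have hUU : U * star U = 1 := mul_eq_one_comm.mp hU
  have h2 : ∀ a b, ‖U a b‖ ≤ 1 := by
    intro a b
    have h3 := unit_row U hUU a
    have h4 : ‖U a b‖ ^ 2 ≤ 1 := by
      rw [← h3]
      exact Finset.single_le_sum (f := fun i => ‖U a i‖ ^ 2) (fun i _ => by positivity)
        (Finset.mem_univ b)
    nlinarith [norm_nonneg (U a b)]
  have h5 : A i j = ∑ k, U i k * (hA.1.eigenvalues k : ℂ) * star (U j k) := by
    conv_lhs => rw [h1]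
    rw [Matrix.mul_apply]
    refine Finset.sum_congr rfl fun k _ => ?_
    rw [Matrix.mul_diagonal, Matrix.star_apply]
  rw [h5, rtr_eig hA.1]
  refine (norm_sum_le _ _).trans (Finset.sum_le_sum fun k _ => ?_)
  have h6 := hA.eigenvalues_nonneg k
  rw [norm_mul, norm_mul, norm_star, Complex.norm_real, Real.norm_of_nonneg h6]
  calc ‖U i k‖ * hA.1.eigenvalues k * ‖U j k‖ ≤ 1 * hA.1.eigenvalues k * 1 := by
        gcongr
        · exact h2 _ _
        · exact h2 _ _
    _ = _ := by ring

lemma norm_le_rtr {d : ℕ} {A : Mat d} (hA : A.PosSemidef) : ‖A‖ ≤ rtr A :=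
  (Matrix.norm_le_iff (rtr_nonneg hA)).mpr fun i j => entry_norm_le hA i j

lemma integrable_mat {α : Type*} [MeasurableSpace α] {ν : Measure α} {d : ℕ}
    {R : α → Mat d} (hR : AEStronglyMeasurable R ν) (h : ∀ a, (R a).PosSemidef)
    (hi : Integrable (fun a => rtr (R a)) ν) : Integrable R ν :=
  hi.mono' hR (Eventually.of_forall fun a => norm_le_rtr (h a))

lemma MeasureTheory.Integrable.rtr' {α : Type*} [MeasurableSpace α] {ν : Measure α} {d : ℕ}
    {R : α → Mat d} (hi : Integrable R ν) : Integrable (fun a => rtr (R a)) ν := by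
  simp only [rtr_eq_rtrL]
  exact ContinuousLinearMap.integrable_comp _ hi

lemma measurable_vnEnt {α : Type*} [MeasurableSpace α] {d : ℕ} {R : α → Mat d}
    (hR : StronglyMeasurable R) (h : ∀ a, (R a).PosSemidef) :
    Measurable (fun a => vnEnt (R a)) := by
  have e : ∀ a, vnEnt (R a) = - ((D0 (R a) 1).toReal + rtr (R a) - d) := by
    intro a
    have := D0_one _ (h a).1.eigenvalues (eU_unit (h a).1) (h a).eigenvalues_nonneg
    rw [← herm_spec (h a).1, ← rtr_eig] at this
    rw [this, vnEnt_eig (h a).1]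
    ring
  simp only [e]
  have h1 := (measurable_D0 hR (stronglyMeasurable_const (b := (1 : Mat d)))).ennreal_toReal
  have h2 : Measurable fun a => rtr (R a) := (continuous_rtr.comp_stronglyMeasurable hR).measurable
  fun_prop

lemma rtr_smul {d : ℕ} (c : ℝ) (A : Mat d) : rtr ((c : ℂ) • A) = c * rtr A := by
  simp [rtr, Matrix.trace_smul]

lemma sm_smul {α : Type*} [MeasurableSpace α] {d : ℕ} {w : α → ℝ} {R : α → Mat d}
    (hw : Measurable w) (hR : StronglyMeasurable R) :
    StronglyMeasurable (fun x => (w x : ℂ) • R x) := by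
  have h1 : StronglyMeasurable (fun x => (w x : ℂ)) :=
    (Complex.measurable_ofReal.comp hw).stronglyMeasurable
  exact h1.smul hR

lemma psd_smul {d : ℕ} {c : ℝ} (hc : 0 ≤ c) {A : Mat d} (hA : A.PosSemidef) :
    ((c : ℂ) • A).PosSemidef := hA.smul (by exact_mod_cast hc)

lemma ker_integral {α : Type*} [MeasurableSpace α] {ν : Measure α} {d : ℕ}
    {R : α → Mat d} (h : ∀ a, (R a).PosSemidef) (hi : Integrable R ν) :
    ∀ᵐ a ∂ν, ∀ v, (∫ a, R a ∂ν) *ᵥ v = 0 → R a *ᵥ v = 0 := by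
  set σ := ∫ a, R a ∂ν with hσ
  have hpsd : σ.PosSemidef := psd_integral h
  have one : ∀ v, σ *ᵥ v = 0 → ∀ᵐ a ∂ν, R a *ᵥ v = 0 := by
    intro v hv
    have e : (fun A : Mat d => (star v ⬝ᵥ (A *ᵥ v)).re)
      = (LinearMap.toContinuousLinearMap
      { toFun := fun A : Mat d => (star v ⬝ᵥ (A *ᵥ v)).re
        map_add' := by intro x y; simp [Matrix.add_mulVec]
        map_smul' := by intro c x; simp [Matrix.smul_mulVec] } : Mat d →L[ℝ] ℝ) := rfl
    have h1 : (star v ⬝ᵥ (σ *ᵥ v)).re = ∫ a, (star v ⬝ᵥ (R a *ᵥ v)).re ∂ν := by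
      have := congrFun e σ
      rw [this, hσ, ← ContinuousLinearMap.integral_comp_comm _ hi]
      rfl
    have h0 : Integrable (fun a => (star v ⬝ᵥ (R a *ᵥ v)).re) ν := by
      have : (fun a => (star v ⬝ᵥ (R a *ᵥ v)).re) = fun a => (LinearMap.toContinuousLinearMap
      { toFun := fun A : Mat d => (star v ⬝ᵥ (A *ᵥ v)).re
        map_add' := by intro x y; simp [Matrix.add_mulVec]
        map_smul' := by intro c x; simp [Matrix.smul_mulVec] } : Mat d →L[ℝ] ℝ) (R a) := rfl
      rw [this]
      exact ContinuousLinearMap.integrable_comp _ hi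
    rw [hv] at h1
    have h2 : (∫ a, (star v ⬝ᵥ (R a *ᵥ v)).re ∂ν) = 0 := by rw [← h1]; simp
    have h3 : ∀ a, 0 ≤ (star v ⬝ᵥ (R a *ᵥ v)).re := fun a =>
      (Complex.le_def.mp ((h a).dotProduct_mulVec_nonneg v)).1
    rw [integral_eq_zero_iff_of_nonneg h3 h0] at h2
    filter_upwards [h2] with a ha
    rw [← (h a).dotProduct_mulVec_zero_iff]
    apply Complex.ext
    · exact ha
    · exact (Complex.le_def.mp ((h a).dotProduct_mulVec_nonneg v)).2.symm
  -- a finite basis of the kernel: use columns of the eigenvector unitary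
  set V := (hpsd.1.eigenvectorUnitary : Mat d) with hV
  have all : ∀ᵐ a ∂ν, ∀ j, hpsd.1.eigenvalues j = 0 → R a *ᵥ (hpsd.1.eigenvectorBasis j) = 0 := by
    rw [ae_all_iff]
    intro j
    by_cases hj : hpsd.1.eigenvalues j = 0
    · have : σ *ᵥ (hpsd.1.eigenvectorBasis j) = 0 := by
        rw [hpsd.1.mulVec_eigenvectorBasis, hj]; simp
      filter_upwards [one _ this] with a ha _ using ha
    · exact Eventually.of_forall fun a h => absurd h hj
  filter_upwards [all] with a ha v hv
  have hVV : V * star V = 1 := mul_eq_one_comm.mp (eU_unit hpsd.1)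
  -- v = V w, w = V* v,  q_j w_j = 0
  have hw : ∀ j, hpsd.1.eigenvalues j ≠ 0 → (star V *ᵥ v) j = 0 := by
    intro j hj
    have h1 : Matrix.diagonal (fun i => (hpsd.1.eigenvalues i : ℂ)) *ᵥ (star V *ᵥ v) = 0 := by
      have h2 : star V *ᵥ (σ *ᵥ v) = 0 := by rw [hv]; simp
      rw [Matrix.mulVec_mulVec] at h2
      have h3 : star V * σ = Matrix.diagonal (fun i => (hpsd.1.eigenvalues i : ℂ)) * star V := by
        conv_lhs => rw [herm_spec hpsd.1]
        calc
          star V * (V * Matrix.diagonal (fun i => (hpsd.1.eigenvalues i : ℂ)) * star V)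
            = (star V * V) * Matrix.diagonal (fun i => (hpsd.1.eigenvalues i : ℂ)) * star V := by
              simp only [mul_assoc]
          _ = _ := by rw [eU_unit hpsd.1, one_mul]
      rw [h3, ← Matrix.mulVec_mulVec] at h2
      exact h2
    have h4 := congrFun h1 j
    rw [Matrix.mulVec_diagonal] at h4
    rcases mul_eq_zero.mp h4 with h | h
    · exact absurd (by exact_mod_cast h) hj
    · exact h
  have hv2 : v = V *ᵥ (star V *ᵥ v) := by rw [Matrix.mulVec_mulVec, hVV, Matrix.one_mulVec]
  rw [hv2, Matrix.mulVec_mulVec]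
  ext k
  rw [Matrix.mulVec, dotProduct]
  refine Finset.sum_eq_zero fun j _ => ?_
  by_cases hj : hpsd.1.eigenvalues j = 0
  · have : (R a * V) k j = 0 := by
      rw [Matrix.mul_apply]
      exact congrFun (ha j hj) k
    rw [this, zero_mul]
  · rw [hw j hj, mul_zero]

/-- The total entropy of a matrix-valued density. -/
def hh {α : Type*} [MeasurableSpace α] {d : ℕ} (ν : Measure α) (R : α → Mat d) : ℝ :=
  ∫ x, vnEnt (R x) ∂ν

/-- Regular matrix-valued densities. -/
structure GD {α : Type*} [MeasurableSpace α] {d : ℕ} (ν : Measure α) (R : α → Mat d) : Prop where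
  sm : StronglyMeasurable R
  psd : ∀ x, (R x).PosSemidef
  int : Integrable R ν
  ent : Integrable (fun x => rtr (R x) * log (rtr (R x))) ν

/-- Admissible weights. -/
structure Wt {α : Type*} [MeasurableSpace α] (ν : Measure α) (w : α → ℝ) : Prop where
  meas : Measurable w
  pos : ∀ x, 0 < w x
  int : Integrable w ν
  one : ∫ x, w x ∂ν = 1

section acc
variable {α : Type*} [MeasurableSpace α] {β : Type*} [MeasurableSpace β] {d : ℕ}
  {μ : Measure α} {ν : Measure β}

lemma GD.vn {R : α → Mat d} (h : GD μ R) : Integrable (fun x => vnEnt (R x)) μ := by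
  have h1 : Integrable (fun x => vnEnt (R x) + rtr (R x) * log (rtr (R x))) μ := by
    refine Integrable.mono' (h.int.rtr'.const_mul (d : ℝ)) ?_ (Eventually.of_forall fun x => ?_)
    · exact (measurable_vnEnt h.sm h.psd).aestronglyMeasurable.add h.ent.1
    · rw [Real.norm_of_nonneg (vnEnt_lower (h.psd x))]
      exact vnEnt_upper (h.psd x)
  have := h1.sub h.ent
  refine this.congr (Eventually.of_forall fun x => ?_)
  simp

lemma int5 {a b c e f : α → ℝ} (ha : Integrable a μ) (hb : Integrable b μ) (hc : Integrable c μ)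
    (he : Integrable e μ) (hf : Integrable f μ) :
    Integrable (fun x => -a x - b x - c x - e x + f x) μ ∧
    ∫ x, (-a x - b x - c x - e x + f x) ∂μ
      = -∫ x, a x ∂μ - ∫ x, b x ∂μ - ∫ x, c x ∂μ - ∫ x, e x ∂μ + ∫ x, f x ∂μ := by
  have j1 : Integrable (fun x => -a x) μ := ha.neg
  have j2 : Integrable (fun x => -a x - b x) μ := j1.sub hb
  have j3 : Integrable (fun x => -a x - b x - c x) μ := j2.sub hc
  have j4 : Integrable (fun x => -a x - b x - c x - e x) μ := j3.sub he
  refine ⟨j4.add hf, ?_⟩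
  rw [integral_add j4 hf, integral_sub j3 he, integral_sub j2 hc, integral_sub j1 hb, integral_neg]

lemma acc_one {R : α → Mat d} (h : GD μ R) {w : α → ℝ} (hw : Wt μ w)
    (hl : Integrable (fun x => rtr (R x) * log (w x)) μ) :
    ∫⁻ x, D0 (R x) ((w x : ℂ) • ∫ y, R y ∂μ) ∂μ
      = ENNReal.ofReal (vnEnt (∫ y, R y ∂μ) - hh μ R - ∫ x, rtr (R x) * log (w x) ∂μ) ∧
    0 ≤ vnEnt (∫ y, R y ∂μ) - hh μ R - ∫ x, rtr (R x) * log (w x) ∂μ := by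
  set M := ∫ y, R y ∂μ with hM
  have hMp : M.PosSemidef := psd_integral h.psd
  set g : α → ℝ := fun x => -vnEnt (R x) - LL (R x) M - log (w x) * rtr (R x) - rtr (R x)
    + w x * rtr M with hg
  have key : ∀ᵐ x ∂μ, D0 (R x) ((w x : ℂ) • M) = ENNReal.ofReal (g x) ∧ 0 ≤ g x := by
    filter_upwards [ker_integral h.psd h.int] with x hx
    exact D0_formula (h.psd x) hMp hx (hw.pos x)
  have hl' : Integrable (fun x => log (w x) * rtr (R x)) μ := by
    simpa only [mul_comm] using hl
  obtain ⟨gi, e1⟩ := int5 h.vn (integrable_LL h.int M) hl' h.int.rtr' (hw.int.mul_const (rtr M))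
  have e : ∫ x, g x ∂μ = vnEnt M - hh μ R - ∫ x, rtr (R x) * log (w x) ∂μ := by
    rw [hg]
    rw [e1, ← LL_integral h.int M, ← hM, LL_self hMp.1, integral_mul_const, hw.one,
      ← rtr_integral h.int, ← hM]
    simp only [hh, mul_comm]
    ring
  constructor
  · rw [lintegral_congr_ae (key.mono fun x hx => hx.1), ← e,
      ofReal_integral_eq_lintegral_ofReal gi (key.mono fun x hx => hx.2)]
  · rw [← e]; exact integral_nonneg_of_ae (key.mono fun x hx => hx.2)

/-- The marginal over the first variable. -/
def mB (μ : Measure α) (R : α × β → Mat d) : β → Mat d := fun b => ∫ a, R (a, b) ∂μ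

/-- The marginal over the second variable. -/
def mA (ν : Measure β) (R : α × β → Mat d) : α → Mat d := fun a => ∫ b, R (a, b) ∂ν

lemma mB_sm [SFinite μ] {R : α × β → Mat d} (h : StronglyMeasurable R) :
    StronglyMeasurable (mB μ R) := h.integral_prod_left'

lemma mA_sm [SFinite ν] {R : α × β → Mat d} (h : StronglyMeasurable R) :
    StronglyMeasurable (mA ν R) := h.integral_prod_right'

lemma acc_two [SFinite μ] [SFinite ν] {R : α × β → Mat d} (h : GD (μ.prod ν) R)
    (hB : GD ν (mB μ R)) {w : α → ℝ} (hw : Wt μ w)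
    (hl : Integrable (fun z : α × β => rtr (R z) * log (w z.1)) (μ.prod ν)) :
    ∫⁻ z, D0 (R z) ((w z.1 : ℂ) • mB μ R z.2) ∂(μ.prod ν)
      = ENNReal.ofReal (hh ν (mB μ R) - hh (μ.prod ν) R
        - ∫ z, rtr (R z) * log (w z.1) ∂(μ.prod ν)) ∧
    0 ≤ hh ν (mB μ R) - hh (μ.prod ν) R - ∫ z, rtr (R z) * log (w z.1) ∂(μ.prod ν) := by
  set N := mB μ R with hN
  have hsec : ∀ᵐ b ∂ν, Integrable (fun a => R (a, b)) μ := h.int.prod_left_ae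
  have hkb : ∀ᵐ b ∂ν, ∀ᵐ a ∂μ, ∀ v, N b *ᵥ v = 0 → R (a, b) *ᵥ v = 0 := by
    filter_upwards [hsec] with b hb
    exact ker_integral (fun a => h.psd (a, b)) hb
  -- measurable representative of LL
  have hL0 : ∀ a b, (∀ v, N b *ᵥ v = 0 → R (a, b) *ᵥ v = 0) →
      LL (R (a, b)) (N b) = -vnEnt (R (a, b)) - (D0 (R (a, b)) (N b)).toReal
        - rtr (R (a, b)) + rtr (N b) := by
    intro a b hk
    obtain ⟨h1, h2⟩ := D0_formula (h.psd (a, b)) (hB.psd b) hk one_pos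
    simp only [Complex.ofReal_one, one_smul, log_one, zero_mul, sub_zero, one_mul] at h1 h2
    rw [h1, ENNReal.toReal_ofReal h2]
    ring
  set L : α × β → ℝ := fun z => -vnEnt (R z) - (D0 (R z) (N z.2)).toReal
        - rtr (R z) + rtr (N z.2) with hL
  have hNs : StronglyMeasurable (fun z : α × β => N z.2) := hB.sm.comp_measurable measurable_snd
  have hmr : Measurable (fun z => rtr (R z)) :=
    (continuous_rtr.comp_stronglyMeasurable h.sm).measurable
  have hmN : Measurable (fun z : α × β => rtr (N z.2)) :=
    (continuous_rtr.comp_stronglyMeasurable hNs).measurable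
  have hLm : Measurable L :=
    (((measurable_vnEnt h.sm h.psd).neg.sub (measurable_D0 h.sm hNs).ennreal_toReal).sub hmr).add
      hmN
  have hLL : ∀ᵐ b ∂ν, ∀ᵐ a ∂μ, L (a, b) = LL (R (a, b)) (N b) := by
    filter_upwards [hkb] with b hb
    filter_upwards [hb] with a ha
    exact (hL0 a b ha).symm
  have hmt : ∀ᵐ b ∂ν, rtr (N b) = ∫ a, rtr (R (a, b)) ∂μ := by
    filter_upwards [hsec] with b hb
    exact rtr_integral hb
  -- integrability of log m_B * rtr R
  have i1 : Integrable (fun z : α × β => log (rtr (N z.2)) * rtr (R z)) (μ.prod ν) := by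
    have hm : Measurable (fun z : α × β => log (rtr (N z.2)) * rtr (R z)) := hmN.log.mul hmr
    rw [integrable_prod_iff' hm.aestronglyMeasurable]
    constructor
    · filter_upwards [hsec] with b hb
      exact hb.rtr'.const_mul _
    · refine hB.ent.norm.congr ?_
      filter_upwards [hmt] with b hb
      simp only [norm_mul]
      rw [integral_const_mul]
      have : ∀ a, ‖rtr (R (a, b))‖ = rtr (R (a, b)) := fun a =>
        Real.norm_of_nonneg (rtr_nonneg (h.psd _))
      simp only [this]
      rw [← hb, Real.norm_of_nonneg (rtr_nonneg (hB.psd b))]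
      ring
  have i2 : Integrable (fun z : α × β => log (rtr (N z.2)) * rtr (R z) - L z) (μ.prod ν) := by
    have hm : Measurable (fun z : α × β => log (rtr (N z.2)) * rtr (R z) - L z) :=
      (hmN.log.mul hmr).sub hLm
    rw [integrable_prod_iff' hm.aestronglyMeasurable]
    constructor
    · filter_upwards [hsec, hLL] with b hb hb2
      refine Integrable.sub (hb.rtr'.const_mul _) ?_
      exact (integrable_LL hb (N b)).congr (hb2.mono fun a ha => ha.symm)
    · refine (hB.vn.add hB.ent).congr ?_
      filter_upwards [hmt, hsec, hLL, hkb] with b hb hb2 hb3 hb4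
      have e1 : ∫ a, ‖log (rtr (N b)) * rtr (R (a, b)) - L (a, b)‖ ∂μ
          = ∫ a, (log (rtr (N b)) * rtr (R (a, b)) - LL (R (a, b)) (N b)) ∂μ := by
        refine integral_congr_ae ?_
        filter_upwards [hb3, hb4] with a ha ha2
        rw [ha, Real.norm_of_nonneg]
        have := LL_le (h.psd (a, b)) (hB.psd b) ha2
        linarith
      simp only [Pi.add_apply]
      rw [e1, integral_sub (hb2.rtr'.const_mul _) (integrable_LL hb2 _), integral_const_mul,
        ← LL_integral hb2]
      change _ = _ - LL (N b) (N b)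
      rw [LL_self (hB.psd b).1, ← hb]
      ring
  have iL : Integrable L (μ.prod ν) := by
    refine (i1.sub i2).congr (Eventually.of_forall fun z => ?_)
    simp
  have eL : ∫ z, L z ∂(μ.prod ν) = - hh ν N := by
    rw [integral_prod_symm _ iL, hh, ← integral_neg]
    refine integral_congr_ae ?_
    filter_upwards [hsec, hLL] with b hb hb2
    rw [integral_congr_ae hb2, ← LL_integral hb]
    exact LL_self (hB.psd b).1
  set g : α × β → ℝ := fun z => -vnEnt (R z) - L z - log (w z.1) * rtr (R z) - rtr (R z)
    + w z.1 * rtr (N z.2) with hg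
  have key : ∀ᵐ z ∂(μ.prod ν), D0 (R z) ((w z.1 : ℂ) • N z.2) = ENNReal.ofReal (g z) ∧ 0 ≤ g z := by
    have hms : Measurable fun z : α × β => D0 (R z) ((w z.1 : ℂ) • N z.2) := by
      refine measurable_D0 h.sm ?_
      exact sm_smul (hw.meas.comp measurable_fst) hNs
    have hgm : Measurable g :=
      ((((measurable_vnEnt h.sm h.psd).neg.sub hLm).sub
        ((hw.meas.comp measurable_fst).log.mul hmr)).sub hmr).add
        ((hw.meas.comp measurable_fst).mul hmN)
    have hset : MeasurableSet {z : α × β | D0 (R z) ((w z.1 : ℂ) • N z.2) = ENNReal.ofReal (g z)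
        ∧ 0 ≤ g z} :=
      (measurableSet_eq_fun hms hgm.ennreal_ofReal).inter (measurableSet_le measurable_const hgm)
    have hsw : ∀ᵐ z ∂(ν.prod μ), D0 (R z.swap) ((w z.swap.1 : ℂ) • N z.swap.2)
        = ENNReal.ofReal (g z.swap) ∧ 0 ≤ g z.swap := by
      refine (Measure.ae_prod_iff_ae_ae (measurable_swap hset)).mpr ?_
      filter_upwards [hkb, hLL] with b hb hb2
      filter_upwards [hb, hb2] with a ha ha2
      have := D0_formula (h.psd (a, b)) (hB.psd b) ha (hw.pos a)
      simp only [hg, Prod.swap_prod_mk]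
      rw [ha2]
      exact this
    have := Measure.measurePreserving_swap (μ := μ) (ν := ν)
    have h3 := this.quasiMeasurePreserving.ae hsw
    filter_upwards [h3] with z hz
    simpa using hz
  have hl' : Integrable (fun z : α × β => log (w z.1) * rtr (R z)) (μ.prod ν) := by
    simpa only [mul_comm] using hl
  have j5 : Integrable (fun z : α × β => w z.1 * rtr (N z.2)) (μ.prod ν) :=
    hw.int.mul_prod hB.int.rtr'
  obtain ⟨gi, e1⟩ := int5 h.vn iL hl' h.int.rtr' j5
  have e : ∫ z, g z ∂(μ.prod ν) = hh ν N - hh (μ.prod ν) R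
      - ∫ z, rtr (R z) * log (w z.1) ∂(μ.prod ν) := by
    rw [hg]
    have e2 : ∫ z, rtr (R z) ∂(μ.prod ν) = ∫ b, rtr (N b) ∂ν := by
      rw [integral_prod_symm _ h.int.rtr']
      exact integral_congr_ae (hmt.mono fun b hb => hb.symm)
    rw [e1, eL, integral_prod_mul (f := w) (g := fun b => rtr (N b)), hw.one, e2]
    simp only [hh, mul_comm]
    ring
  constructor
  · rw [lintegral_congr_ae (key.mono fun x hx => hx.1), ← e,
      ofReal_integral_eq_lintegral_ofReal gi (key.mono fun x hx => hx.2)]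
  · rw [← e]; exact integral_nonneg_of_ae (key.mono fun x hx => hx.2)
end acc

section sa
variable {α : Type*} [MeasurableSpace α] {β : Type*} [MeasurableSpace β] {d : ℕ}
  {μ : Measure α} {ν : Measure β}

lemma int_mA [SFinite μ] [SFinite ν] {R : α × β → Mat d} (h : Integrable R (μ.prod ν)) :
    ∫ a, mA ν R a ∂μ = ∫ z, R z ∂(μ.prod ν) := (integral_prod _ h).symm

lemma int_mB [SFinite μ] [SFinite ν] {R : α × β → Mat d} (h : Integrable R (μ.prod ν)) :
    ∫ b, mB μ R b ∂ν = ∫ z, R z ∂(μ.prod ν) := (integral_prod_symm _ h).symm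

lemma GD.mB_of [SFinite μ] [SFinite ν] {R : α × β → Mat d} (h : GD (μ.prod ν) R) {N : β → Mat d}
    (hN : GD ν N) (hae : mB μ R =ᵐ[ν] N) : GD ν (mB μ R) where
  sm := mB_sm h.sm
  psd := fun b => psd_integral fun a => h.psd (a, b)
  int := hN.int.congr hae.symm
  ent := hN.ent.congr (hae.mono fun b hb => by simp only [hb])

lemma GD.mA_of [SFinite μ] [SFinite ν] {R : α × β → Mat d} (h : GD (μ.prod ν) R) {N : α → Mat d}
    (hN : GD μ N) (hae : mA ν R =ᵐ[μ] N) : GD μ (mA ν R) where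
  sm := mA_sm h.sm
  psd := fun a => psd_integral fun b => h.psd (a, b)
  int := hN.int.congr hae.symm
  ent := hN.ent.congr (hae.mono fun b hb => by simp only [hb])

lemma hh_congr {R S : α → Mat d} (h : R =ᵐ[μ] S) : hh μ R = hh μ S :=
  integral_congr_ae (h.mono fun x hx => by simp only [hx])

lemma ssa [SFinite μ] [SFinite ν] {R : α × β → Mat d} (h : GD (μ.prod ν) R)
    (hA : GD μ (mA ν R)) (hB : GD ν (mB μ R)) {w : α → ℝ} (hw : Wt μ w)
    (hl : Integrable (fun z : α × β => rtr (R z) * log (w z.1)) (μ.prod ν)) :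
    hh (μ.prod ν) R + vnEnt (∫ z, R z ∂(μ.prod ν)) ≤ hh μ (mA ν R) + hh ν (mB μ R) := by
  have hsec : ∀ᵐ a ∂μ, Integrable (fun b => R (a, b)) ν := h.int.prod_right_ae
  have hmt : ∀ᵐ a ∂μ, ∫ b, rtr (R (a, b)) * log (w a) ∂ν = rtr (mA ν R a) * log (w a) := by
    filter_upwards [hsec] with a ha
    rw [integral_mul_const, ← rtr_integral ha]; rfl
  have hlA : Integrable (fun a => rtr (mA ν R a) * log (w a)) μ :=
    hl.integral_prod_left.congr hmt
  have elA : ∫ a, rtr (mA ν R a) * log (w a) ∂μ = ∫ z, rtr (R z) * log (w z.1) ∂(μ.prod ν) := by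
    rw [integral_prod _ hl]; exact (integral_congr_ae hmt).symm
  obtain ⟨a1, a2⟩ := acc_one hA hw hlA
  obtain ⟨b1, b2⟩ := acc_two h hB hw hl
  rw [int_mA h.int] at a1 a2
  rw [elA] at a1 a2
  have hms : Measurable fun z : α × β => D0 (R z) ((w z.1 : ℂ) • mB μ R z.2) :=
    measurable_D0 h.sm (sm_smul (hw.meas.comp measurable_fst) (hB.sm.comp_measurable measurable_snd))
  have key : ∫⁻ x, D0 (mA ν R x) ((w x : ℂ) • ∫ z, R z ∂(μ.prod ν)) ∂μ ≤
      ∫⁻ z, D0 (R z) ((w z.1 : ℂ) • mB μ R z.2) ∂(μ.prod ν) := by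
    rw [lintegral_prod _ hms.aemeasurable]
    refine lintegral_mono_ae ?_
    filter_upwards [hsec] with a ha
    rw [← int_mB h.int, ← integral_smul]
    exact D0_jensen (h.sm.comp_measurable measurable_prodMk_left)
      (hB.sm.const_smul ((w a : ℂ))) ha (hB.int.smul ((w a : ℂ)))
  rw [a1, b1, ENNReal.ofReal_le_ofReal_iff b2] at key
  linarith

end sa

set_option linter.unusedSectionVars false
set_option linter.unusedVariables false

section act
variable {X : Type*} [MeasurableSpace X] {Z : Type*} [MeasurableSpace Z] {d : ℕ}
  {m : Measure X} {η : Measure Z}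

/-- A measurable family of measure preserving maps. -/
structure Act (T : Z → X → X) (m : Measure X) : Prop where
  meas : Measurable (fun p : X × Z => T p.2 p.1)
  mp : ∀ z, MeasurePreserving (T z) m m

/-- Average of a matrix-valued density along a random family of maps. -/
def cv (T : Z → X → X) (η : Measure Z) (R : X → Mat d) : X → Mat d := fun x => ∫ z, R (T z x) ∂η

lemma act_mp [SFinite m] [IsProbabilityMeasure η] {T : Z → X → X} (h : Act T m) :
    MeasurePreserving (fun p : X × Z => T p.2 p.1) (m.prod η) m := by
  have h1 : MeasurePreserving (fun p : Z × X => (id p.1, T p.1 p.2)) (η.prod m) (η.prod m) :=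
    MeasurePreserving.skew_product (g := T) (MeasurePreserving.id η)
      (h.meas.comp measurable_swap) (Eventually.of_forall fun z => (h.mp z).map_eq)
  have h2 : MeasurePreserving (Prod.swap : X × Z → Z × X) (m.prod η) (η.prod m) :=
    Measure.measurePreserving_swap
  have h3 : MeasurePreserving (Prod.snd : Z × X → X) (η.prod m) m := measurePreserving_snd
  exact h3.comp (h1.comp h2)

variable {E : Type*} [NormedAddCommGroup E] [NormedSpace ℝ E]

lemma act_int [SFinite m] [IsProbabilityMeasure η] {T : Z → X → X} (h : Act T m) {f : X → E}
    (hf : Integrable f m) : Integrable (fun p : X × Z => f (T p.2 p.1)) (m.prod η) :=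
  (act_mp h).integrable_comp_of_integrable hf

lemma act_integral [SFinite m] [IsProbabilityMeasure η] {T : Z → X → X} (h : Act T m) {f : X → E}
    (hf : Integrable f m) : ∫ x, ∫ z, f (T z x) ∂η ∂m = ∫ x, f x ∂m := by
  have hmp := act_mp (η := η) h
  have h1 := integral_map (f := f) hmp.measurable.aemeasurable (by rw [hmp.map_eq]; exact hf.1)
  rw [hmp.map_eq] at h1
  rw [h1, integral_prod _ (act_int h hf)]

lemma cv_sm [SFinite η] {T : Z → X → X} (h : Act T m) {R : X → Mat d} (hR : StronglyMeasurable R) :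
    StronglyMeasurable (cv T η R) :=
  (hR.comp_measurable h.meas).integral_prod_right'

lemma cv_psd {T : Z → X → X} {R : X → Mat d} (hR : ∀ x, (R x).PosSemidef) (x : X) :
    (cv T η R x).PosSemidef := psd_integral fun z => hR _

lemma cv_int [SFinite m] [IsProbabilityMeasure η] {T : Z → X → X} (h : Act T m) {R : X → Mat d}
    (hR : Integrable R m) : Integrable (cv T η R) m := (act_int h hR).integral_prod_left

lemma cv_integral [SFinite m] [IsProbabilityMeasure η] {T : Z → X → X} (h : Act T m) {R : X → Mat d}
    (hR : Integrable R m) : ∫ x, cv T η R x ∂m = ∫ x, R x ∂m := act_integral h hR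

lemma cv_sec [SFinite m] [IsProbabilityMeasure η] {T : Z → X → X} (h : Act T m) {f : X → E}
    (hR : Integrable f m) : ∀ᵐ x ∂m, Integrable (fun z => f (T z x)) η :=
  (act_int h hR).prod_right_ae

lemma cv_congr [SFinite m] [IsProbabilityMeasure η] {T : Z → X → X} (h : Act T m) {R S : X → Mat d}
    (hRS : R =ᵐ[m] S) : cv T η R =ᵐ[m] cv T η S := by
  have h1 : ∀ᵐ p ∂(m.prod η), R (T p.2 p.1) = S (T p.2 p.1) :=
    (act_mp h).quasiMeasurePreserving.ae hRS
  filter_upwards [Measure.ae_ae_of_ae_prod h1] with x hx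
  exact integral_congr_ae hx

lemma xlogx_lower {x w : ℝ} (hx : 0 ≤ x) (hw : 0 < w) : x * log w + x - w ≤ x * log x := by
  rcases hx.eq_or_lt with rfl | hx
  · simp; exact hw.le
  · have := Real.log_le_sub_one_of_pos (div_pos hw hx)
    rw [Real.log_div hw.ne' hx.ne'] at this
    have h2 := mul_le_mul_of_nonneg_left this hx.le
    have : x * (w / x - 1) = w - x := by field_simp
    nlinarith

lemma cv_GD [SFinite m] [IsProbabilityMeasure η] {T : Z → X → X} (h : Act T m) {R : X → Mat d}
    (hR : GD m R) {w : X → ℝ} (hw : Wt m w)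
    (hl : Integrable (fun x => rtr (cv T η R x) * log (w x)) m) : GD m (cv T η R) where
  sm := cv_sm h hR.sm
  psd := cv_psd hR.psd
  int := cv_int h hR.int
  ent := by
    have i1 : Integrable (fun x => ∫ z, rtr (R (T z x)) * log (rtr (R (T z x))) ∂η) m :=
      (act_int h hR.ent).integral_prod_left
    have i2 := (hl.add (cv_int (η := η) h hR.int).rtr').sub hw.int
    have hmeas : Measurable (fun x => rtr (cv T η R x)) :=
      (continuous_rtr.comp_stronglyMeasurable (cv_sm h hR.sm)).measurable
    refine Integrable.mono' (i1.norm.add i2.norm) (hmeas.mul hmeas.log).aestronglyMeasurable ?_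
    filter_upwards [cv_sec (η := η) h hR.int, cv_sec (η := η) h hR.ent] with x hx1 hx2
    have low := xlogx_lower (rtr_nonneg (cv_psd (η := η) (T := T) hR.psd x)) (hw.pos x)
    have up : rtr (cv T η R x) * log (rtr (cv T η R x)) ≤
        ∫ z, rtr (R (T z x)) * log (rtr (R (T z x))) ∂η := by
      have e : rtr (cv T η R x) = ∫ z, rtr (R (T z x)) ∂η := rtr_integral hx1
      rw [e]
      exact Real.convexOn_mul_log.map_integral_le Real.continuous_mul_log.continuousOn
        isClosed_Ici (Eventually.of_forall fun z => rtr_nonneg (hR.psd _)) hx1.rtr' hx2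
    simp only [Pi.add_apply, Pi.sub_apply]
    rw [Real.norm_eq_abs]
    refine abs_le.mpr ⟨?_, ?_⟩
    · refine le_trans ?_ low
      have h1 := norm_nonneg (∫ z, rtr (R (T z x)) * log (rtr (R (T z x))) ∂η)
      have h2 := neg_abs_le (rtr (cv T η R x) * log (w x) + rtr (cv T η R x) - w x)
      rw [Real.norm_eq_abs (_ - _)]
      linarith
    · have h1 := le_abs_self (∫ z, rtr (R (T z x)) * log (rtr (R (T z x))) ∂η)
      have h2 := norm_nonneg (rtr (cv T η R x) * log (w x) + rtr (cv T η R x) - w x)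
      rw [Real.norm_eq_abs (∫ z, rtr (R (T z x)) * log (rtr (R (T z x))) ∂η)]
      linarith

end act

section dpi
variable {α : Type*} [MeasurableSpace α] {β : Type*} [MeasurableSpace β] {d : ℕ}
  {Z : Type*} [MeasurableSpace Z] {μ : Measure α} {ν : Measure β} {η : Measure Z}

/-- Product of two families of maps. -/
def pa (S : Z → α → α) (T : Z → β → β) : Z → α × β → α × β := fun z p => (S z p.1, T z p.2)

lemma Act.pa [SFinite μ] [SFinite ν] {S : Z → α → α} {T : Z → β → β} (hS : Act S μ) (hT : Act T ν) :
    Act (pa S T) (μ.prod ν) where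
  meas := (hS.meas.comp ((measurable_fst.comp measurable_fst).prodMk measurable_snd)).prodMk
    (hT.meas.comp ((measurable_snd.comp measurable_fst).prodMk measurable_snd))
  mp := fun z => (hS.mp z).prod (hT.mp z)

lemma act_id : Act (fun (_ : Z) (a : α) => a) μ where
  meas := measurable_fst
  mp := fun _ => MeasurePreserving.id μ

lemma mB_cv [SFinite μ] [SFinite ν] [IsProbabilityMeasure η] {S : Z → α → α} {T : Z → β → β}
    (hS : Act S μ) (hT : Act T ν) {R : α × β → Mat d} (hR : Integrable R (μ.prod ν))
    (hsm : StronglyMeasurable R) :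
    mB μ (cv (pa S T) η R) =ᵐ[ν] cv T η (mB μ R) := by
  have h1 : Integrable (fun p : β × α => R p.swap) (ν.prod μ) := hR.swap
  have h2 : Integrable (fun p : (β × α) × Z => R ((pa T S p.2 p.1).swap)) ((ν.prod μ).prod η) :=
    act_int (hT.pa hS) h1
  have h3 := (measurePreserving_prodAssoc ν μ η).symm
  have h4 : Integrable (fun p : β × α × Z => R (S p.2.2 p.2.1, T p.2.2 p.1))
      (ν.prod (μ.prod η)) := h3.integrable_comp_of_integrable h2
  filter_upwards [h4.prod_right_ae] with b hb
  have e1 : mB μ (cv (pa S T) η R) b = ∫ a, ∫ z, R (S z a, T z b) ∂η ∂μ := rfl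
  rw [e1, integral_integral_swap hb]
  refine integral_congr_ae (Eventually.of_forall fun z => ?_)
  have h5 := (hS.mp z)
  change ∫ a, R (S z a, T z b) ∂μ = ∫ a, R (a, T z b) ∂μ
  have h6 : AEStronglyMeasurable (fun a => R (a, T z b)) (Measure.map (S z) μ) :=
    (hsm.comp_measurable measurable_prodMk_right).aestronglyMeasurable
  have h7 := integral_map h5.measurable.aemeasurable h6
  rw [h5.map_eq] at h7
  exact h7.symm

lemma mA_swap {R : α × β → Mat d} : mA ν R = mB ν (fun p : β × α => R p.swap) := rfl

lemma mA_cv [SFinite μ] [SFinite ν] [IsProbabilityMeasure η] {S : Z → α → α} {T : Z → β → β}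
    (hS : Act S μ) (hT : Act T ν) {R : α × β → Mat d} (hR : Integrable R (μ.prod ν))
    (hsm : StronglyMeasurable R) :
    mA ν (cv (pa S T) η R) =ᵐ[μ] cv S η (mA ν R) :=
  mB_cv hT hS (R := fun p : β × α => R p.swap) hR.swap (hsm.comp_measurable measurable_swap)

lemma dpi [SFinite μ] [SFinite ν] [IsProbabilityMeasure η] {T : Z → β → β}
    (hT : Act T ν) {R : α × β → Mat d} (h : GD (μ.prod ν) R) (hB : GD ν (mB μ R))
    (h' : GD (μ.prod ν) (cv (pa (fun _ a => a) T) η R)) (hB' : GD ν (cv T η (mB μ R)))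
    {w : α → ℝ} (hw : Wt μ w)
    (hl : Integrable (fun z : α × β => rtr (R z) * log (w z.1)) (μ.prod ν)) :
    hh ν (cv T η (mB μ R)) - hh (μ.prod ν) (cv (pa (fun _ a => a) T) η R)
      ≤ hh ν (mB μ R) - hh (μ.prod ν) R := by
  set R' := cv (pa (fun (_ : Z) (a : α) => a) T) η R with hR'
  have act : Act (pa (fun (_ : Z) (a : α) => a) T) (μ.prod ν) := act_id.pa hT
  have hae : mB μ R' =ᵐ[ν] cv T η (mB μ R) := mB_cv act_id hT h.int h.sm
  have hBB := h'.mB_of hB' hae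
  have hlae : ∀ᵐ p ∂(μ.prod ν), ∫ z, rtr (R (p.1, T z p.2)) * log (w p.1) ∂η
      = rtr (R' p) * log (w p.1) := by
    filter_upwards [cv_sec (η := η) act h.int] with p hp
    rw [integral_mul_const]
    congr 1
    exact (rtr_integral hp).symm
  have hl' : Integrable (fun z : α × β => rtr (R' z) * log (w z.1)) (μ.prod ν) :=
    ((act_int (η := η) act hl).integral_prod_left).congr hlae
  have el : ∫ z, rtr (R' z) * log (w z.1) ∂(μ.prod ν)
      = ∫ z, rtr (R z) * log (w z.1) ∂(μ.prod ν) := by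
    rw [← act_integral (η := η) act hl]
    exact (integral_congr_ae hlae).symm
  obtain ⟨a1, a2⟩ := acc_two h hB hw hl
  obtain ⟨b1, b2⟩ := acc_two h' hBB hw hl'
  have hms : Measurable fun z : α × β => D0 (R z) ((w z.1 : ℂ) • mB μ R z.2) :=
    measurable_D0 h.sm (sm_smul (hw.meas.comp measurable_fst) (hB.sm.comp_measurable measurable_snd))
  have key : ∫⁻ z, D0 (R' z) ((w z.1 : ℂ) • mB μ R' z.2) ∂(μ.prod ν) ≤
      ∫⁻ z, D0 (R z) ((w z.1 : ℂ) • mB μ R z.2) ∂(μ.prod ν) := by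
    have hmp := act_mp (η := η) act
    rw [← hmp.lintegral_comp hms]
    have hmm := (hms.comp hmp.measurable).aemeasurable (μ := (μ.prod ν).prod η)
    simp only [Function.comp_def] at hmm
    rw [lintegral_prod _ hmm]
    refine lintegral_mono_ae ?_
    have q1 : ∀ᵐ p ∂(μ.prod ν), mB μ R' p.2 = cv T η (mB μ R) p.2 :=
      Measure.quasiMeasurePreserving_snd.ae hae
    have q2 : ∀ᵐ p : α × β ∂(μ.prod ν), Integrable (fun z => mB μ R (T z p.2)) η :=
      Measure.quasiMeasurePreserving_snd.ae (cv_sec (η := η) hT hB.int)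
    filter_upwards [cv_sec (η := η) act h.int, q1, q2] with p hp hp1 hp2
    rw [hp1, cv, ← integral_smul]
    refine D0_jensen (R := fun z => R (p.1, T z p.2)) ?_ ?_ hp (hp2.smul ((w p.1 : ℂ)))
    · exact h.sm.comp_measurable (measurable_const.prodMk (hT.meas.comp measurable_prodMk_left))
    · exact (hB.sm.comp_measurable (hT.meas.comp measurable_prodMk_left)).const_smul ((w p.1 : ℂ))
  rw [a1, b1, ENNReal.ofReal_le_ofReal_iff a2] at key
  rw [hh_congr hae] at key
  linarith
end dpi

section weight
variable (F : Type*) [NormedAddCommGroup F] [NormedSpace ℝ F] [FiniteDimensional ℝ F]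
  [MeasureSpace F] [BorelSpace F] [(volume : Measure F).IsAddHaarMeasure]

/-- Exponent of the polynomial weight. -/
def wr : ℝ := (Module.finrank ℝ F : ℝ) + 1

/-- Normalisation of the polynomial weight. -/
def wc : ℝ := ∫ x : F, (1 + ‖x‖) ^ (-wr F)

/-- A polynomial probability density. -/
def wF (x : F) : ℝ := (wc F)⁻¹ * (1 + ‖x‖) ^ (-wr F)

lemma wr_pos : 0 < wr F := by unfold wr; positivity

lemma wint : Integrable (fun x : F => (1 + ‖x‖) ^ (-wr F)) :=
  integrable_one_add_norm (by unfold wr; linarith)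

lemma wc_pos : 0 < wc F := by
  unfold wc
  have hc : Continuous (fun x : F => (1 + ‖x‖) ^ (-wr F)) := by
    refine Continuous.rpow_const (by fun_prop) fun x => Or.inl ?_
    positivity
  exact integral_pos_of_integrable_nonneg_nonzero (x := 0) hc (wint F)
    (fun x => by positivity) (by simp)

lemma wF_wt : Wt (volume : Measure F) (wF F) where
  meas := by unfold wF; fun_prop
  pos := fun x => by
    have := wc_pos F
    unfold wF; positivity
  int := (wint F).const_mul _
  one := by
    unfold wF
    rw [integral_const_mul]
    exact inv_mul_cancel₀ (wc_pos F).ne'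

lemma log_wF (x : F) : log (wF F x) = log (wc F)⁻¹ - wr F * log (1 + ‖x‖) := by
  have h1 : (0:ℝ) < 1 + ‖x‖ := by positivity
  unfold wF
  rw [Real.log_mul (inv_pos.mpr (wc_pos F)).ne' (by positivity), Real.log_rpow h1]
  ring

lemma log_one_add_lip {a b : ℝ} (ha : 0 ≤ a) (hb : 0 ≤ b) (hab : b ≤ a) :
    |log (1 + a) - log (1 + b)| ≤ a - b := by
  rw [abs_of_nonneg (sub_nonneg.mpr (Real.log_le_log (by linarith) (by linarith))),
    ← Real.log_div (by linarith) (by linarith)]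
  have h2 := Real.log_le_sub_one_of_pos (x := (1 + a) / (1 + b)) (by positivity)
  refine h2.trans ?_
  rw [div_sub_one (by linarith), div_le_iff₀ (by linarith)]
  nlinarith [mul_nonneg (sub_nonneg.mpr hab) hb]

lemma log_one_add_lip' {a b : ℝ} (ha : 0 ≤ a) (hb : 0 ≤ b) :
    |log (1 + a) - log (1 + b)| ≤ |a - b| := by
  rcases le_total b a with h | h
  · exact (log_one_add_lip ha hb h).trans (le_abs_self _)
  · rw [abs_sub_comm, abs_sub_comm a b]
    exact (log_one_add_lip hb ha h).trans (le_abs_self _)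

lemma log_wF_lip (x y : F) : |log (wF F x) - log (wF F y)| ≤ wr F * ‖x - y‖ := by
  rw [log_wF, log_wF]
  have h := log_one_add_lip' (norm_nonneg x) (norm_nonneg y)
  have h2 := abs_norm_sub_norm_le x y
  have e : log (wc F)⁻¹ - wr F * log (1 + ‖x‖) - (log (wc F)⁻¹ - wr F * log (1 + ‖y‖))
    = - (wr F * (log (1 + ‖x‖) - log (1 + ‖y‖))) := by ring
  rw [e, abs_neg, abs_mul, abs_of_pos (wr_pos F)]
  exact mul_le_mul_of_nonneg_left (h.trans h2) (wr_pos F).le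

/-- Functions of quadratic growth. -/
def Gr {F : Type*} [NormedAddCommGroup F] [MeasurableSpace F] (g : F → ℝ) : Prop :=
  Measurable g ∧ ∃ C, ∀ x, |g x| ≤ C * (1 + ‖x‖ ^ 2)

lemma Gr_log_wF : Gr (fun x : F => log (wF F x)) := by
  refine ⟨(wF_wt F).meas.log, |log (wF F 0)| + wr F, fun x => ?_⟩
  have h := log_wF_lip F x 0
  rw [sub_zero] at h
  have h1 : |log (wF F x)| ≤ |log (wF F x) - log (wF F 0)| + |log (wF F 0)| := by
    have := abs_add_le (log (wF F x) - log (wF F 0)) (log (wF F 0))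
    simpa using this
  have h2 : ‖x‖ ≤ 1 + ‖x‖ ^ 2 := by nlinarith [sq_nonneg (‖x‖ - 1), norm_nonneg x]
  have h3 := mul_le_mul_of_nonneg_left h2 (wr_pos F).le
  have h4 := abs_nonneg (log (wF F 0))
  nlinarith [mul_nonneg h4 (sq_nonneg ‖x‖)]

end weight

section noise
variable {F : Type*} [NormedAddCommGroup F] [NormedSpace ℝ F] [FiniteDimensional ℝ F]
  [MeasureSpace F] [BorelSpace F] [(volume : Measure F).IsAddHaarMeasure]
variable {Z : Type*} [NormedAddCommGroup Z] [NormedSpace ℝ Z] [FiniteDimensional ℝ Z]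
  [MeasurableSpace Z] [BorelSpace Z]
variable {d : ℕ} {η : Measure Z} [IsProbabilityMeasure η]

/-- Regular densities with second moments. -/
structure SG (R : F → Mat d) : Prop extends GD (volume : Measure F) R where
  mom : Integrable (fun x => ‖x‖ ^ 2 * rtr (R x))

lemma SG.gr {R : F → Mat d} (h : SG R) {g : F → ℝ} (hg : Gr g) :
    Integrable (fun x => rtr (R x) * g x) := by
  obtain ⟨hm, C, hC⟩ := hg
  have hmr : Measurable (fun z => rtr (R z)) :=
    (continuous_rtr.comp_stronglyMeasurable h.sm).measurable
  have i1 : Integrable (fun x => C * (rtr (R x) + ‖x‖ ^ 2 * rtr (R x))) :=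
    (h.int.rtr'.add h.mom).const_mul C
  refine i1.mono' (hmr.mul hm).aestronglyMeasurable (Eventually.of_forall fun x => ?_)
  rw [norm_mul, Real.norm_eq_abs (g x), Real.norm_of_nonneg (rtr_nonneg (h.psd x))]
  have := mul_le_mul_of_nonneg_left (hC x) (rtr_nonneg (h.psd x))
  linarith

/-- Translations by a linear image of the noise. -/
def tl (L : Z →L[ℝ] F) : Z → F → F := fun z x => x - L z

lemma tl_act (L : Z →L[ℝ] F) : Act (tl L) (volume : Measure F) where
  meas := by
    unfold tl
    exact measurable_fst.sub (L.measurable.comp measurable_snd)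
  mp := fun z => measurePreserving_sub_right volume (L z)

lemma shear_mp {X : Type*} [MeasurableSpace X] {m : Measure X} [SFinite m] {T : Z → X → X}
    (h : Act T m) :
    MeasurePreserving (fun p : X × Z => (T p.2 p.1, p.2)) (m.prod η) (m.prod η) := by
  have h1 : MeasurePreserving (fun p : Z × X => (id p.1, T p.1 p.2)) (η.prod m) (η.prod m) :=
    MeasurePreserving.skew_product (g := T) (MeasurePreserving.id η)
      (h.meas.comp measurable_swap) (Eventually.of_forall fun z => (h.mp z).map_eq)
  have h2 : MeasurePreserving (Prod.swap : X × Z → Z × X) (m.prod η) (η.prod m) :=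
    Measure.measurePreserving_swap
  have h3 : MeasurePreserving (Prod.swap : Z × X → X × Z) (η.prod m) (m.prod η) :=
    Measure.measurePreserving_swap
  exact h3.comp (h1.comp h2)

lemma cv_test (h2 : Integrable (fun z => ‖z‖ ^ 2) η) {R : F → Mat d} (h : SG R) (L : Z →L[ℝ] F)
    {g : F → ℝ} (hg : Gr g) :
    Integrable (fun x => rtr (cv (tl L) η R x) * g x) ∧
    Integrable (fun p : F × Z => rtr (R p.1) * g (p.1 + L p.2)) ((volume : Measure F).prod η) ∧
    ∫ x, rtr (cv (tl L) η R x) * g x = ∫ p : F × Z, rtr (R p.1) * g (p.1 + L p.2)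
      ∂((volume : Measure F).prod η) := by
  obtain ⟨hm, C, hC⟩ := hg
  have hC0 : 0 ≤ C := by
    have := (abs_nonneg _).trans (hC 0)
    simpa using this
  have hmr : Measurable (fun z => rtr (R z)) :=
    (continuous_rtr.comp_stronglyMeasurable h.sm).measurable
  have i0 : Integrable (fun p : F × Z => rtr (R p.1) * g (p.1 + L p.2))
      ((volume : Measure F).prod η) := by
    have a1 : Integrable (fun p : F × Z => rtr (R p.1) * (1:ℝ)) ((volume : Measure F).prod η) :=
      h.int.rtr'.mul_prod (integrable_const (1:ℝ))
    have a2 : Integrable (fun p : F × Z => (‖p.1‖ ^ 2 * rtr (R p.1)) * (1:ℝ))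
      ((volume : Measure F).prod η) := h.mom.mul_prod (integrable_const (1:ℝ))
    have a3 : Integrable (fun p : F × Z => rtr (R p.1) * ‖p.2‖ ^ 2)
      ((volume : Measure F).prod η) := h.int.rtr'.mul_prod h2
    have a4 := ((a1.add (a2.const_mul 2)).add (a3.const_mul (2 * ‖L‖ ^ 2))).const_mul C
    refine a4.mono' ?_ (Eventually.of_forall fun p => ?_)
    · refine Measurable.aestronglyMeasurable ?_
      exact (hmr.comp measurable_fst).mul (hm.comp (measurable_fst.add
        (L.measurable.comp measurable_snd)))
    · have hr := rtr_nonneg (h.psd p.1)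
      rw [norm_mul, Real.norm_eq_abs (g _), Real.norm_of_nonneg hr]
      have b1 : ‖p.1 + L p.2‖ ^ 2 ≤ 2 * ‖p.1‖ ^ 2 + 2 * (‖L‖ ^ 2 * ‖p.2‖ ^ 2) := by
        have c1 : ‖p.1 + L p.2‖ ≤ ‖p.1‖ + ‖L‖ * ‖p.2‖ :=
          (norm_add_le _ _).trans (by gcongr; exact L.le_opNorm _)
        have c2 := pow_le_pow_left₀ (norm_nonneg _) c1 2
        nlinarith [sq_nonneg (‖p.1‖ - ‖L‖ * ‖p.2‖)]
      have b2 := (hC (p.1 + L p.2)).trans (mul_le_mul_of_nonneg_left (add_le_add_right b1 1) hC0)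
      have b3 := mul_le_mul_of_nonneg_left b2 hr
      simp only [Pi.add_apply]
      linarith
  have sh := shear_mp (η := η) (tl_act L)
  have i1 : Integrable (fun p : F × Z => rtr (R (p.1 - L p.2)) * g p.1)
      ((volume : Measure F).prod η) := by
    have := sh.integrable_comp_of_integrable i0
    refine this.congr (Eventually.of_forall fun p => ?_)
    simp [tl]
  have hae : ∀ᵐ x : F, ∫ z, rtr (R (x - L z)) * g x ∂η = rtr (cv (tl L) η R x) * g x := by
    filter_upwards [cv_sec (η := η) (tl_act L) h.int] with x hx
    rw [integral_mul_const]
    congr 1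
    exact (rtr_integral hx).symm
  refine ⟨i1.integral_prod_left.congr hae, i0, ?_⟩
  rw [← integral_congr_ae hae, ← integral_prod _ i1]
  have e := integral_map (f := fun p : F × Z => rtr (R p.1) * g (p.1 + L p.2))
    sh.measurable.aemeasurable (by rw [sh.map_eq]; exact i0.1)
  rw [sh.map_eq] at e
  rw [e]
  refine integral_congr_ae (Eventually.of_forall fun p => ?_)
  simp [tl]

lemma Gr_sq : Gr (fun x : F => ‖x‖ ^ 2) :=
  ⟨by fun_prop, 1, fun x => by rw [abs_of_nonneg (by positivity)]; linarith⟩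

lemma SG.cv (h2 : Integrable (fun z => ‖z‖ ^ 2) η) {R : F → Mat d} (h : SG R) (L : Z →L[ℝ] F) :
    SG (cv (tl L) η R) where
  toGD := cv_GD (tl_act L) h.toGD (wF_wt F) (cv_test h2 h L (Gr_log_wF F)).1
  mom := by simpa only [mul_comm] using (cv_test h2 h L Gr_sq).1

section comp
variable {X Y : Type*} [MeasurableSpace X] [MeasurableSpace Y] {m : Measure X} {m' : Measure Y}

lemma GD.comp {R : X → Mat d} (h : GD m R) {φ : Y → X} (hφ : MeasurePreserving φ m' m) :
    GD m' (fun y => R (φ y)) where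
  sm := h.sm.comp_measurable hφ.measurable
  psd := fun y => h.psd _
  int := hφ.integrable_comp_of_integrable h.int
  ent := hφ.integrable_comp_of_integrable h.ent

lemma hh_comp {R : X → Mat d} (h : GD m R) {φ : Y → X} (hφ : MeasurePreserving φ m' m) :
    hh m' (fun y => R (φ y)) = hh m R := by
  have e := integral_map (f := fun x => vnEnt (R x)) hφ.measurable.aemeasurable
    (by rw [hφ.map_eq]; exact h.vn.1)
  rw [hφ.map_eq] at e
  exact e.symm

lemma int_comp {R : X → Mat d} (h : GD m R) {φ : Y → X} (hφ : MeasurePreserving φ m' m) :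
    ∫ y, R (φ y) ∂m' = ∫ x, R x ∂m := by
  have e := integral_map (f := fun x => R x) hφ.measurable.aemeasurable
    (by rw [hφ.map_eq]; exact h.int.1)
  rw [hφ.map_eq] at e
  exact e.symm
end comp

lemma wt_one : Wt η (fun _ => (1:ℝ)) := ⟨measurable_const, fun _ => one_pos, integrable_const _,
  by simp⟩

lemma act_mp' (L : Z →L[ℝ] F) :
    MeasurePreserving (fun p : Z × F => tl L p.1 p.2) (η.prod (volume : Measure F)) volume :=
  (act_mp (η := η) (tl_act L)).comp Measure.measurePreserving_swap

lemma GD_const (M : Mat d) (hM : M.PosSemidef) : GD η (fun _ => M) :=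
  ⟨stronglyMeasurable_const, fun _ => hM, integrable_const _, integrable_const _⟩

/-- Adding noise increases the entropy. -/
lemma hh_mono (h2 : Integrable (fun z => ‖z‖ ^ 2) η) {R : F → Mat d} (h : SG R) (L : Z →L[ℝ] F) :
    hh volume R ≤ hh volume (cv (tl L) η R) := by
  set Q : Z × F → Mat d := fun p => R (tl L p.1 p.2) with hQ
  have hG : GD (η.prod volume) Q := h.toGD.comp (act_mp' L)
  have hA : mA volume Q = fun _ => ∫ x, R x := by
    funext z
    exact integral_sub_right_eq_self R (L z)
  have := ssa hG (by rw [hA]; exact GD_const _ (psd_integral h.psd)) (h.cv h2 L).toGD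
    (wt_one (η := η)) (by simp)
  rw [hA, hh_comp h.toGD (act_mp' L), int_comp h.toGD (act_mp' L)] at this
  have e : hh η (fun _ : Z => ∫ x, R x) = vnEnt (∫ x, R x) := by simp [hh]
  rw [e] at this
  have e2 : mB η Q = cv (tl L) η R := rfl
  rw [e2] at this
  linarith

/-- Entropy increments decrease. -/
lemma hh_dec (h2 : Integrable (fun z => ‖z‖ ^ 2) η) {R : F → Mat d} (h : SG R)
    (L L' : Z →L[ℝ] F) :
    hh volume (cv (tl L') η (cv (tl L) η R)) - hh volume (cv (tl L') η R)
      ≤ hh volume (cv (tl L) η R) - hh volume R := by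
  set Q : Z × F → Mat d := fun p => R (tl L p.1 p.2) with hQ
  have hG : GD (η.prod volume) Q := h.toGD.comp (act_mp' L)
  have e1 : cv (pa (fun (_ : Z) (a : Z) => a) (tl L')) η Q
      = fun p : Z × F => cv (tl L') η R (tl L p.1 p.2) := by
    funext p
    refine integral_congr_ae (Eventually.of_forall fun z => ?_)
    simp only [hQ, pa, tl]
    congr 1
    abel
  have h' := h.cv h2 L'
  have := dpi (η := η) (tl_act L') hG (h.cv h2 L).toGD
    (by rw [e1]; exact h'.toGD.comp (act_mp' L)) ((h.cv h2 L).cv h2 L').toGD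
    (wt_one (η := η)) (by simp)
  rw [e1, hh_comp h'.toGD (act_mp' L), hh_comp h.toGD (act_mp' L)] at this
  exact this
end noise

section gauss
variable {n : ℕ}

/-- The standard Gaussian probability measure. -/
def gam (n : ℕ) : Measure (En n) := ProbabilityTheory.stdGaussian (En n)

instance : IsProbabilityMeasure (gam n) := by unfold gam; infer_instance

lemma gam_sq : Integrable (fun z => ‖z‖ ^ 2) (gam n) := by
  have : MemLp id 2 (gam n) := by
    unfold gam; exact ProbabilityTheory.IsGaussian.memLp_two_id
  exact this.integrable_norm_pow (by norm_num)

lemma gd_meas : Measurable (gaussDensity n) := by unfold gaussDensity; fun_prop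

lemma gd_pos (z : En n) : 0 < gaussDensity n z := by unfold gaussDensity; positivity

lemma gd_int : Integrable (gaussDensity n) := by
  have := (GaussianFourier.integrable_cexp_neg_mul_sq_norm_add (V := En n) (b := 1/2)
    (by norm_num) 0 0).norm
  unfold gaussDensity
  refine (this.const_mul ((2 * π) ^ (-(n : ℝ) / 2))).congr (Eventually.of_forall fun z => ?_)
  simp only [Complex.norm_exp]
  congr 2
  simp [← Complex.ofReal_pow]
  ring

lemma gd_one : ∫ z, gaussDensity n z = 1 := by
  unfold gaussDensity
  rw [integral_const_mul]
  have := GaussianFourier.integral_rexp_neg_mul_sq_norm (V := En n) (b := 1/2) (by norm_num)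
  have e : ∀ z : En n, rexp (-‖z‖ ^ 2 / 2) = rexp (-(1/2) * ‖z‖ ^ 2) := fun z => by
    congr 1; ring
  simp only [e]
  rw [this, finrank_euclideanSpace_fin]
  rw [show π / (1/2) = 2 * π by ring, ← Real.rpow_add (by positivity)]
  rw [show -(n:ℝ) / 2 + n / 2 = 0 by ring, Real.rpow_zero]

lemma gam_eq : gam n = (volume : Measure (En n)).withDensity
    (fun z => ENNReal.ofReal (gaussDensity n z)) := by
  have hfin : IsProbabilityMeasure ((volume : Measure (En n)).withDensity
    (fun z => ENNReal.ofReal (gaussDensity n z))) := by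
    constructor
    rw [withDensity_apply _ MeasurableSet.univ, Measure.restrict_univ,
      ← ofReal_integral_eq_lintegral_ofReal gd_int (Eventually.of_forall fun z => (gd_pos z).le),
      gd_one, ENNReal.ofReal_one]
  refine Measure.ext_of_charFun ?_
  funext t
  unfold gam
  rw [ProbabilityTheory.charFun_stdGaussian, charFun_apply,
    integral_withDensity_eq_integral_toReal_smul (by exact gd_meas.ennreal_ofReal)
      (Eventually.of_forall fun z => ENNReal.ofReal_lt_top)]
  have := GaussianFourier.integral_cexp_neg_mul_sq_norm_add (V := En n) (b := 1/2)
    (by norm_num) Complex.I t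
  have e : ∀ z : En n, (ENNReal.ofReal (gaussDensity n z)).toReal •
      Complex.exp ((inner ℝ z t : ℝ) * Complex.I) = (((2 * π) ^ (-(n : ℝ) / 2) : ℝ) : ℂ) *
      Complex.exp (-(1/2) * (‖z‖:ℂ) ^ 2 + Complex.I * (inner ℝ t z : ℝ)) := by
    intro z
    rw [ENNReal.toReal_ofReal (gd_pos z).le]
    unfold gaussDensity
    rw [Complex.real_smul, Complex.ofReal_mul, mul_assoc, Complex.ofReal_exp, ← Complex.exp_add,
      real_inner_comm]
    congr 2
    push_cast
    ring
  simp only [e]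
  rw [integral_const_mul, this, finrank_euclideanSpace_fin]
  have h2 : ((π:ℂ) / (1/2)) ^ ((n:ℂ) / 2) = (((2 * π) ^ ((n : ℝ) / 2) : ℝ) : ℂ) := by
    rw [Complex.ofReal_cpow (by positivity)]
    push_cast
    congr 1
    ring
  rw [h2, ← mul_assoc, ← Complex.ofReal_mul, ← Real.rpow_add (by positivity)]
  rw [show -(n:ℝ) / 2 + n / 2 = 0 by ring, Real.rpow_zero]
  simp
  congr 1
  ring

lemma integral_gam {G : Type*} [NormedAddCommGroup G] [NormedSpace ℝ G] (f : En n → G) :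
    ∫ z, f z ∂(gam n) = ∫ z, gaussDensity n z • f z := by
  rw [gam_eq, integral_withDensity_eq_integral_toReal_smul (by exact gd_meas.ennreal_ofReal)
      (Eventually.of_forall fun z => ENNReal.ofReal_lt_top)]
  refine integral_congr_ae (Eventually.of_forall fun z => ?_)
  simp only [ENNReal.toReal_ofReal (gd_pos z).le]

lemma integrable_gam {G : Type*} [NormedAddCommGroup G] [NormedSpace ℝ G] (f : En n → G) :
    Integrable f (gam n) ↔ Integrable (fun z => gaussDensity n z • f z) := by
  rw [gam_eq, integrable_withDensity_iff_integrable_smul' (by exact gd_meas.ennreal_ofReal)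
      (Eventually.of_forall fun z => ENNReal.ofReal_lt_top)]
  refine integrable_congr (Eventually.of_forall fun z => ?_)
  simp only [ENNReal.toReal_ofReal (gd_pos z).le]

lemma gam_neg : (gam n).map (fun z => -z) = gam n := by
  have : IsProbabilityMeasure ((gam n).map (fun z => -z)) :=
    Measure.isProbabilityMeasure_map (by fun_prop)
  refine Measure.ext_of_charFun ?_
  funext t
  have h := charFun_map_smul (μ := gam n) (-1) t
  have e : (fun z : En n => -z) = (fun z => (-1:ℝ) • z) := by funext z; simp
  rw [e, h]
  unfold gam
  rw [ProbabilityTheory.charFun_stdGaussian, ProbabilityTheory.charFun_stdGaussian, norm_smul]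
  simp

lemma gam_conv {a b c : ℝ} (h : c ^ 2 = a ^ 2 + b ^ 2) :
    ((gam n).prod (gam n)).map (fun p => a • p.1 + b • p.2) = (gam n).map (fun z => c • z) := by
  have h1 : IsProbabilityMeasure ((gam n).map (fun z => a • z)) :=
    Measure.isProbabilityMeasure_map (by fun_prop)
  have h2 : IsProbabilityMeasure ((gam n).map (fun z => b • z)) :=
    Measure.isProbabilityMeasure_map (by fun_prop)
  have h3 : IsProbabilityMeasure ((gam n).map (fun z => c • z)) :=
    Measure.isProbabilityMeasure_map (by fun_prop)
  have e : ((gam n).prod (gam n)).map (fun p => a • p.1 + b • p.2)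
      = ((gam n).map (fun z => a • z)).conv ((gam n).map (fun z => b • z)) := by
    unfold Measure.conv
    rw [Measure.map_prod_map _ _ (by fun_prop) (by fun_prop), Measure.map_map (by fun_prop)
      (by fun_prop)]
    rfl
  rw [e]
  refine Measure.ext_of_charFun ?_
  funext t
  rw [charFun_conv]
  simp only [charFun_map_smul]
  unfold gam
  simp only [ProbabilityTheory.charFun_stdGaussian]
  rw [← Complex.exp_add]
  congr 1
  simp only [norm_smul, mul_pow, Real.norm_eq_abs]
  push_cast
  simp only [← Complex.ofReal_pow, mul_pow, sq_abs, h]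
  push_cast
  ring

variable {d : ℕ}

/-- Gaussian smoothing with standard deviation `c`. -/
def heat (c : ℝ) (R : En n → Mat d) : En n → Mat d :=
  cv (tl (c • ContinuousLinearMap.id ℝ (En n))) (gam n) R

lemma heat_apply (c : ℝ) (R : En n → Mat d) (x : En n) :
    heat c R x = ∫ z, R (x - c • z) ∂(gam n) := rfl

lemma heat_zero (R : En n → Mat d) : heat 0 R = R := by
  funext x
  simp [heat_apply]

lemma SG.heat {R : En n → Mat d} (h : SG R) (c : ℝ) : SG (heat c R) := h.cv gam_sq _

lemma heat_integral {R : En n → Mat d} (h : SG R) (c : ℝ) : ∫ x, heat c R x = ∫ x, R x :=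
  cv_integral (tl_act _) h.int

lemma heat_congr {R S : En n → Mat d} (h : R =ᵐ[volume] S) (c : ℝ) :
    heat c R =ᵐ[volume] heat c S := cv_congr (tl_act _) h

lemma heat_heat {R : En n → Mat d} (hR : SG R) {a b c : ℝ} (h : c ^ 2 = a ^ 2 + b ^ 2) :
    heat a (heat b R) =ᵐ[volume] heat c R := by
  set L : En n × En n →L[ℝ] En n := a • ContinuousLinearMap.fst ℝ _ _
    + b • ContinuousLinearMap.snd ℝ _ _ with hL
  filter_upwards [cv_sec (η := (gam n).prod (gam n)) (tl_act L) hR.int] with x hx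
  have e1 : heat a (heat b R) x = ∫ p, R (tl L p x) ∂((gam n).prod (gam n)) := by
    rw [integral_prod _ hx]
    simp only [heat_apply]
    refine integral_congr_ae (Eventually.of_forall fun z => ?_)
    refine integral_congr_ae (Eventually.of_forall fun z' => ?_)
    simp [tl, hL, sub_sub]
  rw [e1]
  have m1 : AEStronglyMeasurable (fun w => R (x - w))
      (((gam n).prod (gam n)).map (fun p => a • p.1 + b • p.2)) :=
    (hR.sm.comp_measurable (by fun_prop)).aestronglyMeasurable
  have e2 := integral_map (f := fun w => R (x - w)) (μ := (gam n).prod (gam n))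
    (φ := fun p => a • p.1 + b • p.2) (by fun_prop) m1
  have e3 := integral_map (f := fun w => R (x - w)) (μ := gam n)
    (φ := fun z => c • z) (by fun_prop)
    ((hR.sm.comp_measurable (by fun_prop)).aestronglyMeasurable)
  rw [gam_conv h] at e2
  rw [heat_apply, ← e3, e2]
  rfl

/-- Entropy along the heat flow. -/
def GG (R : En n → Mat d) (t : ℝ) : ℝ := hh volume (heat (√t) R)

lemma GG_add {R : En n → Mat d} (hR : SG R) {a t s : ℝ} (ht : 0 ≤ t) (hs : 0 ≤ s)
    (ha : a ^ 2 = s) :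
    hh volume (heat a (heat (√t) R)) = GG R (t + s) := by
  refine hh_congr (heat_heat hR ?_)
  rw [Real.sq_sqrt (by positivity), Real.sq_sqrt ht, ha, add_comm]

lemma GG_zero (R : En n → Mat d) : GG R 0 = hh volume R := by
  simp [GG, heat_zero]

lemma GG_mono {R : En n → Mat d} (hR : SG R) {t s : ℝ} (ht : 0 ≤ t) (hs : 0 ≤ s) :
    GG R t ≤ GG R (t + s) := by
  rw [← GG_add hR ht hs (Real.sq_sqrt hs)]
  exact hh_mono gam_sq (hR.heat _) _

/-- Increments of `GG` decrease. -/
lemma GG_dec {R : En n → Mat d} (hR : SG R) {t s u : ℝ} (ht : 0 ≤ t) (hs : 0 ≤ s) (hu : 0 ≤ u) :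
    GG R (t + s + u) - GG R (t + u) ≤ GG R (t + s) - GG R t := by
  have h := hh_dec gam_sq (hR.heat (√t)) ((√s) • ContinuousLinearMap.id ℝ (En n))
    ((√u) • ContinuousLinearMap.id ℝ (En n))
  have e1 : hh volume (heat (√s) (heat (√t) R)) = GG R (t + s) :=
    GG_add hR ht hs (Real.sq_sqrt hs)
  have e2 : hh volume (heat (√u) (heat (√t) R)) = GG R (t + u) :=
    GG_add hR ht hu (Real.sq_sqrt hu)
  have e3 : hh volume (heat (√u) (heat (√s) (heat (√t) R))) = GG R (t + s + u) := by
    rw [← GG_add hR (a := √u) (add_nonneg ht hs) hu (Real.sq_sqrt hu)]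
    refine hh_congr (heat_congr (heat_heat hR ?_) _)
    rw [Real.sq_sqrt (by positivity), Real.sq_sqrt ht, Real.sq_sqrt hs, add_comm]
  rw [← e1, ← e2, ← e3]
  exact h
end gauss

section tensor
variable {α β : Type*} [MeasurableSpace α] [MeasurableSpace β] {μ : Measure α} {ν : Measure β}
  [SFinite μ] [SFinite ν] {d : ℕ}

lemma xlog_mul {x y : ℝ} (hx : 0 < x) (_hy : 0 ≤ y) :
    (x * y) * log (x * y) = (y * log y) * x + y * (x * log x) := by
  rcases eq_or_ne y 0 with h | h
  · simp [h]
  · rw [Real.log_mul hx.ne' h]; ring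

lemma GD_tensor {R : α → Mat d} (h : GD μ R) {k : β → ℝ} (hk : Wt ν k)
    (hke : Integrable (fun x => k x * log (k x)) ν) :
    GD (μ.prod ν) (fun p : α × β => (k p.2 : ℂ) • R p.1) where
  sm := sm_smul (hk.meas.comp measurable_snd) (h.sm.comp_measurable measurable_fst)
  psd := fun p => psd_smul (hk.pos _).le (h.psd _)
  int := by
    refine integrable_mat (sm_smul (hk.meas.comp measurable_snd)
      (h.sm.comp_measurable measurable_fst)).aestronglyMeasurable
      (fun p => psd_smul (hk.pos _).le (h.psd _)) ?_
    simp only [rtr_smul]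
    simpa only [mul_comm] using h.int.rtr'.mul_prod hk.int
  ent := by
    simp only [rtr_smul]
    have e : ∀ p : α × β, k p.2 * rtr (R p.1) * log (k p.2 * rtr (R p.1)) =
      (rtr (R p.1) * log (rtr (R p.1))) * k p.2 + rtr (R p.1) * (k p.2 * log (k p.2)) := fun p =>
        xlog_mul (hk.pos _) (rtr_nonneg (h.psd _))
    simp only [e]
    exact (h.ent.mul_prod hk.int).add (h.int.rtr'.mul_prod hke)

lemma hh_tensor {R : α → Mat d} (h : GD μ R) {k : β → ℝ} (hk : Wt ν k)
    (hke : Integrable (fun x => k x * log (k x)) ν) :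
    hh (μ.prod ν) (fun p : α × β => (k p.2 : ℂ) • R p.1)
      = hh μ R - rtr (∫ x, R x ∂μ) * ∫ y, k y * log (k y) ∂ν := by
  unfold hh
  have e : ∀ p : α × β, vnEnt ((k p.2 : ℂ) • R p.1) =
      vnEnt (R p.1) * k p.2 - rtr (R p.1) * (k p.2 * log (k p.2)) := fun p => by
    rw [vnEnt_smul (h.psd _) (hk.pos _).le]; ring
  simp only [e]
  rw [integral_sub (h.vn.mul_prod hk.int) (h.int.rtr'.mul_prod hke), integral_prod_mul
    (fun x => vnEnt (R x)) k,
    integral_prod_mul (fun x => rtr (R x)) (fun y => k y * log (k y)), hk.one, mul_one,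
    rtr_integral h.int]
end tensor

section kern
variable {n d : ℕ}

/-- The Gaussian kernel with standard deviation `c`. -/
def kc (n : ℕ) (c : ℝ) (x : En n) : ℝ := (c ^ n)⁻¹ * gaussDensity n (c⁻¹ • x)

/-- The normalisation constant in the logarithm of the kernel. -/
def kap (n : ℕ) (c : ℝ) : ℝ := n * (log c + log (2 * π) / 2)

lemma kc_pos {c : ℝ} (hc : 0 < c) (x : En n) : 0 < kc n c x :=
  mul_pos (by positivity) (gd_pos _)

lemma kc_meas {c : ℝ} : Measurable (kc n c) := by
  unfold kc
  exact (gd_meas.comp (measurable_const_smul _)).const_mul _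

lemma log_kc {c : ℝ} (hc : 0 < c) (x : En n) :
    log (kc n c x) = - kap n c - ‖x‖ ^ 2 / (2 * c ^ 2) := by
  unfold kc gaussDensity kap
  rw [Real.log_mul (by positivity) (by positivity), Real.log_mul (by positivity) (by positivity),
    Real.log_exp, Real.log_inv, Real.log_pow, Real.log_rpow (by positivity), norm_smul, norm_inv,
    Real.norm_of_nonneg hc.le]
  field_simp
  ring

lemma kc_integral {G : Type*} [NormedAddCommGroup G] [NormedSpace ℝ G] {c : ℝ} (hc : 0 < c)
    (f : En n → G) : ∫ x, kc n c x • f x = ∫ z, f (c • z) ∂(gam n) := by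
  rw [integral_gam]
  have := Measure.integral_comp_smul (volume : Measure (En n))
    (fun x => gaussDensity n (c⁻¹ • x) • f x) c
  simp only [smul_smul, inv_mul_cancel₀ hc.ne', one_smul] at this
  rw [this, finrank_euclideanSpace_fin, ← integral_smul, abs_of_pos (by positivity)]
  simp only [kc, smul_smul]

lemma kc_integrable {G : Type*} [NormedAddCommGroup G] [NormedSpace ℝ G] {c : ℝ} (hc : 0 < c)
    {f : En n → G} (hf : Integrable (fun z => f (c • z)) (gam n)) :
    Integrable (fun x => kc n c x • f x) := by
  rw [integrable_gam] at hf
  have := (integrable_comp_smul_iff (volume : Measure (En n))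
    (fun x => gaussDensity n (c⁻¹ • x) • f x) hc.ne')
  simp only [smul_smul, inv_mul_cancel₀ hc.ne', one_smul] at this
  have := (this.1 hf).smul (c ^ n)⁻¹
  simpa only [kc, smul_smul, Pi.smul_def] using this

lemma kc_wt {c : ℝ} (hc : 0 < c) : Wt volume (kc n c) where
  meas := kc_meas
  pos := kc_pos hc
  int := by
    have := kc_integrable (n := n) hc (f := fun _ => (1:ℝ)) (integrable_const _)
    simpa using this
  one := by
    have := kc_integral (n := n) hc (f := fun _ => (1:ℝ))
    simpa using this

/-- The second moment of the standard Gaussian. -/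
def vv (n : ℕ) : ℝ := ∫ z, ‖z‖ ^ 2 ∂(gam n)

lemma kc_sq {c : ℝ} (hc : 0 < c) : Integrable (fun x => kc n c x * ‖x‖ ^ 2) := by
  have := kc_integrable (n := n) hc (f := fun x => ‖x‖ ^ 2) (by
    simp only [norm_smul, mul_pow]
    exact gam_sq.const_mul _)
  simpa using this

lemma kc_sq_int {c : ℝ} (hc : 0 < c) : ∫ x, kc n c x * ‖x‖ ^ 2 = c ^ 2 * vv n := by
  have := kc_integral (n := n) hc (f := fun x => ‖x‖ ^ 2)
  simp only [norm_smul, mul_pow, integral_const_mul, smul_eq_mul] at this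
  rw [this, Real.norm_of_nonneg hc.le]; rfl

lemma kc_log_eq {c : ℝ} (hc : 0 < c) (x : En n) : kc n c x * log (kc n c x) =
    -(kap n c) * kc n c x - (2 * c ^ 2)⁻¹ * (kc n c x * ‖x‖ ^ 2) := by
  rw [log_kc hc]; field_simp

lemma kc_log {c : ℝ} (hc : 0 < c) : Integrable (fun x => kc n c x * log (kc n c x)) := by
  simp only [kc_log_eq hc]
  exact ((kc_wt hc).int.const_mul _).sub ((kc_sq hc).const_mul _)

lemma kc_log_int {c : ℝ} (hc : 0 < c) :
    ∫ x, kc n c x * log (kc n c x) = - kap n c - vv n / 2 := by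
  simp only [kc_log_eq hc]
  rw [integral_sub ((kc_wt hc).int.const_mul _) ((kc_sq hc).const_mul _), integral_const_mul,
    integral_const_mul, (kc_wt hc).one, kc_sq_int hc]
  field_simp

lemma heat_kc {c : ℝ} (hc : 0 < c) (R : En n → Mat d) (x : En n) :
    heat c R x = ∫ a, (kc n c (x - a) : ℂ) • R a := by
  rw [heat_apply, ← kc_integral hc (fun w => R (x - w)),
    ← integral_sub_left_eq_self (fun a => (kc n c (x - a) : ℂ) • R a) volume x]
  simp only [sub_sub_cancel]
  rfl

lemma shear_sub_mp : MeasurePreserving (fun p : En n × En n => (p.1, p.2 - p.1))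
    (volume.prod volume) (volume.prod volume) :=
  MeasurePreserving.skew_product (g := fun a b => b - a) (MeasurePreserving.id volume)
    (by fun_prop) (Eventually.of_forall fun z => (measurePreserving_sub_right volume z).map_eq)

lemma heat_lower {R : En n → Mat d} (h : SG R) {c : ℝ} (hc : 0 < c) :
    vnEnt (∫ x, R x) + rtr (∫ x, R x) * (kap n c + vv n / 2) ≤ hh volume (heat c R) := by
  have h0 := GD_tensor h.toGD (kc_wt (n := n) hc) (kc_log hc)
  set Q : En n × En n → Mat d := fun p => (kc n c (p.2 - p.1) : ℂ) • R p.1 with hQ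
  have hG : GD (volume.prod volume) Q := by
    have := GD.comp h0 shear_sub_mp
    exact this
  have hhQ : hh (volume.prod volume) Q
      = hh volume R - rtr (∫ x, R x) * ∫ y, kc n c y * log (kc n c y) := by
    rw [← hh_tensor h.toGD (kc_wt (n := n) hc) (kc_log hc), ← hh_comp h0 shear_sub_mp]
  have hA : mA volume Q = R := by
    funext a
    have : mA volume Q a = ∫ b, kc n c (b - a) • R a := rfl
    rw [this, integral_smul_const, integral_sub_right_eq_self (kc n c) a, (kc_wt hc).one, one_smul]
  have hB : mB volume Q = heat c R := by
    funext b
    rw [heat_kc hc]; rfl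
  have hl : Integrable (fun z : En n × En n => rtr (Q z) * log (wF (En n) z.1))
      (volume.prod volume) := by
    have i0 : Integrable (fun z : En n × En n => (rtr (R z.1) * log (wF (En n) z.1)) * kc n c z.2)
      (volume.prod volume) := (h.gr (Gr_log_wF _)).mul_prod (kc_wt hc).int
    have := shear_sub_mp.integrable_comp_of_integrable i0
    refine this.congr (Eventually.of_forall fun p => ?_)
    simp only [hQ, rtr_smul, Function.comp]
    ring
  have := ssa hG (by rw [hA]; exact h.toGD) (by rw [hB]; exact (h.heat c).toGD) (wF_wt _) hl
  rw [← int_mA hG.int, hA, hB, hhQ, kc_log_int hc] at this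
  linarith

lemma heat_mom {R : En n → Mat d} (h : SG R) (c : ℝ) :
    ∫ x, rtr (heat c R x) * ‖x‖ ^ 2 = (∫ x, rtr (R x) * ‖x‖ ^ 2)
      + rtr (∫ x, R x) * (c ^ 2 * vv n) := by
  obtain ⟨-, i1, e1⟩ := cv_test (η := gam n) gam_sq h (c • ContinuousLinearMap.id ℝ (En n)) Gr_sq
  obtain ⟨-, i2, -⟩ := cv_test (η := gam n) gam_sq h ((-c) • ContinuousLinearMap.id ℝ (En n)) Gr_sq
  have e0 : ∫ x, rtr (heat c R x) * ‖x‖ ^ 2 = _ := e1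
  have mpn : MeasurePreserving (fun p : En n × En n => (p.1, -p.2)) (volume.prod (gam n))
      (volume.prod (gam n)) :=
    (MeasurePreserving.id volume).prod ⟨by fun_prop, gam_neg⟩
  have e2 : ∫ p : En n × En n, rtr (R p.1) * ‖p.1 + (c • ContinuousLinearMap.id ℝ (En n)) p.2‖ ^ 2
      ∂(volume.prod (gam n)) = ∫ p : En n × En n, rtr (R p.1) *
        ‖p.1 + ((-c) • ContinuousLinearMap.id ℝ (En n)) p.2‖ ^ 2 ∂(volume.prod (gam n)) := by
    have e := integral_map (μ := volume.prod (gam n)) (f := fun p : En n × En n => rtr (R p.1) * ‖p.1 + (c • ContinuousLinearMap.id ℝ (En n)) p.2‖ ^ 2)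
      mpn.measurable.aemeasurable (by rw [mpn.map_eq]; exact i1.1)
    rw [mpn.map_eq] at e
    rw [e]
    refine integral_congr_ae (Eventually.of_forall fun p => ?_)
    simp
  have hi : Integrable (fun x => rtr (R x) * ‖x‖ ^ 2) := h.gr Gr_sq
  have a1 : Integrable (fun p : En n × En n => (rtr (R p.1) * ‖p.1‖ ^ 2) * (1:ℝ))
      (volume.prod (gam n)) := hi.mul_prod (integrable_const 1)
  have a2 : Integrable (fun p : En n × En n => rtr (R p.1) * (‖p.2‖ ^ 2))
      (volume.prod (gam n)) := h.int.rtr'.mul_prod gam_sq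
  have e3 : ∫ p : En n × En n, (rtr (R p.1) * ‖p.1‖ ^ 2) * (1:ℝ) + c ^ 2 *
      (rtr (R p.1) * (‖p.2‖ ^ 2)) ∂(volume.prod (gam n)) = (∫ x, rtr (R x) * ‖x‖ ^ 2)
      + rtr (∫ x, R x) * (c ^ 2 * vv n) := by
    rw [integral_add a1 (a2.const_mul _), integral_const_mul,
      integral_prod_mul (fun x => rtr (R x) * ‖x‖ ^ 2) (fun _ => (1:ℝ)),
      integral_prod_mul (fun x => rtr (R x)) (fun z => ‖z‖ ^ 2), rtr_integral h.int]
    simp only [integral_const, probReal_univ, smul_eq_mul, mul_one, vv]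
    ring
  rw [e0, ← e3]
  have e4 := integral_add i1 i2
  rw [← e2] at e4
  have e5 : ∫ p : En n × En n, (rtr (R p.1) * ‖p.1 + (c • ContinuousLinearMap.id ℝ (En n)) p.2‖ ^ 2
      + rtr (R p.1) * ‖p.1 + ((-c) • ContinuousLinearMap.id ℝ (En n)) p.2‖ ^ 2)
      ∂(volume.prod (gam n)) = 2 * ∫ p : En n × En n, (rtr (R p.1) * ‖p.1‖ ^ 2) * (1:ℝ) + c ^ 2 *
      (rtr (R p.1) * (‖p.2‖ ^ 2)) ∂(volume.prod (gam n)) := by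
    rw [← integral_const_mul]
    refine integral_congr_ae (Eventually.of_forall fun p => ?_)
    have := parallelogram_law_with_norm ℝ p.1 (c • p.2)
    have hn : ‖c • p.2‖ ^ 2 = c ^ 2 * ‖p.2‖ ^ 2 := by rw [norm_smul, mul_pow]; simp
    simp only [smul_apply, ContinuousLinearMap.id_apply, neg_smul,
      ← sub_eq_add_neg]
    rw [← mul_add]
    have : ‖p.1 + c • p.2‖ ^ 2 + ‖p.1 - c • p.2‖ ^ 2 = 2 * (‖p.1‖ ^ 2 + c ^ 2 * ‖p.2‖ ^ 2) := by
      rw [← hn]; linarith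
    rw [this]; ring
  linarith [e4, e5]

lemma heat_upper {R : En n → Mat d} (h : SG R) {c : ℝ} (hc : 0 < c) :
    hh volume (heat c R) ≤ vnEnt (∫ x, R x) + rtr (∫ x, R x) * (kap n c + vv n / 2)
      + (∫ x, rtr (R x) * ‖x‖ ^ 2) / (2 * c ^ 2) := by
  have h' := h.heat c
  have i1 : Integrable (fun x => rtr (heat c R x) * ‖x‖ ^ 2) := h'.gr Gr_sq
  have e : ∀ x, rtr (heat c R x) * log (kc n c x) = -(kap n c) * rtr (heat c R x)
      - (2 * c ^ 2)⁻¹ * (rtr (heat c R x) * ‖x‖ ^ 2) := fun x => by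
    rw [log_kc hc]; field_simp
  have hl : Integrable (fun x => rtr (heat c R x) * log (kc n c x)) := by
    simp only [e]
    exact (h'.int.rtr'.const_mul _).sub (i1.const_mul _)
  have := (acc_one h'.toGD (kc_wt hc) hl).2
  simp only [e] at this
  rw [integral_sub (h'.int.rtr'.const_mul _) (i1.const_mul _), integral_const_mul,
    integral_const_mul, heat_mom h, ← rtr_integral h'.int, heat_integral h] at this
  have e2 : (2 * c ^ 2)⁻¹ * ((∫ x, rtr (R x) * ‖x‖ ^ 2) + rtr (∫ x, R x) * (c ^ 2 * vv n))
      = (∫ x, rtr (R x) * ‖x‖ ^ 2) / (2 * c ^ 2) + rtr (∫ x, R x) * (vv n / 2) := by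
    field_simp
  rw [e2] at this
  linarith
end kern

section joint
variable {n d : ℕ}

lemma SG_of_ae {F : Type*} [NormedAddCommGroup F] [NormedSpace ℝ F] [FiniteDimensional ℝ F]
    [MeasureSpace F] [BorelSpace F] [(volume : Measure F).IsAddHaarMeasure]
    {R N : F → Mat d} (hsm : StronglyMeasurable R)
    (hpsd : ∀ x, (R x).PosSemidef) (hN : SG N) (hae : R =ᵐ[volume] N) : SG R where
  sm := hsm
  psd := hpsd
  int := hN.int.congr hae.symm
  ent := hN.ent.congr (hae.symm.mono fun b hb => by simp only [hb])
  mom := hN.mom.congr (hae.symm.mono fun b hb => by simp only [hb])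

lemma Gr_comp {F G : Type*} [NormedAddCommGroup F] [NormedSpace ℝ F] [MeasurableSpace F]
    [BorelSpace F] [NormedAddCommGroup G] [NormedSpace ℝ G] [MeasurableSpace G] [BorelSpace G]
    {g : F → ℝ} (hg : Gr g) (L : G →L[ℝ] F) : Gr (fun x => g (L x)) := by
  obtain ⟨hm, C, hC⟩ := hg
  have hC0 : 0 ≤ C := by
    have := (abs_nonneg _).trans (hC 0)
    simpa using this
  refine ⟨hm.comp L.measurable, C * (1 + ‖L‖ ^ 2), fun x => (hC _).trans ?_⟩
  rw [mul_assoc]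
  refine mul_le_mul_of_nonneg_left ?_ hC0
  have := pow_le_pow_left₀ (norm_nonneg _) (L.le_opNorm x) 2
  nlinarith [sq_nonneg ‖L‖, sq_nonneg ‖x‖]

instance instHaarProd : (volume : Measure (En n × En n)).IsAddHaarMeasure := by
  rw [Measure.volume_eq_prod]
  infer_instance

/-- Correlated Gaussian noise on a pair. -/
def jn (α β : ℝ) (R : En n × En n → Mat d) : En n × En n → Mat d :=
  cv (pa (tl (α • ContinuousLinearMap.id ℝ (En n))) (tl (β • ContinuousLinearMap.id ℝ (En n))))
    (gam n) R

lemma jn_apply (α β : ℝ) (R : En n × En n → Mat d) (p : En n × En n) :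
    jn α β R p = ∫ z, R (p.1 - α • z, p.2 - β • z) ∂(gam n) := rfl

lemma jn_eq (α β : ℝ) (R : En n × En n → Mat d) :
    jn α β R = cv (tl ((α • ContinuousLinearMap.id ℝ (En n)).prod
      (β • ContinuousLinearMap.id ℝ (En n)))) (gam n) R := rfl

/-- The marginal of the sum. -/
def mS (R : En n × En n → Mat d) : En n → Mat d := fun s => ∫ a, R (a, s - a)

lemma mS_eq (R : En n × En n → Mat d) : mS R = mB volume (fun p => R (p.1, p.2 - p.1)) := rfl

lemma mS_sm {R : En n × En n → Mat d} (h : StronglyMeasurable R) : StronglyMeasurable (mS R) := by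
  rw [mS_eq]
  exact mB_sm (h.comp_measurable (by fun_prop))

lemma SG.jn {R : En n × En n → Mat d} (h : SG R) (α β : ℝ) : SG (jn α β R) := by
  rw [jn_eq]
  exact h.cv gam_sq _

lemma jn_integral {R : En n × En n → Mat d} (h : SG R) (α β : ℝ) :
    ∫ p, jn α β R p = ∫ p, R p := by
  rw [jn_eq]
  exact cv_integral (tl_act _) h.int

lemma mA_jn {R : En n × En n → Mat d} (h : SG R) (α β : ℝ) :
    mA volume (jn α β R) =ᵐ[volume] heat α (mA volume R) :=
  mA_cv (tl_act _) (tl_act _) h.int h.sm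

lemma mB_jn {R : En n × En n → Mat d} (h : SG R) (α β : ℝ) :
    mB volume (jn α β R) =ᵐ[volume] heat β (mB volume R) :=
  mB_cv (tl_act _) (tl_act _) h.int h.sm

lemma mS_jn {R : En n × En n → Mat d} (h : SG R) (α β : ℝ) :
    mS (jn α β R) =ᵐ[volume] heat (α + β) (mS R) := by
  have hG : GD (volume.prod volume) (fun p : En n × En n => R (p.1, p.2 - p.1)) := by
    have := GD.comp (m := volume.prod volume) h.toGD shear_sub_mp
    exact this
  have e : (fun p : En n × En n => jn α β R (p.1, p.2 - p.1))
      = jn α (α + β) (fun p => R (p.1, p.2 - p.1)) := by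
    funext p
    simp only [jn_apply]
    refine integral_congr_ae (Eventually.of_forall fun z => ?_)
    dsimp only
    congr 2
    rw [add_smul]; abel
  rw [mS_eq, mS_eq, e]
  exact mB_cv (tl_act _) (tl_act _) hG.int hG.sm

lemma dpi0 {R : En n × En n → Mat d} (β : ℝ) (h : GD (volume.prod volume) R)
    (hB : SG (mB volume R)) (h' : GD (volume.prod volume) (jn 0 β R))
    (hl : Integrable (fun z : En n × En n => rtr (R z) * log (wF (En n) z.1))
      (volume.prod volume)) :
    hh volume (heat β (mB volume R)) - hh (volume.prod volume) (jn 0 β R)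
      ≤ hh volume (mB volume R) - hh (volume.prod volume) R := by
  have e : jn 0 β R = cv (pa (fun (_ : En n) (a : En n) => a)
      (tl (β • ContinuousLinearMap.id ℝ (En n)))) (gam n) R := by
    unfold jn
    congr 2
    funext z x
    simp [tl]
  rw [e] at h' ⊢
  exact dpi (tl_act _) h hB.toGD h' (hB.heat β).toGD (wF_wt _) hl

/-- A regular state with conditionally independent variables. -/
structure CQ (R : En n × En n → Mat d) : Prop where
  sg : SG R
  sx : SG (mA volume R)
  sy : SG (mB volume R)
  ss : SG (mS R)
  ci : hh volume (mA volume R) + hh volume (mB volume R) ≤ hh volume R + vnEnt (∫ p, R p)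

lemma jn_marg {R : En n × En n → Mat d} (h : CQ R) (α β : ℝ) :
    SG (mA volume (jn α β R)) ∧ SG (mB volume (jn α β R)) ∧ SG (mS (jn α β R)) := by
  have hs := h.sg.jn α β
  exact ⟨SG_of_ae (mA_sm hs.sm) (fun x => psd_integral fun _ => hs.psd _) (h.sx.heat _)
      (mA_jn h.sg _ _), SG_of_ae (mB_sm hs.sm) (fun x => psd_integral fun _ => hs.psd _)
      (h.sy.heat _) (mB_jn h.sg _ _), SG_of_ae (mS_sm hs.sm)
      (fun x => psd_integral fun _ => hs.psd _) (h.ss.heat _) (mS_jn h.sg _ _)⟩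

lemma log_fst {R : En n × En n → Mat d} (h : SG R) (L : En n × En n →L[ℝ] En n) :
    Integrable (fun z : En n × En n => rtr (R z) * log (wF (En n) (L z))) (volume.prod volume) :=
  h.gr (Gr_comp (Gr_log_wF (En n)) L)

lemma CQ.jnB {R : En n × En n → Mat d} (h : CQ R) (β : ℝ) : CQ (jn 0 β R) := by
  obtain ⟨a, b, c⟩ := jn_marg h 0 β
  refine ⟨h.sg.jn 0 β, a, b, c, ?_⟩
  have h1 := dpi0 β h.sg.toGD h.sy (h.sg.jn 0 β).toGD
    (log_fst h.sg (ContinuousLinearMap.fst ℝ _ _))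
  have e1 : hh volume (mA volume (jn 0 β R)) = hh volume (mA volume R) := by
    rw [hh_congr (mA_jn h.sg 0 β), heat_zero]
  rw [hh_congr (mB_jn h.sg 0 β), e1, jn_integral h.sg]
  have := h.ci
  rw [Measure.volume_eq_prod] at *
  linarith

lemma swap_mp : MeasurePreserving (Prod.swap : En n × En n → En n × En n) (volume.prod volume)
    (volume.prod volume) := Measure.measurePreserving_swap

lemma CQ.swap {R : En n × En n → Mat d} (h : CQ R) : CQ (fun p => R p.swap) where
  sg := by
    have hG : GD (volume.prod volume) (fun p : En n × En n => R p.swap) := by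
      have := GD.comp (m := volume.prod volume) h.sg.toGD swap_mp
      exact this
    refine ⟨hG, ?_⟩
    have := swap_mp.integrable_comp_of_integrable h.sg.mom
    refine this.congr (Eventually.of_forall fun p => ?_)
    simp [Function.comp, Prod.norm_def, max_comm]
  sx := h.sy
  sy := h.sx
  ss := by
    have : mS (fun p : En n × En n => R p.swap) = mS R := by
      funext s
      have := integral_sub_left_eq_self (fun a => R (a, s - a)) volume s
      simp only [sub_sub_cancel] at this
      exact this
    rw [this]; exact h.ss
  ci := by
    have := h.ci
    have e1 : hh volume (fun p : En n × En n => R p.swap) = hh volume R :=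
      hh_comp (m := volume.prod volume) h.sg.toGD swap_mp
    have e2 : ∫ p : En n × En n, R p.swap = ∫ p, R p :=
      int_comp (m := volume.prod volume) h.sg.toGD swap_mp
    rw [e1, e2, add_comm]
    exact this

lemma CQ.jnA {R : En n × En n → Mat d} (h : CQ R) (α : ℝ) : CQ (jn α 0 R) :=
  (h.swap.jnB α).swap

lemma addl_mp (l : ℝ) : MeasurePreserving (fun p : En n × En n => (l • p.2 + p.1, p.2))
    (volume.prod volume) (volume.prod volume) := by
  have h1 : MeasurePreserving (fun p : En n × En n => (id p.1, l • p.1 + p.2))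
      (volume.prod volume) (volume.prod volume) :=
    MeasurePreserving.skew_product (g := fun a b => l • a + b) (MeasurePreserving.id volume)
      (by fun_prop)
      (Eventually.of_forall fun z => (measurePreserving_add_left volume (l • z)).map_eq)
  exact swap_mp.comp (h1.comp swap_mp)

lemma coord_mp (l : ℝ) : MeasurePreserving
    (fun p : En n × En n => (l • p.2 + p.1, p.2 - (l • p.2 + p.1)))
    (volume.prod volume) (volume.prod volume) := shear_sub_mp.comp (addl_mp l)

lemma CQ.step {R : En n × En n → Mat d} (h : CQ R) (l σ : ℝ) :
    hh volume (heat σ (mS R)) - hh volume (mS R) ≤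
      hh volume (heat (l * σ) (mA volume R)) - hh volume (mA volume R)
      + (hh volume (heat ((1 - l) * σ) (mB volume R)) - hh volume (mB volume R)) := by
  set φ : En n × En n → En n × En n := fun p => (l • p.2 + p.1, p.2 - (l • p.2 + p.1)) with hφ
  have mp : MeasurePreserving φ (volume.prod volume) (volume.prod volume) := coord_mp l
  set R3 := jn (l * σ) ((1 - l) * σ) R with hR3
  set Q : En n × En n → Mat d := fun p => R (φ p) with hQ
  have s3 : SG R3 := h.sg.jn _ _
  have gQ : GD (volume.prod volume) Q := GD.comp (m := volume.prod volume) h.sg.toGD mp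
  have g3 : GD (volume.prod volume) (fun p => R3 (φ p)) :=
    GD.comp (m := volume.prod volume) s3.toGD mp
  have e3 : (fun p => R3 (φ p)) = jn 0 σ Q := by
    funext p
    simp only [hR3, jn_apply, hQ]
    refine integral_congr_ae (Eventually.of_forall fun z => ?_)
    simp only [hφ]
    congr 2
    · simp only [smul_sub, smul_smul, zero_smul, sub_zero]; abel
    · simp only [smul_sub, smul_smul, zero_smul, sub_zero, sub_mul, sub_smul, one_mul]; abel
  have eB : mB volume Q = mS R := by
    funext u
    exact integral_add_left_eq_self (fun a => R (a, u - a)) (l • u)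
  have hl : Integrable (fun z : En n × En n => rtr (Q z) * log (wF (En n) z.1))
      (volume.prod volume) := by
    have i0 := log_fst h.sg (ContinuousLinearMap.fst ℝ (En n) (En n)
      - l • (ContinuousLinearMap.fst ℝ (En n) (En n) + ContinuousLinearMap.snd ℝ (En n) (En n)))
    have := mp.integrable_comp_of_integrable i0
    refine this.congr (Eventually.of_forall fun p => ?_)
    simp only [hQ, hφ, Function.comp]
    congr 3
    simp
    simp only [smul_sub, smul_add]
    abel
  have d := dpi0 σ gQ (by rw [eB]; exact h.ss) (by rw [← e3]; exact g3) hl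
  rw [eB, ← e3, hh_comp (m := volume.prod volume) s3.toGD mp,
    hh_comp (m := volume.prod volume) h.sg.toGD mp] at d
  obtain ⟨ma, mb, -⟩ := jn_marg h (l * σ) ((1 - l) * σ)
  have s := ssa (μ := volume) (ν := volume) s3.toGD ma.toGD mb.toGD (wF_wt (En n))
    (log_fst s3 (ContinuousLinearMap.fst ℝ _ _))
  have ei : ∫ z, R3 z ∂(volume.prod volume) = ∫ p, R p := jn_integral h.sg _ _
  rw [ei, hh_congr (mA_jn h.sg _ _), hh_congr (mB_jn h.sg _ _)] at s
  have ci := h.ci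
  rw [Measure.volume_eq_prod] at ci
  rw [Measure.volume_eq_prod] at s
  linarith

/-- The basic comparison of entropy increments. -/
lemma CQ.incr {R : En n × En n → Mat d} (h : CQ R) {l t s : ℝ} (hl0 : 0 < l) (hl1 : l < 1)
    (ht : 0 ≤ t) (hs : 0 ≤ s) :
    GG (mS R) (t + s) - GG (mS R) t ≤
      GG (mA volume R) (l * t + l ^ 2 * s) - GG (mA volume R) (l * t)
      + (GG (mB volume R) ((1 - l) * t + (1 - l) ^ 2 * s) - GG (mB volume R) ((1 - l) * t)) := by
  have p1 : 0 ≤ l * t := by positivity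
  have p2 : 0 ≤ (1 - l) * t := mul_nonneg (by linarith) ht
  set α := √(l * t) with hα
  set β := √((1 - l) * t) with hβ
  have h1 := h.jnA α
  have h2 := h1.jnB β
  have key := h2.step l (√s)
  have A : mA volume (jn 0 β (jn α 0 R)) =ᵐ[volume] heat α (mA volume R) := by
    have := mA_jn h1.sg 0 β
    rw [heat_zero] at this
    exact this.trans (mA_jn h.sg α 0)
  have B : mB volume (jn 0 β (jn α 0 R)) =ᵐ[volume] heat β (mB volume R) := by
    have := mB_jn h.sg α 0
    rw [heat_zero] at this
    exact (mB_jn h1.sg 0 β).trans (heat_congr this _)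
  have S : mS (jn 0 β (jn α 0 R)) =ᵐ[volume] heat (√t) (mS R) := by
    have a1 := mS_jn h.sg α 0
    have a2 := mS_jn h1.sg 0 β
    rw [add_zero] at a1
    rw [zero_add] at a2
    refine (a2.trans (heat_congr a1 _)).trans (heat_heat h.ss ?_)
    rw [Real.sq_sqrt ht, hα, hβ, Real.sq_sqrt p1, Real.sq_sqrt p2]; ring
  rw [hh_congr A, hh_congr B, hh_congr S, hh_congr (heat_congr A _), hh_congr (heat_congr B _),
    hh_congr (heat_congr S _), GG_add h.sx p1 (s := l ^ 2 * s) (by positivity)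
      (by rw [mul_pow, Real.sq_sqrt hs]),
    GG_add h.sy p2 (s := (1 - l) ^ 2 * s) (by positivity) (by rw [mul_pow, Real.sq_sqrt hs]),
    GG_add h.ss ht hs (Real.sq_sqrt hs)] at key
  exact key
end joint

section conc

/-- Monotone functions with decreasing increments. -/
structure MD (G : ℝ → ℝ) : Prop where
  mono : ∀ t s, 0 ≤ t → 0 ≤ s → G t ≤ G (t + s)
  dec : ∀ t s u, 0 ≤ t → 0 ≤ s → 0 ≤ u → G (t + s + u) - G (t + u) ≤ G (t + s) - G t

lemma MD.up {G : ℝ → ℝ} (h : MD G) {τ δ : ℝ} (hδ : 0 ≤ δ) (hτ : δ ≤ τ) (k : ℕ) :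
    G (τ + k * δ) ≤ G τ + k * (G τ - G (τ - δ)) := by
  induction k with
  | zero => simp
  | succ k ih =>
    have := h.dec (τ - δ) δ ((k + 1) * δ) (by linarith) hδ (by positivity)
    rw [show τ - δ + δ + (k + 1) * δ = τ + (k + 1) * δ by ring,
      show τ - δ + (k + 1) * δ = τ + k * δ by ring, show τ - δ + δ = τ by ring] at this
    push_cast
    linarith

lemma MD.down {G : ℝ → ℝ} (h : MD G) {τ δ : ℝ} (hδ : 0 ≤ δ) (m : ℕ) (hτ : m * δ ≤ τ) :
    m * (G τ - G (τ - δ)) ≤ G τ - G (τ - m * δ) := by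
  induction m with
  | zero => simp
  | succ k ih =>
    push_cast at hτ ⊢
    have ih' := ih (by nlinarith)
    have := h.dec (τ - (k + 1) * δ) δ (k * δ) (by linarith) hδ (by positivity)
    rw [show τ - (k + 1) * δ + δ + k * δ = τ by ring,
      show τ - (k + 1) * δ + k * δ = τ - δ by ring,
      show τ - (k + 1) * δ + δ = τ - k * δ by ring] at this
    linarith

lemma MD.scale {G : ℝ → ℝ} (h : MD G) {τ a l : ℝ} (ha : 0 ≤ a) (hτ : a ≤ τ) (hl : 0 ≤ l) :
    G (τ + l * a) - G τ ≤ l * (G τ - G (τ - a)) := by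
  have key : ∀ m : ℕ, G (τ + l * a) - G τ ≤ (l + 1 / ((m : ℝ) + 1)) * (G τ - G (τ - a)) := by
    intro m
    set N : ℝ := (m : ℝ) + 1 with hN
    have hNp : 0 < N := by positivity
    set δ := a / N with hδ
    have hδ0 : 0 ≤ δ := by positivity
    have hδa : N * δ = a := by rw [hδ]; field_simp
    have hN1 : 1 ≤ N := by rw [hN]; have : (0:ℝ) ≤ m := by positivity
                           linarith
    have hδτ : δ ≤ τ := by nlinarith
    have h1 := h.up hδ0 hδτ (⌈l * N⌉₊)
    have h2 := h.down hδ0 (m + 1) (τ := τ) (by push_cast; rw [← hN, hδa]; exact hτ)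
    push_cast at h2
    rw [← hN, hδa] at h2
    have h3 := Nat.le_ceil (l * N)
    have h4 := (Nat.ceil_lt_add_one (a := l * N) (by positivity)).le
    have h5 : G (τ + l * a) ≤ G (τ + ⌈l * N⌉₊ * δ) := by
      have := h.mono (τ + l * a) (⌈l * N⌉₊ * δ - l * a) (by have := mul_nonneg hl ha; linarith)
        (by rw [← hδa]; nlinarith)
      rwa [show τ + l * a + (⌈l * N⌉₊ * δ - l * a) = τ + ⌈l * N⌉₊ * δ by ring] at this
    have h6 : 0 ≤ G τ - G (τ - δ) := by
      have := h.mono (τ - δ) δ (by linarith) hδ0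
      rw [sub_add_cancel] at this
      linarith
    have h7 := mul_le_mul_of_nonneg_right h4 h6
    have h8 : (l * N + 1) * (G τ - G (τ - δ)) = (l + 1 / N) * (N * (G τ - G (τ - δ))) := by
      field_simp
    have h9 : (l + 1 / N) * (N * (G τ - G (τ - δ))) ≤ (l + 1 / N) * (G τ - G (τ - a)) :=
      mul_le_mul_of_nonneg_left h2 (by positivity)
    linarith
  have lim : Tendsto (fun m : ℕ => (l + 1 / ((m : ℝ) + 1)) * (G τ - G (τ - a))) atTop
      (𝓝 ((l + 0) * (G τ - G (τ - a)))) :=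
    (tendsto_const_nhds.add tendsto_one_div_add_atTop_nhds_zero_nat).mul_const _
  rw [add_zero] at lim
  exact ge_of_tendsto' lim key

lemma GG_MD {n d : ℕ} {R : En n → Mat d} (h : SG R) : MD (GG R) :=
  ⟨fun _ _ ht hs => GG_mono h ht hs, fun _ _ _ ht hs hu => GG_dec h ht hs hu⟩

lemma CQ.tele {n d : ℕ} {R : En n × En n → Mat d} (h : CQ R) {l s : ℝ} (hl0 : 0 < l) (hl1 : l < 1)
    (hs : 0 ≤ s) (N : ℕ) :
    GG (mS R) ((N + 1) * s) - GG (mS R) s ≤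
      l * (GG (mA volume R) (l * (N * s)) - GG (mA volume R) 0)
      + (1 - l) * (GG (mB volume R) ((1 - l) * (N * s)) - GG (mB volume R) 0) := by
  induction N with
  | zero => simp
  | succ N ih =>
    have q := h.incr hl0 hl1 (t := (N + 1) * s) (s := s) (by positivity) hs
    have hl2 : 0 < 1 - l := by linarith
    have a1 := (GG_MD h.sx).scale (τ := l * ((N + 1) * s)) (a := l * s) (l := l) (by positivity)
      (mul_le_mul_of_nonneg_left (le_mul_of_one_le_left hs (by
        have : (0:ℝ) ≤ N := by positivity
        linarith)) hl0.le) hl0.le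
    have a2 := (GG_MD h.sy).scale (τ := (1 - l) * ((N + 1) * s)) (a := (1 - l) * s) (l := 1 - l)
      (by positivity)
      (mul_le_mul_of_nonneg_left (le_mul_of_one_le_left hs (by
        have : (0:ℝ) ≤ N := by positivity
        linarith)) hl2.le) hl2.le
    rw [show l * ((N + 1) * s) + l * (l * s) = l * ((N + 1) * s) + l ^ 2 * s by ring,
      show l * ((N + 1) * s) - l * s = l * (N * s) by ring] at a1
    rw [show (1 - l) * ((N + 1) * s) + (1 - l) * ((1 - l) * s)
        = (1 - l) * ((N + 1) * s) + (1 - l) ^ 2 * s by ring,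
      show (1 - l) * ((N + 1) * s) - (1 - l) * s = (1 - l) * (N * s) by ring] at a2
    rw [show ((N:ℝ) + 1) * s + s = (N + 1 + 1) * s by ring] at q
    push_cast
    linarith
end conc

section small
variable {n d : ℕ}

lemma om_tendsto {E : Type*} [NormedAddCommGroup E] {R : En n → E} (h : Integrable R) :
    Tendsto (fun w : En n => ∫⁻ x, ‖R (x - w) - R x‖ₑ) (𝓝 0) (𝓝 0) := by
  have : Fact ((1:ℝ≥0∞) ≤ 1) := ⟨le_rfl⟩
  have hm : MemLp R 1 (volume : Measure (En n)) := memLp_one_iff_integrable.2 h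
  let g : C(En n, C(En n, En n)) :=
    (ContinuousMap.mk (fun a : En n × En n => a.2 - a.1) (by fun_prop)).curry
  have hg : ∀ w, MeasurePreserving (g w) (volume : Measure (En n)) volume := fun w =>
    measurePreserving_sub_right volume w
  have t := Filter.Tendsto.compMeasurePreservingLp (l := 𝓝 (0 : En n))
    (f := fun _ => hm.toLp R) (f₀ := hm.toLp R) (g := g) (g₀ := g 0) tendsto_const_nhds
    (g.continuous.tendsto 0) hg (hg 0) ENNReal.one_ne_top
  have t2 := (tendsto_iff_edist_tendsto_0).1 t
  refine t2.congr fun w => ?_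
  rw [Lp.toLp_compMeasurePreserving, Lp.toLp_compMeasurePreserving, Lp.edist_toLp_toLp,
    eLpNorm_one_eq_lintegral_enorm]
  refine lintegral_congr fun x => ?_
  simp [g]

lemma om_le {E : Type*} [NormedAddCommGroup E] {R : En n → E} (h : Integrable R) (w : En n) :
    ∫⁻ x, ‖R (x - w) - R x‖ₑ ≤ (∫⁻ x, ‖R x‖ₑ) + ∫⁻ x, ‖R x‖ₑ := by
  calc ∫⁻ x, ‖R (x - w) - R x‖ₑ ≤ ∫⁻ x, (‖R (x - w)‖ₑ + ‖R x‖ₑ) :=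
        lintegral_mono fun x => enorm_sub_le
    _ = (∫⁻ x, ‖R (x - w)‖ₑ) + ∫⁻ x, ‖R x‖ₑ := lintegral_add_right' _ h.1.enorm
    _ = _ := by
        congr 1
        exact lintegral_sub_right_eq_self (μ := (volume : Measure (En n))) (fun x => ‖R x‖ₑ) w

lemma heat_L1 {R : En n → Mat d} (h : SG R) {ck : ℕ → ℝ} (hc : Tendsto ck atTop (𝓝 0)) :
    Tendsto (fun k => eLpNorm (heat (ck k) R - R) 1 volume) atTop (𝓝 0) := by
  set om : En n → ℝ≥0∞ := fun w => ∫⁻ x, ‖R (x - w) - R x‖ₑ with hom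
  have hsm : ∀ c : ℝ, StronglyMeasurable (fun p : En n × En n => R (p.2 - c • p.1) - R p.2) := by
    intro c
    refine StronglyMeasurable.sub (h.sm.comp_measurable ?_) (h.sm.comp_measurable measurable_snd)
    fun_prop
  have hme : ∀ c : ℝ, Measurable (fun p : En n × En n => ‖R (p.2 - c • p.1) - R p.2‖ₑ) :=
    fun c => (hsm c).enorm
  have hmeas : ∀ c : ℝ, Measurable (fun z => om (c • z)) := by
    intro c
    exact (hme c).lintegral_prod_right'
  have hle : ∀ c : ℝ, eLpNorm (heat c R - R) 1 volume ≤ ∫⁻ z, om (c • z) ∂gam n := by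
    intro c
    rw [eLpNorm_one_eq_lintegral_enorm]
    have : ∀ᵐ x : En n, ‖(heat c R - R) x‖ₑ ≤ ∫⁻ z, ‖R (x - c • z) - R x‖ₑ ∂gam n := by
      filter_upwards [cv_sec (η := gam n) (tl_act (c • ContinuousLinearMap.id ℝ (En n))) h.int]
        with x hx
      have hx' : Integrable (fun z => R (x - c • z)) (gam n) := hx
      have e : (heat c R - R) x = ∫ z, (R (x - c • z) - R x) ∂gam n := by
        rw [integral_sub hx' (integrable_const _), Pi.sub_apply, heat_apply]
        simp
      rw [e]
      exact enorm_integral_le_lintegral_enorm _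
    refine (lintegral_mono_ae this).trans (le_of_eq ?_)
    refine lintegral_lintegral_swap (f := fun x z => ‖R (x - c • z) - R x‖ₑ) ?_
    exact ((hme c).comp measurable_swap).aemeasurable
  refine tendsto_of_tendsto_of_tendsto_of_le_of_le tendsto_const_nhds ?_ (fun _ => zero_le)
    (fun k => hle (ck k))
  have fin : ∫⁻ x, ‖R x‖ₑ ≠ ⊤ := h.int.2.ne
  have := tendsto_lintegral_of_dominated_convergence (μ := gam n)
    (F := fun k z => om (ck k • z)) (f := fun _ => 0)
    (fun _ => (∫⁻ x, ‖R x‖ₑ) + ∫⁻ x, ‖R x‖ₑ) (fun k => hmeas (ck k))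
    (fun k => Eventually.of_forall fun z => om_le h.int _)
    (by simp [fin]) (Eventually.of_forall fun z => ?_)
  · simpa using this
  · refine (om_tendsto h.int).comp ?_
    have := hc.smul_const z
    rwa [zero_smul] at this

lemma heat_log {R : En n → Mat d} (h : SG R) {ck : ℕ → ℝ} (hc : Tendsto ck atTop (𝓝 0)) :
    Tendsto (fun k => ∫ x, rtr (heat (ck k) R x) * log (wF (En n) x)) atTop
      (𝓝 (∫ x, rtr (R x) * log (wF (En n) x))) := by
  set V : ℝ := ∫ p : En n × En n, rtr (R p.1) * ‖p.2‖ ∂((volume : Measure (En n)).prod (gam n))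
    with hV
  have hz1 : Integrable (fun z : En n => ‖z‖) (gam n) := by
    refine ((integrable_const (1:ℝ)).add gam_sq).mono' (by fun_prop)
      (Eventually.of_forall fun z => ?_)
    simp only [norm_norm, Pi.add_apply]
    nlinarith [sq_nonneg (‖z‖ - 1)]
  have iV : Integrable (fun p : En n × En n => rtr (R p.1) * ‖p.2‖)
      ((volume : Measure (En n)).prod (gam n)) := h.int.rtr'.mul_prod hz1
  have bd : ∀ c : ℝ, |(∫ x, rtr (heat c R x) * log (wF (En n) x))
      - ∫ x, rtr (R x) * log (wF (En n) x)| ≤ |c| * (wr (En n) * V) := by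
    intro c
    obtain ⟨_, i1, e1⟩ := cv_test (η := gam n) gam_sq h
      (c • ContinuousLinearMap.id ℝ (En n)) (Gr_log_wF (En n))
    obtain ⟨_, i0, e0⟩ := cv_test (η := gam n) gam_sq h
      ((0:ℝ) • ContinuousLinearMap.id ℝ (En n)) (Gr_log_wF (En n))
    have e0' : ∫ x, rtr (R x) * log (wF (En n) x)
        = ∫ x, rtr (heat 0 R x) * log (wF (En n) x) := by
      rw [heat_zero]
    replace e0' := e0'.trans e0
    change |(∫ x, rtr (cv (tl (c • ContinuousLinearMap.id ℝ (En n))) (gam n) R x)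
      * log (wF (En n) x)) - _| ≤ _
    rw [e1, e0', ← integral_sub i1 i0, ← integral_const_mul, ← integral_const_mul]
    refine (abs_integral_le_integral_abs).trans ?_
    refine integral_mono (i1.sub i0).abs ((iV.const_mul _).const_mul _) fun p => ?_
    have hr := rtr_nonneg (h.psd p.1)
    simp only [Pi.sub_apply]
    rw [← mul_sub, abs_mul, abs_of_nonneg hr]
    have := log_wF_lip (En n) (p.1 + (c • ContinuousLinearMap.id ℝ (En n)) p.2)
      (p.1 + ((0:ℝ) • ContinuousLinearMap.id ℝ (En n)) p.2)
    have e : ‖p.1 + (c • ContinuousLinearMap.id ℝ (En n)) p.2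
        - (p.1 + ((0:ℝ) • ContinuousLinearMap.id ℝ (En n)) p.2)‖ = |c| * ‖p.2‖ := by
      simp [norm_smul]
    rw [e] at this
    refine (mul_le_mul_of_nonneg_left this hr).trans (le_of_eq ?_)
    ring
  rw [tendsto_iff_norm_sub_tendsto_zero]
  refine squeeze_zero (fun _ => norm_nonneg _) (fun k => bd (ck k)) ?_
  have := (hc.abs).mul_const (wr (En n) * V)
  simpa using this

/-- Right continuity of the entropy at time zero. -/
lemma GG_small {R : En n → Mat d} (h : SG R) {ε : ℝ} (hε : 0 < ε) :
    ∃ s : ℝ, 0 < s ∧ GG R s ≤ hh volume R + ε := by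
  by_contra hcon
  push Not at hcon
  set cc : ℕ → ℝ := fun k => 1 / ((k : ℝ) + 1) with hcc
  have hc0 : Tendsto cc atTop (𝓝 0) := tendsto_one_div_add_atTop_nhds_zero_nat
  have hcp : ∀ k, 0 < cc k := fun k => by rw [hcc]; positivity
  have im := tendstoInMeasure_of_tendsto_eLpNorm one_ne_zero
    (fun k => (h.heat (cc k)).int.1) h.int.1 (heat_L1 h hc0)
  obtain ⟨ns, hns, hae⟩ := im.exists_seq_tendsto_ae
  set ck : ℕ → ℝ := fun k => cc (ns k) with hck
  have hk0 : Tendsto ck atTop (𝓝 0) := hc0.comp hns.tendsto_atTop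
  have hbig : ∀ k, hh volume R + ε < hh volume (heat (ck k) R) := by
    intro k
    have := hcon ((ck k) ^ 2) (by have := hcp (ns k); rw [hck]; positivity)
    rwa [GG, Real.sqrt_sq (hcp _).le] at this
  set M := ∫ x, R x with hM
  set I := ∫ x, rtr (R x) * log (wF (En n) x) with hI
  have a0 := acc_one h.toGD (wF_wt (En n)) (h.gr (Gr_log_wF (En n)))
  have ak := fun k => acc_one (h.heat (ck k)).toGD (wF_wt (En n))
    ((h.heat (ck k)).gr (Gr_log_wF (En n)))
  simp only [heat_integral h] at ak
  have wsm : StronglyMeasurable (fun x : En n => ((wF (En n) x : ℝ) : ℂ) • M) :=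
    sm_smul (wF_wt (En n)).meas stronglyMeasurable_const
  have fatou : ∫⁻ x, D0 (R x) (((wF (En n) x : ℝ) : ℂ) • M)
      ≤ liminf (fun k => ∫⁻ x, D0 (heat (ck k) R x) (((wF (En n) x : ℝ) : ℂ) • M)) atTop := by
    refine le_trans ?_ (lintegral_liminf_le fun k => measurable_D0 (h.heat (ck k)).sm wsm)
    refine lintegral_mono_ae ?_
    filter_upwards [hae] with x hx
    exact D0_lsc hx
  have hlog := heat_log h hk0
  set A := vnEnt M - hh volume R - I with hAdef
  have ev : ∀ᶠ k in atTop, ∫⁻ x, D0 (heat (ck k) R x) (((wF (En n) x : ℝ) : ℂ) • M)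
      ≤ ENNReal.ofReal (A - ε / 2) ∧ 0 ≤ A - ε / 2 := by
    have : ∀ᶠ k in atTop, I - ε / 2 < ∫ x, rtr (heat (ck k) R x) * log (wF (En n) x) :=
      hlog.eventually (lt_mem_nhds (by linarith))
    filter_upwards [this] with k hk
    have hb := hbig k
    obtain ⟨q1, q2⟩ := ak k
    constructor
    · rw [q1]
      refine ENNReal.ofReal_le_ofReal ?_
      rw [hAdef]; linarith
    · rw [hAdef]; linarith
  obtain ⟨k, _, hk⟩ := ev.exists
  have lim : liminf (fun k => ∫⁻ x, D0 (heat (ck k) R x) (((wF (En n) x : ℝ) : ℂ) • M)) atTop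
      ≤ ENNReal.ofReal (A - ε / 2) := by
    refine liminf_le_of_frequently_le' (ev.mono fun k hk => hk.1).frequently
  have fin := fatou.trans lim
  rw [a0.1] at fin
  have := (ENNReal.ofReal_le_ofReal_iff hk).1 fin
  linarith
end small

section final
variable {n d : ℕ}

lemma int_shear {E : Type*} [NormedAddCommGroup E] {f : En n × En n → E} (h : Integrable f) :
    Integrable (fun p : En n × En n => f (p.1, p.2 - p.1)) (volume.prod volume) := by
  have := (shear_sub_mp (n := n)).integrable_comp_of_integrable (g := f) h
  exact this

lemma integral_shear {E : Type*} [NormedAddCommGroup E] [NormedSpace ℝ E]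
    {f : En n × En n → E} (h : Integrable f) :
    ∫ p : En n × En n, f (p.1, p.2 - p.1) ∂(volume.prod volume) = ∫ p, f p := by
  have sh := shear_sub_mp (n := n)
  have e := integral_map (f := f) sh.measurable.aemeasurable (by rw [sh.map_eq]; exact h.1)
  rw [sh.map_eq] at e
  exact e.symm

lemma int_mS {R : En n × En n → Mat d} (h : Integrable R) : ∫ s, mS R s = ∫ p, R p := by
  rw [← integral_shear h, mS_eq]
  exact int_mB (int_shear h)

lemma CQ.atT {R : En n × En n → Mat d} (h : CQ R) {l T : ℝ} (hl0 : 0 < l) (hl1 : l < 1)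
    (hT : 0 < T) :
    GG (mS R) T - hh volume (mS R) ≤
      l * (GG (mA volume R) (l * T) - hh volume (mA volume R))
      + (1 - l) * (GG (mB volume R) ((1 - l) * T) - hh volume (mB volume R)) := by
  refine le_of_forall_pos_le_add fun ε hε => ?_
  obtain ⟨s0, hs0, hs1⟩ := GG_small h.ss hε
  obtain ⟨N, hN⟩ := exists_nat_gt (T / s0)
  have hN0 : (0:ℝ) < N := lt_trans (by positivity) hN
  set s := T / N with hs
  have hsp : 0 ≤ s := by positivity
  have hss : s ≤ s0 := by
    rw [hs, div_le_iff₀ hN0]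
    rw [div_lt_iff₀ hs0] at hN
    linarith
  have hNs : N * s = T := by rw [hs]; field_simp
  have t := h.tele hl0 hl1 hsp N
  rw [add_mul, one_mul, hNs, GG_zero, GG_zero] at t
  have m1 := GG_mono h.ss hT.le hsp
  have m2 := GG_mono h.ss hsp (s := s0 - s) (by linarith)
  rw [add_sub_cancel] at m2
  linarith

lemma CQ.main {R : En n × En n → Mat d} (h : CQ R) {l : ℝ} (hl0 : 0 < l) (hl1 : l < 1)
    (htr : rtr (∫ p, R p) = 1) :
    l * hh volume (mA volume R) + (1 - l) * hh volume (mB volume R)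
      - n * (l * log l + (1 - l) * log (1 - l)) / 2 ≤ hh volume (mS R) := by
  have hl2 : 0 < 1 - l := by linarith
  set A := (∫ x, rtr (mA volume R x) * ‖x‖ ^ 2) with hA
  set B := (∫ x, rtr (mB volume R x) * ‖x‖ ^ 2) with hB
  have eA : ∫ x, mA volume R x = ∫ p, R p := int_mA h.sg.int
  have eB : ∫ x, mB volume R x = ∫ p, R p := int_mB h.sg.int
  have eS : ∫ x, mS R x = ∫ p, R p := int_mS h.sg.int
  have key : ∀ N : ℕ, l * hh volume (mA volume R) + (1 - l) * hh volume (mB volume R)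
      - n * (l * log l + (1 - l) * log (1 - l)) / 2 - (A + B) / 2 * (1 / ((N : ℝ) + 1))
        ≤ hh volume (mS R) := by
    intro N
    set T : ℝ := (N : ℝ) + 1 with hTd
    have hT : 0 < T := by positivity
    clear_value T
    have t := h.atT hl0 hl1 hT
    have q0 := heat_lower h.ss (c := √T) (by positivity)
    have q1 := heat_upper h.sx (c := √(l * T)) (by positivity)
    have q2 := heat_upper h.sy (c := √((1 - l) * T)) (by positivity)
    rw [eS, htr, one_mul, kap, Real.log_sqrt hT.le] at q0
    rw [eA, htr, one_mul, kap, Real.log_sqrt (by positivity), Real.sq_sqrt (by positivity),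
      Real.log_mul hl0.ne' hT.ne', ← hA] at q1
    rw [eB, htr, one_mul, kap, Real.log_sqrt (by positivity), Real.sq_sqrt (by positivity),
      Real.log_mul hl2.ne' hT.ne', ← hB] at q2
    have q1' := mul_le_mul_of_nonneg_left q1 hl0.le
    have q2' := mul_le_mul_of_nonneg_left q2 hl2.le
    have f1 : l * (A / (2 * (l * T))) = A / 2 * (1 / T) := by field_simp
    have f2 : (1 - l) * (B / (2 * ((1 - l) * T))) = B / 2 * (1 / T) := by field_simp
    rw [mul_add l, f1] at q1'
    rw [mul_add (1 - l), f2] at q2'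
    simp only [GG] at t
    linarith
  have lim : Tendsto (fun N : ℕ => l * hh volume (mA volume R) + (1 - l) * hh volume (mB volume R)
      - n * (l * log l + (1 - l) * log (1 - l)) / 2 - (A + B) / 2 * (1 / ((N : ℝ) + 1))) atTop
      (𝓝 (l * hh volume (mA volume R) + (1 - l) * hh volume (mB volume R)
      - n * (l * log l + (1 - l) * log (1 - l)) / 2 - (A + B) / 2 * 0)) :=
    tendsto_const_nhds.sub (tendsto_one_div_add_atTop_nhds_zero_nat.const_mul _)
  rw [mul_zero, sub_zero] at lim
  exact le_of_tendsto' lim key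
end final

section translate
variable {n d : ℕ}

lemma of_integral {α : Type*} [MeasurableSpace α] {ν : Measure α} {R : α → Mat d}
    (hi : Integrable R ν) : (Matrix.of fun i j => ∫ a, R a i j ∂ν) = ∫ a, R a ∂ν := by
  ext i j
  exact ContinuousLinearMap.integral_comp_comm (LinearMap.toContinuousLinearMap
    ({ toFun := fun A => A i j, map_add' := by simp, map_smul' := by simp } : Mat d →ₗ[ℝ] ℂ)) hi

lemma cond_gen {α : Type*} [MeasureSpace α] {q : α → ℝ} {σ R : α → Mat d}
    (hint : Integrable R)
    (hσ : ∀ᵐ x, (σ x).PosSemidef ∧ R x = (q x : ℂ) • σ x ∧ q x * rtr (σ x) = q x ∧ 0 ≤ q x)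
    (hf : EntFinite q σ) :
    condEnt q σ = hh volume R - vnEnt (∫ x, R x) ∧
    Integrable (fun x => rtr (R x) * log (rtr (R x))) := by
  constructor
  · have e1 : avgState q σ = ∫ x, R x := by
      have : avgState q σ = Matrix.of fun i j => ∫ a, R a i j := by
        unfold avgState
        congr 1
        funext i j
        refine integral_congr_ae ?_
        filter_upwards [hσ] with x hx
        rw [hx.2.1]
        simp
      rw [this, of_integral hint]
    have e2 : hh volume R = (∫ x, q x * vnEnt (σ x)) - ∫ x, q x * log (q x) := by
      rw [← integral_sub hf.2 hf.1]
      refine integral_congr_ae ?_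
      filter_upwards [hσ] with x hx
      obtain ⟨h1, h2, h3, h4⟩ := hx
      rw [h2, vnEnt_smul h1 h4]
      linear_combination (-log (q x)) * h3
    unfold condEnt clEnt
    rw [e1, e2]
    ring
  · refine hf.1.congr ?_
    filter_upwards [hσ] with x hx
    rw [hx.2.1, rtr_smul, hx.2.2.1]

lemma cond_inv {q : ℝ} {σ R : Mat d} (hR : R.PosSemidef) (hq : rtr R = q)
    (hσ : σ = (q : ℂ)⁻¹ • R) :
    σ.PosSemidef ∧ R = (q : ℂ) • σ ∧ q * rtr σ = q ∧ 0 ≤ q := by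
  have q0 : 0 ≤ q := hq ▸ rtr_nonneg hR
  have hσ' : σ = ((q⁻¹ : ℝ) : ℂ) • R := by rw [hσ]; push_cast; rfl
  refine ⟨by rw [hσ']; exact psd_smul (by positivity) hR, ?_, ?_, q0⟩
  · by_cases h0 : q = 0
    · have : ‖R‖ ≤ 0 := by rw [← h0, ← hq]; exact norm_le_rtr hR
      have r0 : R = 0 := norm_le_zero_iff.1 this
      rw [hσ, r0]; simp
    · rw [hσ, smul_smul, mul_inv_cancel₀ (by exact_mod_cast h0), one_smul]
  · by_cases h0 : q = 0
    · simp [h0]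
    · rw [hσ', rtr_smul, hq]; field_simp

/-- The unnormalized joint state. -/
def jR (p : En n × En n → ℝ) (ρ : En n × En n → Mat d) : En n × En n → Mat d :=
  fun z => (p z : ℂ) • ρ z

lemma jR_int {p : En n × En n → ℝ} {ρ : En n × En n → Mat d} (hp : Measurable p)
    (hp0 : ∀ z, 0 ≤ p z) (hpi : Integrable p (volume.prod volume)) (hρ : StronglyMeasurable ρ)
    (hs : ∀ z, IsState (ρ z)) :
    StronglyMeasurable (jR p ρ) ∧ (∀ z, (jR p ρ z).PosSemidef) ∧ (∀ z, rtr (jR p ρ z) = p z) ∧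
    Integrable (jR p ρ) (volume.prod volume) := by
  have a1 := sm_smul hp hρ
  have a2 : ∀ z, (jR p ρ z).PosSemidef := fun z => psd_smul (hp0 z) (hs z).1
  have a3 : ∀ z, rtr (jR p ρ z) = p z := fun z => by
    have : rtr (ρ z) = 1 := by simp [rtr, (hs z).2]
    rw [jR, rtr_smul, this, mul_one]
  exact ⟨a1, a2, a3, integrable_mat a1.aestronglyMeasurable a2 (by simpa only [a3] using hpi)⟩

lemma marg_gen {p : En n × En n → ℝ} {ρ : En n × En n → Mat d} (hp : Measurable p)
    (hp0 : ∀ z, 0 ≤ p z) (hpi : Integrable p (volume.prod volume)) (hρ : StronglyMeasurable ρ)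
    (hs : ∀ z, IsState (ρ z))
    (hm : Integrable (fun z : En n × En n => ‖z.2‖ ^ 2 * p z) (volume.prod volume))
    (hf : EntFinite (margSnd p) (margSndState p ρ)) :
    SG (mB volume (jR p ρ)) ∧ condEnt (margSnd p) (margSndState p ρ)
      = hh volume (mB volume (jR p ρ)) - vnEnt (∫ z, jR p ρ z ∂(volume.prod volume)) := by
  obtain ⟨a1, a2, a3, a4⟩ := jR_int hp hp0 hpi hρ hs
  have sec : ∀ᵐ y : En n, Integrable (fun x : En n => jR p ρ (x, y)) := a4.prod_left_ae
  have hq : ∀ᵐ y : En n, rtr (mB volume (jR p ρ) y) = margSnd p y := by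
    filter_upwards [sec] with y hy
    rw [mB, rtr_integral hy]
    simp only [a3]
    rfl
  have psd : ∀ y, (mB volume (jR p ρ) y).PosSemidef := fun y => psd_integral fun x => a2 _
  have hint : Integrable (mB volume (jR p ρ)) := a4.integral_prod_right
  have hσ : ∀ᵐ y : En n, (margSndState p ρ y).PosSemidef ∧
      mB volume (jR p ρ) y = (margSnd p y : ℂ) • margSndState p ρ y ∧
      margSnd p y * rtr (margSndState p ρ y) = margSnd p y ∧ 0 ≤ margSnd p y := by
    filter_upwards [sec, hq] with y hy hy2
    refine cond_inv (psd y) hy2 ?_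
    unfold margSndState mB
    rw [← of_integral hy]
    rfl
  obtain ⟨c1, c2⟩ := cond_gen hint hσ hf
  rw [int_mB a4] at c1
  refine ⟨⟨⟨mB_sm a1, psd, hint, c2⟩, ?_⟩, c1⟩
  refine hm.integral_prod_right.congr ?_
  filter_upwards [hq] with y hy
  rw [hy, margSnd]
  exact integral_const_mul _ _

lemma sg_joint {p : En n × En n → ℝ} {ρ : En n × En n → Mat d} (hp : Measurable p)
    (hp0 : ∀ z, 0 ≤ p z) (hpi : Integrable p) (hρ : StronglyMeasurable ρ)
    (hs : ∀ z, IsState (ρ z))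
    (hX2 : Integrable fun z : En n × En n => ‖z.1‖ ^ 2 * p z)
    (hY2 : Integrable fun z : En n × En n => ‖z.2‖ ^ 2 * p z)
    (hf : EntFinite p ρ) :
    SG (jR p ρ) ∧ condEnt p ρ = hh volume (jR p ρ) - vnEnt (∫ z, jR p ρ z) := by
  obtain ⟨a1, a2, a3, a4⟩ := jR_int hp hp0 hpi hρ hs
  obtain ⟨c1, c2⟩ := cond_gen (q := p) (σ := ρ) (R := jR p ρ) a4
    (Eventually.of_forall fun z => ⟨(hs z).1, rfl, by simp [rtr, (hs z).2], hp0 z⟩) hf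
  refine ⟨⟨⟨a1, a2, a4, c2⟩, ?_⟩, c1⟩
  simp only [a3]
  refine (hX2.add hY2).mono' ?_ (Eventually.of_forall fun z => ?_)
  · exact ((measurable_norm.pow_const 2).mul hp).aestronglyMeasurable
  · rw [Real.norm_of_nonneg (mul_nonneg (by positivity) (hp0 z)), Pi.add_apply, ← add_mul]
    refine mul_le_mul_of_nonneg_right ?_ (hp0 z)
    rw [Prod.norm_def]
    rcases max_cases ‖z.1‖ ‖z.2‖ with ⟨h, _⟩ | ⟨h, _⟩ <;> rw [h] <;> nlinarith [sq_nonneg ‖z.1‖, sq_nonneg ‖z.2‖]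

lemma epi_main (p : En n × En n → ℝ) (ρ : En n × En n → Matrix (Fin d) (Fin d) ℂ)
    (hcq : IsCQState p ρ)
    (hX2 : Integrable fun z : En n × En n => ‖z.1‖ ^ 2 * p z)
    (hY2 : Integrable fun z : En n × En n => ‖z.2‖ ^ 2 * p z)
    (hXYfin : EntFinite p ρ)
    (hXfin : EntFinite (margFst p) (margFstState p ρ))
    (hYfin : EntFinite (margSnd p) (margSndState p ρ))
    (hSfin : EntFinite (sumDensity p) (sumState p ρ))
    (hindep : condMI p ρ = 0) (l : ℝ) (hl0 : 0 < l) (hl1 : l < 1) :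
      l * condEnt (margFst p) (margFstState p ρ)
          + (1 - l) * condEnt (margSnd p) (margSndState p ρ)
          - n * (l * Real.log l + (1 - l) * Real.log (1 - l)) / 2
        ≤ condEnt (sumDensity p) (sumState p ρ) := by
  obtain ⟨hp, hp0, hp1, hρc, hs⟩ := hcq
  have hpi : Integrable p := by
    by_contra h
    rw [integral_undef h] at hp1
    exact zero_ne_one hp1
  have hρ : StronglyMeasurable ρ := by
    have hc : Continuous (ρ : En n × En n → Mat d) := hρc
    exact hc.stronglyMeasurable
  obtain ⟨b1, b2, b3, b4⟩ := jR_int hp hp0 hpi hρ hs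
  -- the joint state
  obtain ⟨gJ, eJ⟩ := sg_joint hp hp0 hpi hρ hs hX2 hY2 hXYfin
  -- the second marginal
  obtain ⟨gY, eY⟩ := marg_gen hp hp0 hpi hρ hs hY2 hYfin
  -- the first marginal
  have hpi' : Integrable (fun z : En n × En n => p z.swap) (volume.prod volume) := hpi.swap
  have hX2' : Integrable (fun z : En n × En n => ‖z.2‖ ^ 2 * p z.swap) (volume.prod volume) :=
    hX2.swap
  obtain ⟨gX, eX⟩ := marg_gen (p := fun z => p z.swap) (ρ := fun z => ρ z.swap)
    (hp.comp measurable_swap) (fun z => hp0 _) hpi' (hρ.comp_measurable measurable_swap)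
    (fun z => hs _) hX2' hXfin
  have iX : ∫ z : En n × En n, jR (fun z => p z.swap) (fun z => ρ z.swap) z ∂(volume.prod volume)
      = ∫ z, jR p ρ z := integral_prod_swap (jR p ρ)
  -- the sum
  have hsh : Measurable (fun z : En n × En n => (z.1, z.2 - z.1)) := by fun_prop
  have hS2 : Integrable (fun z : En n × En n => ‖z.1 + z.2‖ ^ 2 * p z) := by
    refine ((hX2.add hY2).const_mul 2).mono' ?_ (Eventually.of_forall fun z => ?_)
    · exact (((measurable_fst.add measurable_snd).norm.pow_const 2).mul hp).aestronglyMeasurable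
    · rw [Real.norm_of_nonneg (mul_nonneg (by positivity) (hp0 z)), Pi.add_apply, ← add_mul,
        ← mul_assoc]
      refine mul_le_mul_of_nonneg_right ?_ (hp0 z)
      have := norm_add_le z.1 z.2
      nlinarith [sq_nonneg (‖z.1‖ - ‖z.2‖), norm_nonneg (z.1 + z.2)]
  have hS2' : Integrable (fun z : En n × En n => ‖z.2‖ ^ 2 * p (z.1, z.2 - z.1))
      (volume.prod volume) := by
    refine (int_shear hS2).congr (Eventually.of_forall fun z => ?_)
    simp
  obtain ⟨gS, eS⟩ := marg_gen (p := fun z => p (z.1, z.2 - z.1)) (ρ := fun z => ρ (z.1, z.2 - z.1))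
    (hp.comp hsh) (fun z => hp0 _) (int_shear hpi) (hρ.comp_measurable hsh)
    (fun z => hs _) hS2' hSfin
  have iS : ∫ z : En n × En n, jR (fun z => p (z.1, z.2 - z.1)) (fun z => ρ (z.1, z.2 - z.1)) z
      ∂(volume.prod volume) = ∫ z, jR p ρ z := integral_shear b4
  rw [iX] at eX
  rw [iS] at eS
  have iY : ∫ z, jR p ρ z ∂(volume.prod volume) = ∫ z, jR p ρ z := rfl
  rw [iY] at eY
  have fX : mB volume (jR (fun z => p z.swap) (fun z => ρ z.swap)) = mA volume (jR p ρ) := rfl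
  have fS : mB volume (jR (fun z => p (z.1, z.2 - z.1)) (fun z => ρ (z.1, z.2 - z.1)))
    = mS (jR p ρ) := rfl
  rw [fX] at gX eX
  rw [fS] at gS eS
  have eX' : condEnt (margFst p) (margFstState p ρ)
      = hh volume (mA volume (jR p ρ)) - vnEnt (∫ z, jR p ρ z) := eX
  have eS' : condEnt (sumDensity p) (sumState p ρ)
      = hh volume (mS (jR p ρ)) - vnEnt (∫ z, jR p ρ z) := eS
  have hCQ : CQ (jR p ρ) := by
    refine ⟨gJ, gX, gY, gS, ?_⟩
    unfold condMI at hindep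
    rw [eX', eY, eJ] at hindep
    linarith
  have htr : rtr (∫ z, jR p ρ z) = 1 := by
    rw [rtr_integral gJ.int]
    simp only [b3]
    exact hp1
  have := hCQ.main hl0 hl1 htr
  rw [eX', eY, eS']
  linarith
end translate

end epi_proof

/-- The linear Entropy Power Inequality with quantum conditioning: for `X`, `Y`
conditionally independent given the quantum system `M` and `0 < λ < 1`,
`S(X+Y|M) ≥ λ S(X|M) + (1-λ) S(Y|M) - n (λ ln λ + (1-λ) ln (1-λ))/2`. -/
theorem linear_entropy_power_inequality_quantum_conditioning {n d : ℕ}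
    (p : En n × En n → ℝ) (ρ : En n × En n → Matrix (Fin d) (Fin d) ℂ)
    (hcq : IsCQState p ρ)
    (hX2 : Integrable fun z : En n × En n => ‖z.1‖ ^ 2 * p z)
    (hY2 : Integrable fun z : En n × En n => ‖z.2‖ ^ 2 * p z)
    (hXYfin : EntFinite p ρ)
    (hXfin : EntFinite (margFst p) (margFstState p ρ))
    (hYfin : EntFinite (margSnd p) (margSndState p ρ))
    (hSfin : EntFinite (sumDensity p) (sumState p ρ))
    (hindep : condMI p ρ = 0) :
    ∀ l : ℝ, 0 < l → l < 1 →
      condEnt (sumDensity p) (sumState p ρ)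
        ≥ l * condEnt (margFst p) (margFstState p ρ)
          + (1 - l) * condEnt (margSnd p) (margSndState p ρ)
          - n * (l * Real.log l + (1 - l) * Real.log (1 - l)) / 2 := by
  intro l hl0 hl1
  exact epi_main p ρ hcq hX2 hY2 hXYfin hXfin hYfin hSfin hindep l hl0 hl1

end
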